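/- Let f(x) = 8x⁷ − 16x⁵ − 7x⁴ + 4x³ + 6x² + 4x + 1. For every quadratic field k and all x, y ∈ k with y² = f(x), if x is not rational and y ≠ 0, then (2x − 1)² = 5 in k (that is, x = (1 ± √5)/2). -/

import Mathlib

namespace QP

lemma four {x y k : ℤ} (hx : 0 < x) (hy : 0 < y) (hc : IsCoprime x y) (h : x*y = k^4) :
    ∃ r t : ℤ, x = r^4 ∧ y = t^4 ∧ k^2 = r^2*t^2 ∧ IsCoprime r t := by
  obtain ⟨r, hr⟩ := exists_associated_pow_of_mul_eq_pow' hc h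
  obtain ⟨t, ht⟩ := exists_associated_pow_of_mul_eq_pow' hc.symm (by rw [mul_comm]; exact h)
  have h1 : x = r^4 := by
    rcases Int.associated_iff.1 hr with h1 | h1
    · exact h1.symm
    · have : 0 ≤ r^4 := by positivity
      omega
  have h2 : y = t^4 := by
    rcases Int.associated_iff.1 ht with h1 | h1
    · exact h1.symm
    · have : 0 ≤ t^4 := by positivity
      omega
  refine ⟨r, t, h1, h2, ?_, ?_⟩
  · have h3 : (k^2)^2 = (r^2*t^2)^2 := by
      rw [h1, h2] at h; linear_combination -h
    exact (sq_eq_sq₀ (by positivity) (by positivity)).1 h3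
  · rw [h1, h2] at hc
    exact (IsCoprime.pow_iff (by norm_num) (by norm_num)).1 hc

/-- coprimality through primes -/
lemma cop_of {x y : ℤ} (h : ∀ p : ℤ, Prime p → p ∣ x → p ∣ y → False) : IsCoprime x y := by
  by_contra hc
  have hg : ¬ (Int.gcd x y = 1) := fun hg => hc (Int.isCoprime_iff_gcd_eq_one.2 hg)
  obtain ⟨p, hp, hpd⟩ := Nat.exists_prime_and_dvd hg
  have hpd' : (p : ℤ) ∣ (Int.gcd x y : ℤ) := Int.natCast_dvd_natCast.2 hpd
  exact h p (Nat.prime_iff_prime_int.1 hp) (hpd'.trans (Int.gcd_dvd_left ..))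
    (hpd'.trans (Int.gcd_dvd_right ..))

lemma no_p {x y p : ℤ} (hc : IsCoprime x y) (hp : Prime p) (h1 : p ∣ x) (h2 : p ∣ y) : False :=
  hp.not_isUnit (hc.isUnit_of_dvd' h1 h2)

/-- prime power splits over a coprime product -/
lemma ppow_split {x y p N : ℤ} (e : ℕ) (hp : Prime p) (hc : IsCoprime x y)
    (h : x*y = p^e*N) : p^e ∣ x ∨ p^e ∣ y := by
  by_cases hx : p ∣ x
  · left
    have hy : ¬ p ∣ y := fun hy => no_p hc hp hx hy
    exact hp.pow_dvd_of_dvd_mul_right e hy ⟨N, h⟩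
  · right
    exact hp.pow_dvd_of_dvd_mul_left e hx ⟨N, h⟩

lemma four_p {x y k p : ℤ} (e : ℕ) (hp : Prime p) (hp0 : 0 < p) (hx : 0 < x) (hy : 0 < y) (hc : IsCoprime x y)
    (h : x*y = p^e*k^4) :
    ∃ r t : ℤ, k^2 = r^2*t^2 ∧ IsCoprime r t ∧
      ((x = r^4 ∧ y = p^e*t^4) ∨ (x = p^e*t^4 ∧ y = r^4)) := by
  have hpe : 0 < p^e := by positivity
  rcases ppow_split e hp hc h with ⟨x', rfl⟩ | ⟨y', rfl⟩
  · have hx' : 0 < x' := by exact (pos_iff_pos_of_mul_pos hx).1 hpe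
    obtain ⟨r, t, h1, h2, h3, h4⟩ := four hx' hy hc.of_mul_left_right
      (by have := mul_left_cancel₀ hpe.ne' (show p^e*(x'*y) = p^e*k^4 by rw [← h]; ring)
          exact this)
    exact ⟨t, r, by rw [h3]; ring, h4.symm, Or.inr ⟨by rw [h1], h2⟩⟩
  · have hy' : 0 < y' := by exact (pos_iff_pos_of_mul_pos hy).1 hpe
    obtain ⟨r, t, h1, h2, h3, h4⟩ := four hx hy' hc.of_mul_right_right
      (by have := mul_left_cancel₀ hpe.ne' (show p^e*(x*y') = p^e*k^4 by rw [← h]; ring)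
          exact this)
    exact ⟨r, t, h3, h4, Or.inl ⟨h1, by rw [h2]⟩⟩

lemma prime5 : Prime (5 : ℤ) := by norm_num [Int.prime_iff_natAbs_prime]
lemma prime71 : Prime (71 : ℤ) := by norm_num [Int.prime_iff_natAbs_prime]
lemma prime2 : Prime (2 : ℤ) := Int.prime_two
lemma prime3 : Prime (3 : ℤ) := Int.prime_three

lemma odd_sq8 {a : ℤ} (h : a % 2 = 1) : a^2 % 8 = 1 := by
  have : a % 8 = 1 ∨ a % 8 = 3 ∨ a % 8 = 5 ∨ a % 8 = 7 := by omega
  rcases this with h | h | h | h <;> simp [pow_two, Int.mul_emod, h]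

end QP

namespace QP

lemma dvd_of_sqf {p x y c B : ℤ} {n : ℕ} (hp : Prime p) (hc : Squarefree c) (h : x*y = c*B^n)
    (hx : p ∣ x) (hy : p ∣ y) : p ∣ B := by
  by_contra hB
  have h1 : p*p ∣ c*B^n := h ▸ mul_dvd_mul hx hy
  have hcop : IsCoprime (p*p) (B^n) := by
    have : IsCoprime p B := (Prime.coprime_iff_not_dvd hp).2 hB
    exact IsCoprime.pow_right (IsCoprime.mul_left this this)
  exact hp.not_isUnit (hc p (hcop.dvd_of_dvd_mul_right h1))

lemma pos_of_mul_add {x y : ℤ} (h : 0 < x*y) (hs : 0 < x + y) : 0 < x ∧ 0 < y := by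
  rcases (mul_pos_iff.1 h) with h | h
  · exact h
  · omega

end QP
namespace QP
lemma not_two {p x : ℤ} (hp : Prime p) (h : x % 2 = 1) (hd : p ∣ x) {y : ℤ} (h2 : p ∣ 2*y) : p ∣ y := by
  rcases hp.dvd_or_dvd h2 with h3 | h3
  · exfalso
    have := Int.natAbs_dvd_natAbs.2 h3
    have hp' := Int.prime_iff_natAbs_prime.1 hp
    have h4 : p.natAbs = 2 := (Nat.prime_dvd_prime_iff_eq hp' Nat.prime_two).1 (by simpa using this)
    have : (2:ℤ) ∣ x := by
      rcases Int.natAbs_eq_iff.1 h4 with h5 | h5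
      · rw [h5] at hd; exact_mod_cast hd
      · rw [h5] at hd; exact (neg_dvd.1 hd)
    omega
  · exact h3

lemma odd_of_sq {a : ℤ} (h : a^2 % 2 = 1) : a % 2 = 1 := by
  rcases Int.emod_two_eq_zero_or_one a with h1 | h1
  · simp [pow_two, Int.mul_emod, h1] at h
  · exact h1

lemma even_of_sq {a : ℤ} (h : a^2 % 2 = 0) : a % 2 = 0 := by
  rcases Int.emod_two_eq_zero_or_one a with h1 | h1
  · exact h1
  · simp [pow_two, Int.mul_emod, h1] at h

lemma odd_mul_sq {a b : ℤ} (h : (a^2*b^2) % 2 = 1) : a % 2 = 1 ∧ b % 2 = 1 := by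
  rcases Int.emod_two_eq_zero_or_one a with h1 | h1 <;> rcases Int.emod_two_eq_zero_or_one b with h2 | h2 <;>
    simp [pow_two, Int.mul_emod, h1, h2] at h ⊢

lemma sq4 (a : ℤ) : (a % 2 = 0 ∧ a^2 % 4 = 0) ∨ (a % 2 = 1 ∧ a^2 % 8 = 1) := by
  rcases Int.emod_two_eq_zero_or_one a with h1 | h1
  · left; refine ⟨h1, ?_⟩
    obtain ⟨c, rfl⟩ : (2:ℤ) ∣ a := by omega
    ring_nf; omega
  · right; exact ⟨h1, odd_sq8 h1⟩

lemma E_one {A B C : ℤ} (hB : B^2 = 1) (h : C^2 = A^4 + A^2*B^2 - B^4) : A^2 = 1 := by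
  have h4 : B^4 = 1 := by rw [show B^4 = (B^2)^2 by ring, hB]; norm_num
  rw [hB, h4] at h
  have hA : A ≠ 0 := by rintro rfl; nlinarith [sq_nonneg C]
  have : 1 ≤ A^2 := by have := sq_pos_of_ne_zero hA; omega
  by_contra hne
  have h2 : 1 < A^2 := by omega
  have h3 : A^2 < |C| := by apply lt_abs.2; by_contra hh; push Not at hh; nlinarith
  have h5 : |C| < A^2 + 1 := by apply abs_lt.2; constructor <;> nlinarith
  omega

lemma nat_lt {i B c : ℤ} (hi : i ≠ 0) (hc : 1 < c) (h : B^2 = c*i^2) : i.natAbs < B.natAbs := by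
  rw [Int.natAbs_lt_iff_sq_lt, h]
  have : 0 < i^2 := by positivity
  nlinarith

lemma E_desc (n : ℕ) : ∀ A B C : ℤ, B.natAbs ≤ n → IsCoprime A B → B ≠ 0 →
    C^2 = A^4 + A^2*B^2 - B^4 → A^2 = 1 ∧ B^2 = 1 := by
  induction n using Nat.strong_induction_on with
  | _ n ih =>
  intro A0 B C hn hc0 hB h0
  obtain ⟨A, hA, hA2⟩ : ∃ A : ℤ, 0 ≤ A ∧ A^2 = A0^2 := ⟨|A0|, abs_nonneg _, sq_abs _⟩
  have hc : IsCoprime A B := by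
    have : IsCoprime (A0^2) B := IsCoprime.pow_left hc0
    rw [← hA2] at this
    exact (IsCoprime.pow_left_iff (by norm_num)).1 this
  have h : C^2 = A^4 + A^2*B^2 - B^4 := by
    rw [h0]; linear_combination (-A^2 - A0^2 - B^2)*hA2
  rw [← hA2]
  suffices hB1 : B^2 = 1 from ⟨E_one hB1 h, hB1⟩
  have hB2 : 0 < B^2 := by positivity
  have hApos : 0 < A := by
    rcases hA.lt_or_eq with h1 | h1
    · exact h1
    · rw [← h1] at h; nlinarith [sq_nonneg C]
  have hAB : ¬ (A % 2 = 0 ∧ B % 2 = 0) := fun hh =>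
    no_p hc prime2 (Int.dvd_of_emod_eq_zero hh.1) (Int.dvd_of_emod_eq_zero hh.2)
  have key : ∀ r i j : ℤ, IsCoprime i j → i ≠ 0 → i.natAbs < B.natAbs → r^2 = j^4 + i^2*j^2 - i^4 →
      i^2 = 1 ∧ j^2 = 1 ∧ r^2 = 1 := by
    intro r i j hij hi hlt hr
    have := ih i.natAbs (by omega) j i r le_rfl hij.symm hi (by rw [hr]; ring)
    refine ⟨this.2, this.1, ?_⟩
    rw [hr, show j^4 + i^2*j^2 - i^4 = (j^2)^2 + i^2*j^2 - (i^2)^2 by ring, this.1, this.2]; norm_num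
  have hAodd : A % 2 = 1 := by
    rcases sq4 A with ⟨h1, h2⟩ | h1
    · exfalso
      obtain ⟨a, ha⟩ : (4:ℤ) ∣ A^2 := by omega
      have hb : B^2 % 8 = 1 := odd_sq8 (by omega)
      obtain ⟨b, hb⟩ : ∃ b, B^2 = 8*b + 1 := ⟨B^2 / 8, by omega⟩
      have : C^2 = 4*(4*a^2 + a*B^2 - 16*b^2 - 4*b) - 1 := by
        rw [h]; linear_combination (A^2 + 4*a + B^2)*ha + (- B^2 - 8*b - 1)*hb
      rcases sq4 C with h | h <;> omega
    · exact h1.1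
  rcases Int.emod_two_eq_zero_or_one B with hBe | hBo
  · obtain ⟨b, rfl⟩ : (2:ℤ) ∣ B := by omega
    have hb : b ≠ 0 := by rintro rfl; simp at hB
    have hCo : C % 2 = 1 := by
      apply odd_of_sq; rw [h]
      have : A^2 % 8 = 1 := odd_sq8 hAodd
      obtain ⟨a, ha⟩ : ∃ a, A^2 = 8*a + 1 := ⟨A^2 / 8, by omega⟩
      rw [show A^4 + A^2*(2*b)^2 - (2*b)^4 = 2*(32*a^2 + 8*a + (8*a + 1)*2*b^2 - 8*b^4) + 1 by
        rw [show A^4 = (A^2)^2 by ring, ha]; ring]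
      omega
    have hAsq := odd_sq8 hAodd
    obtain ⟨x, hx⟩ : (2:ℤ) ∣ A^2 + 2*b^2 - C := by omega
    obtain ⟨y, hy⟩ : (2:ℤ) ∣ A^2 + 2*b^2 + C := by omega
    have hxy : x*y = 5^1*b^4 := by
      have : 4*(x*y) = 4*(5^1*b^4) := by
        rw [show 4*(x*y) = (2*x)*(2*y) by ring, ← hx, ← hy]; linear_combination -h
      omega
    have hsum : x + y = A^2 + 2*b^2 := by omega
    obtain ⟨hx0, hy0⟩ := pos_of_mul_add (by rw [hxy]; positivity) (by rw [hsum]; positivity)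
    have hcop : IsCoprime x y := cop_of fun p hp h1 h2 => by
      have hpb : p ∣ b := dvd_of_sqf hp (c := 5^1) (by rw [pow_one]; exact prime5.squarefree) hxy h1 h2
      have : p ∣ A^2 := by
        have := dvd_sub (hsum ▸ dvd_add h1 h2) (Dvd.dvd.mul_left (dvd_pow hpb two_ne_zero) 2)
        simpa using this
      exact no_p hc hp (hp.dvd_of_dvd_pow this) (hpb.mul_left 2)
    obtain ⟨r, t, hrt, hcrt, hor⟩ := four_p 1 prime5 (by norm_num) hx0 hy0 hcop hxy
    have hs2 : A^2 = r^4 - 2*(r^2*t^2) + 5*t^4 := by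
      rw [← hrt]; rcases hor with ⟨h1, h2⟩ | ⟨h1, h2⟩ <;> rw [h1, h2] at hsum <;> linear_combination -hsum
    have ht0 : t ≠ 0 := by rintro rfl; simp at hrt; exact hb hrt
    have hr0 : r ≠ 0 := by rintro rfl; simp at hrt; exact hb hrt
    have hpar : (r^2 - t^2) % 2 = 1 := by
      apply odd_of_sq
      rw [show (r^2 - t^2)^2 = A^2 - 4*t^4 by rw [hs2]; ring]; omega
    obtain ⟨u, hu⟩ : (2:ℤ) ∣ A - (r^2 - t^2) := by omega
    obtain ⟨v, hv⟩ : (2:ℤ) ∣ A + (r^2 - t^2) := by omega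
    have huv : u*v = 1*t^4 := by
      have : 4*(u*v) = 4*(1*t^4) := by
        rw [show 4*(u*v) = (2*u)*(2*v) by ring, ← hu, ← hv]; linear_combination hs2
      omega
    have hsum2 : u + v = A := by omega
    obtain ⟨hu0, hv0⟩ := pos_of_mul_add (by rw [huv]; positivity) (by rw [hsum2]; positivity)
    have hcop2 : IsCoprime u v := cop_of fun p hp h1 h2 => by
      have hpt : p ∣ t := dvd_of_sqf hp squarefree_one huv h1 h2
      have h3 : p ∣ b := hp.dvd_of_dvd_pow (n := 2) (by rw [hrt]; exact Dvd.dvd.mul_left (dvd_pow hpt two_ne_zero) _)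
      exact no_p hc hp (hsum2 ▸ dvd_add h1 h2) (h3.mul_left 2)
    obtain ⟨i, j, hi, hj, hij, hcij⟩ := four hu0 hv0 hcop2 (by rw [huv, one_mul])
    have hr : r^2 = j^4 + i^2*j^2 - i^4 := by rw [← hij, ← hi, ← hj]; omega
    have hi0 : i ≠ 0 := by rintro rfl; simp at hij; exact ht0 hij
    have hj0 : j ≠ 0 := by rintro rfl; simp at hij; exact ht0 hij
    have hlt : i.natAbs < (2*b).natAbs := by
      refine nat_lt (c := 4*r^2*j^2) hi0 ?_ (by linear_combination 4*hrt + 4*r^2*hij)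
      have : 0 < r^2*j^2 := by positivity
      nlinarith
    have := key r i j hcij hi0 hlt hr
    exfalso
    rw [hij, this.1, this.2.1, this.2.2] at hpar
    norm_num at hpar
  · have hAsq := odd_sq8 hAodd
    have hBsq := odd_sq8 hBo
    have hxy : (2*A^2 + B^2 - 2*C)*(2*A^2 + B^2 + 2*C) = 5^1*B^4 := by
      linear_combination -4*h
    have hsum : (2*A^2 + B^2 - 2*C) + (2*A^2 + B^2 + 2*C) = 2*(2*A^2 + B^2) := by ring
    obtain ⟨hx0, hy0⟩ := pos_of_mul_add (by rw [hxy]; positivity) (by rw [hsum]; positivity)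
    have hcop : IsCoprime (2*A^2 + B^2 - 2*C) (2*A^2 + B^2 + 2*C) := cop_of fun p hp h1 h2 => by
      have hpb : p ∣ B := dvd_of_sqf hp (c := 5^1) (by rw [pow_one]; exact prime5.squarefree) hxy h1 h2
      have h3 : p ∣ 2*A^2 + B^2 := not_two hp hBo hpb (hsum ▸ dvd_add h1 h2)
      have : p ∣ 2*A^2 := by
        have := dvd_sub h3 (dvd_pow hpb two_ne_zero)
        simpa using this
      exact no_p hc hp (hp.dvd_of_dvd_pow (not_two hp hBo hpb this)) hpb
    obtain ⟨r, t, hrt, hcrt, hor⟩ := four_p 1 prime5 (by norm_num) hx0 hy0 hcop hxy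
    have hs2 : 4*A^2 = r^4 - 2*(r^2*t^2) + 5*t^4 := by
      rw [← hrt]; rcases hor with ⟨h1, h2⟩ | ⟨h1, h2⟩ <;> rw [h1, h2] at hsum <;> linear_combination -hsum
    have ht0 : t ≠ 0 := by rintro rfl; simp at hrt; exact hB hrt
    have hr0 : r ≠ 0 := by rintro rfl; simp at hrt; exact hB hrt
    obtain ⟨hro, hto⟩ := odd_mul_sq (a := r) (b := t) (by rw [← hrt]; omega)
    have hrs := odd_sq8 hro
    have hts := odd_sq8 hto
    obtain ⟨g, hg⟩ : (2:ℤ) ∣ (r^2 - t^2) := by omega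
    have huv : (A - g)*(A + g) = 1*t^4 := by
      have : 4*((A - g)*(A + g)) = 4*(1*t^4) := by
        linear_combination hs2 + (r^2 - t^2 + 2*g)*hg
      omega
    have hsum2 : (A - g) + (A + g) = 2*A := by omega
    obtain ⟨hu0, hv0⟩ := pos_of_mul_add (by rw [huv]; positivity) (by rw [hsum2]; positivity)
    have hcop2 : IsCoprime (A - g) (A + g) := cop_of fun p hp h1 h2 => by
      have hpt : p ∣ t := dvd_of_sqf hp squarefree_one huv h1 h2
      have h3 : p ∣ B := hp.dvd_of_dvd_pow (n := 2) (by rw [hrt]; exact Dvd.dvd.mul_left (dvd_pow hpt two_ne_zero) _)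
      exact no_p hc hp (not_two hp hto hpt (hsum2 ▸ dvd_add h1 h2)) h3
    obtain ⟨i, j, hi, hj, hij, hcij⟩ := four hu0 hv0 hcop2 (by rw [huv, one_mul])
    have hr : r^2 = j^4 + i^2*j^2 - i^4 := by rw [← hij, ← hi, ← hj]; omega
    have hi0 : i ≠ 0 := by rintro rfl; simp at hij; exact ht0 hij
    have hj0 : j ≠ 0 := by rintro rfl; simp at hij; exact ht0 hij
    have hrj : 0 < r^2*j^2 := by positivity
    have hBe : B^2 = (r^2*j^2)*i^2 := by linear_combination hrt + r^2*hij
    rcases (show r^2*j^2 = 1 ∨ 1 < r^2*j^2 by omega) with h1 | h1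
    · have hj1 : j^2 = 1 := by
        have := Int.isUnit_iff.1 (IsUnit.of_mul_eq_one (r^2) (by rw [mul_comm]; exact h1) : IsUnit (j^2))
        have : 0 < j^2 := by positivity
        omega
      have hr1 : r^2 = 1 := by rw [hj1] at h1; omega
      have : i^2*(i^2 - 1) = 0 := by
        rw [hr1, show j^4 = (j^2)^2 by ring, hj1] at hr; linear_combination hr
      have : i^2 = 1 := by
        rcases mul_eq_zero.1 this with h | h
        · exact absurd h (by positivity)
        · omega
      rw [hBe, h1, this]; norm_num
    · have := key r i j hcij hi0 (nat_lt hi0 h1 hBe) hr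
      rw [hBe, this.1, this.2.1, this.2.2]; norm_num

lemma int_sq {r : ℚ} {N : ℤ} (h : r^2 = N) : ∃ y : ℤ, N = y^2 := by
  have : IsSquare (N : ℚ) := ⟨r, by rw [← h]; ring⟩
  obtain ⟨y, hy⟩ := Rat.isSquare_intCast_iff.1 this
  exact ⟨y, by rw [hy]; ring⟩

lemma q_ne {n m : ℤ} (hm : m ≠ 0) : n^2 + n*m - m^2 ≠ 0 := by
  intro h
  have h5 : ((2*n + m : ℤ) / m : ℚ)^2 = (5 : ℤ) := by
    have hm' : (m : ℚ) ≠ 0 := by exact_mod_cast hm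
    have hq : (n : ℚ)^2 + n*m - m^2 = 0 := by exact_mod_cast h
    field_simp; push_cast; linear_combination 4*hq
  obtain ⟨y, hy⟩ := int_sq h5
  have : y < 3 := by nlinarith
  have : -3 < y := by nlinarith
  interval_cases y <;> omega

lemma pow_dvd_aux {p a b : ℤ} (hp : Prime p) (hc : IsCoprime a b) (ha : p ∣ a) (h : p ∣ b^2) : False :=
  no_p hc hp ha (hp.dvd_of_dvd_pow h)

/-- rational points on `Y² = w⁴ - 2w² + w`. -/
lemma EQ {w Y : ℚ} (h : Y^2 = w^4 - 2*w^2 + w) : w = 0 ∨ w = 1 ∨ w = 1 / 2 := by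
  obtain ⟨n, m, hm, hnm, rfl⟩ : ∃ n m : ℤ, 0 < m ∧ IsCoprime n m ∧ w = n / m :=
    ⟨w.num, w.den, by exact_mod_cast w.den_pos, Int.isCoprime_iff_gcd_eq_one.2 w.reduced,
      by exact_mod_cast (Rat.num_div_den w).symm⟩
  have hm' : (m : ℚ) ≠ 0 := by exact_mod_cast hm.ne'
  by_cases hn : n = 0
  · left; simp [hn]
  by_cases hN : n - m = 0
  · right; left; rw [show n = m by omega]; field_simp
  right; right
  obtain ⟨N, rfl⟩ : ∃ N, m = n - N := ⟨n - m, by ring⟩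
  rw [sub_sub_cancel] at hN
  have hq := q_ne (n := n) hm.ne'
  rw [show n^2 + n*(n - N) - (n - N)^2 = n^2 + n*N - N^2 by ring] at hq
  obtain ⟨y, hy⟩ : ∃ y : ℤ, n*N*(n^2 + n*N - N^2) = y^2 := by
    apply int_sq (r := Y*(n - N : ℤ)^2)
    rw [mul_pow, h]; push_cast at hm' ⊢
    field_simp; ring
  have hnN : IsCoprime n N := by
    have := hnm; exact cop_of fun p hp h1 h2 => no_p this hp h1 (dvd_sub h1 h2)
  have hnq : IsCoprime n (n^2 + n*N - N^2) := cop_of fun p hp h1 h2 =>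
    pow_dvd_aux hp hnN h1 (by
      rw [show N^2 = n*(n + N) - (n^2 + n*N - N^2) by ring]; exact dvd_sub (h1.mul_right (n + N)) h2)
  have hNq : IsCoprime N (n^2 + n*N - N^2) := cop_of fun p hp h1 h2 =>
    pow_dvd_aux hp hnN.symm h1 (by
      rw [show n^2 = (n^2 + n*N - N^2) + N*(N - n) by ring]; exact dvd_add h2 (h1.mul_right (N - n)))
  obtain ⟨A, hA⟩ := Int.sq_of_isCoprime (hnN.mul_right hnq) (by rw [← mul_assoc]; exact hy)
  obtain ⟨B, hB⟩ := Int.sq_of_isCoprime (hnN.symm.mul_right hNq) (c := y) (by rw [← hy]; ring)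
  obtain ⟨C, hC⟩ := Int.sq_of_isCoprime (hnq.symm.mul_right hNq.symm) (c := y) (by rw [← hy]; ring)
  have hypos : 0 < y^2 := by
    rw [← hy]; have : n*N*(n^2 + n*N - N^2) ≠ 0 := mul_ne_zero (mul_ne_zero hn hN) hq
    rw [hy] at this ⊢; positivity
  have hA0 : A ≠ 0 := by rintro rfl; simp at hA; exact hn hA
  have hB0 : B ≠ 0 := by rintro rfl; simp at hB; exact hN hB
  have hC0 : C ≠ 0 := by rintro rfl; simp at hC; exact hq hC
  have hcAB : IsCoprime A B := cop_of fun p hp h1 h2 => no_p hnN hp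
    (by rcases hA with h | h <;> rw [h] <;> (try rw [dvd_neg]) <;> exact dvd_pow h1 two_ne_zero)
    (by rcases hB with h | h <;> rw [h] <;> (try rw [dvd_neg]) <;> exact dvd_pow h2 two_ne_zero)
  have hABC : 0 < A^2*B^2*C^2 := by positivity
  rcases hA with hA | hA <;> rcases hB with hB | hB <;> rcases hC with hC | hC <;> rw [hC] at hy <;>
    subst hA hB
  · have := E_desc _ A B C le_rfl hcAB hB0 (by linear_combination -hC)
    omega
  · exfalso; nlinarith
  · exfalso; nlinarith
  · have := E_desc _ B A C le_rfl hcAB.symm hA0 (by linear_combination hC)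
    push_cast
    have h1 : (A : ℚ)^2 = 1 := by exact_mod_cast this.2
    have h2 : (B : ℚ)^2 = 1 := by exact_mod_cast this.1
    rw [h1, h2]; norm_num
  · exfalso; nlinarith
  · have := E_desc _ B A C le_rfl hcAB.symm hA0 (by linear_combination hC)
    omega
  · have := E_desc _ A B C le_rfl hcAB hB0 (by linear_combination -hC)
    omega
  · exfalso; nlinarith

end QP

namespace QP

lemma four_c {x y k c : ℤ} (hc0 : 0 < c) (hx : 0 < x) (hy : 0 < y) (hc : IsCoprime x y)
    (h : x*y = c*k^4) :
    ∃ c1 c2 r t : ℤ, c1*c2 = c ∧ 0 < c1 ∧ 0 < c2 ∧ IsCoprime c1 c2 ∧ x = c1*r^4 ∧ y = c2*t^4 ∧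
      k^2 = r^2*t^2 ∧ IsCoprime r t := by
  obtain ⟨c1, c2, h1, h2, h3⟩ := exists_dvd_and_dvd_of_dvd_mul (Dvd.intro _ h.symm : c ∣ x*y)
  obtain ⟨d1, d2, e1, e2, e3, p1, p2⟩ : ∃ d1 d2 : ℤ, d1 ∣ x ∧ d2 ∣ y ∧ c = d1*d2 ∧ 0 < d1 ∧ 0 < d2 := by
    refine ⟨|c1|, |c2|, (abs_dvd _ _).2 h1, (abs_dvd _ _).2 h2, ?_, ?_, ?_⟩
    · rw [← abs_mul, ← h3, abs_of_pos hc0]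
    · apply abs_pos.2; rintro rfl; simp at h3; omega
    · apply abs_pos.2; rintro rfl; simp at h3; omega
  obtain ⟨x', rfl⟩ := e1
  obtain ⟨y', rfl⟩ := e2
  have hx' : 0 < x' := (pos_iff_pos_of_mul_pos hx).1 p1
  have hy' : 0 < y' := (pos_iff_pos_of_mul_pos hy).1 p2
  obtain ⟨r, t, a1, a2, a3, a4⟩ := four (k := k) hx' hy' (hc.of_mul_left_right.of_mul_right_right) (by
    apply mul_left_cancel₀ hc0.ne'; rw [← h, e3]; ring)
  exact ⟨d1, d2, r, t, e3.symm, p1, p2, hc.of_mul_left_left.of_mul_right_left, by rw [a1], by rw [a2], a3, a4⟩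

lemma dvd_or_sq {p x y c B : ℤ} {n : ℕ} (hp : Prime p) (h : x*y = c*B^n)
    (hx : p ∣ x) (hy : p ∣ y) : p ∣ B ∨ p*p ∣ c := by
  by_cases hB : p ∣ B
  · exact Or.inl hB
  · right
    have h1 : p*p ∣ c*B^n := h ▸ mul_dvd_mul hx hy
    have hcop : IsCoprime (p*p) (B^n) := by
      have : IsCoprime p B := (Prime.coprime_iff_not_dvd hp).2 hB
      exact IsCoprime.pow_right (IsCoprime.mul_left this this)
    exact hcop.dvd_of_dvd_mul_right h1

lemma sq1620 {p : ℤ} (hp : Prime p) (h : p*p ∣ 1620) : p ∣ 2 ∨ p ∣ 3 := by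
  have h3 := Int.natAbs_dvd_natAbs.2 h
  rw [Int.natAbs_mul] at h3
  have hq : p.natAbs ≤ 40 := by by_contra hh; push Not at hh; have := Nat.le_of_dvd (by norm_num) h3; simp at this; nlinarith
  have hp' := Int.prime_iff_natAbs_prime.1 hp
  rw [← Int.natAbs_dvd_natAbs, ← Int.natAbs_dvd_natAbs]
  generalize p.natAbs = q at *
  interval_cases q <;> (revert h3 hp'; norm_num)

lemma sq284 {p : ℤ} (hp : Prime p) (h : p*p ∣ 284) : p ∣ 2 := by
  have h3 := Int.natAbs_dvd_natAbs.2 h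
  rw [Int.natAbs_mul] at h3
  have hq : p.natAbs ≤ 16 := by by_contra hh; push Not at hh; have := Nat.le_of_dvd (by norm_num) h3; simp at this; nlinarith
  have hp' := Int.prime_iff_natAbs_prime.1 hp
  rw [← Int.natAbs_dvd_natAbs]
  generalize p.natAbs = q at *
  interval_cases q <;> (revert h3 hp'; norm_num)

lemma odd_two {p x : ℤ} (hp : Prime p) (h : x % 2 = 1) (hd : p ∣ x) (h2 : p ∣ 2) : False :=
  hp.not_isUnit (isUnit_of_dvd_one (not_two hp h hd (y := 1) (by simpa using h2)))

lemma dvd3 {p x : ℤ} (hp : Prime p) (h3 : p ∣ 3) (hx : p ∣ x) : 3 ∣ x :=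
  ((hp.associated_of_dvd prime3 h3).symm.dvd).trans hx

lemma mod3 {a b : ℤ} (h : (3:ℤ) ∣ a^2 + b^2) : 3 ∣ a ∧ 3 ∣ b := by
  have ha : a % 3 = 0 ∨ a % 3 = 1 ∨ a % 3 = 2 := by omega
  have hb : b % 3 = 0 ∨ b % 3 = 1 ∨ b % 3 = 2 := by omega
  have h' := Int.emod_eq_zero_of_dvd h
  rcases ha with ha | ha | ha <;> rcases hb with hb | hb | hb <;>
    simp [pow_two, Int.add_emod, Int.mul_emod, ha, hb] at h' ⊢ <;> omega

lemma z8o {a : ℤ} (h : a % 2 = 1) : ((a : ZMod 8))^2 = 1 := by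
  have := odd_sq8 h
  have h2 : ((a^2 : ℤ) : ZMod 8) = ((1 : ℤ) : ZMod 8) := (ZMod.intCast_eq_intCast_iff _ _ 8).2 (by rw [Int.ModEq]; exact this)
  simpa using h2

lemma z8 (a : ℤ) : (a % 2 = 1 ∧ ((a : ZMod 8))^2 = 1) ∨ (a % 2 = 0 ∧ (((a : ZMod 8))^2 = 0 ∨ ((a : ZMod 8))^2 = 4)) := by
  rcases Int.emod_two_eq_zero_or_one a with h | h
  · right; refine ⟨h, ?_⟩
    obtain ⟨b, rfl⟩ : (2:ℤ) ∣ a := by omega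
    push_cast
    generalize (b : ZMod 8) = c
    revert c; decide
  · left; exact ⟨h, z8o h⟩

lemma c8 {x y : ℤ} (h : x = y) : (x : ZMod 8) = (y : ZMod 8) := by rw [h]

lemma exo0 (n : ℕ) : ∀ A K C : ℤ, K.natAbs ≤ n → IsCoprime A K →
    C^2 = A^4 - 17*(A^2*K^2) + 71*K^4 → K = 0 := by
  induction n using Nat.strong_induction_on with
  | _ n ih =>
  intro A K C hn hc h
  by_contra hK
  have hAK : ¬ (A % 2 = 0 ∧ K % 2 = 0) := fun hh =>
    no_p hc prime2 (Int.dvd_of_emod_eq_zero hh.1) (Int.dvd_of_emod_eq_zero hh.2)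
  have hKe : K % 2 = 0 := by
    have h8 := c8 h
    push_cast at h8
    rw [show (A : ZMod 8)^4 = (A^2)^2 by ring, show (K : ZMod 8)^4 = (K^2)^2 by ring] at h8
    rcases z8 K with ⟨h1, h1'⟩ | ⟨h1, h1'⟩
    · exfalso; rw [h1'] at h8
      rcases z8 A with ⟨-, h2⟩ | ⟨-, h2 | h2⟩ <;> rcases z8 C with ⟨-, h3⟩ | ⟨-, h3 | h3⟩ <;>
       rw [h2, h3] at h8 <;> revert h8 <;> decide
    · exact h1
  obtain ⟨k, rfl⟩ : (2:ℤ) ∣ K := by omega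
  have hk : k ≠ 0 := by rintro rfl; simp at hK
  have hAo : A % 2 = 1 := by omega
  have hCo : C % 2 = 1 := by
    apply odd_of_sq; rw [h]
    have : A^2 % 8 = 1 := odd_sq8 hAo
    obtain ⟨a, ha⟩ : ∃ a, A^2 = 8*a + 1 := ⟨A^2 / 8, by omega⟩
    rw [show A^4 - 17*(A^2*(2*k)^2) + 71*(2*k)^4 = 2*(32*a^2 + 8*a - 34*((8*a + 1)*k^2) + 568*k^4) + 1 by
        rw [show A^4 = (A^2)^2 by ring, ha]; ring]
    omega
  have hAsq := odd_sq8 hAo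
  obtain ⟨x, hx⟩ : (2:ℤ) ∣ A^2 - 34*k^2 - C := by omega
  obtain ⟨y, hy⟩ : (2:ℤ) ∣ A^2 - 34*k^2 + C := by omega
  have hxy : x*y = 5*k^4 := by
    have : 4*(x*y) = 4*(5*k^4) := by
      rw [show 4*(x*y) = (2*x)*(2*y) by ring, ← hx, ← hy]; linear_combination -h
    omega
  have hsum : x + y = A^2 - 34*k^2 := by omega
  have hcop : IsCoprime x y := cop_of fun p hp h1 h2 => by
    have hpb : p ∣ k := dvd_of_sqf hp prime5.squarefree hxy h1 h2
    have : p ∣ A^2 := by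
      have := dvd_add (hsum ▸ dvd_add h1 h2) (Dvd.dvd.mul_left (dvd_pow hpb two_ne_zero) 34)
      simpa using this
    exact no_p hc hp (hp.dvd_of_dvd_pow this) (hpb.mul_left 2)
  have hA8 := z8o hAo
  have hxypos : 0 < x*y := by rw [hxy]; positivity
  rcases mul_pos_iff.1 hxypos with ⟨hx0, hy0⟩ | ⟨hx0, hy0⟩
  · obtain ⟨r, t, hrt, hcrt, hor⟩ := four_p 1 prime5 (by norm_num) hx0 hy0 hcop (by rw [hxy]; ring)
    have hs2 : A^2 = r^4 + 34*(r^2*t^2) + 5*t^4 := by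
      rw [← hrt]; rcases hor with ⟨h1, h2⟩ | ⟨h1, h2⟩ <;> rw [h1, h2] at hsum <;> linear_combination -hsum
    have ht0 : t ≠ 0 := by rintro rfl; simp at hrt; exact hk hrt
    have hr0 : r ≠ 0 := by rintro rfl; simp at hrt; exact hk hrt
    have hpar : r % 2 = 1 ∧ t % 2 = 0 := by
      have h8 := c8 hs2
      push_cast at h8
      rw [show (r : ZMod 8)^4 = (r^2)^2 by ring, show (t : ZMod 8)^4 = (t^2)^2 by ring, hA8] at h8
      rcases z8 r with ⟨h1, h2⟩ | ⟨h1, h2 | h2⟩ <;> rcases z8 t with ⟨h3, h4⟩ | ⟨h3, h4 | h4⟩ <;>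
       rw [h2, h4] at h8 <;> first | exact ⟨h1, h3⟩ | (exfalso; revert h8; decide)
    obtain ⟨s, rfl⟩ : (2:ℤ) ∣ t := by omega
    have hrsq := odd_sq8 hpar.1
    obtain ⟨u, hu⟩ : (2:ℤ) ∣ r^2 + 17*(2*s)^2 - A := by
      rw [show (2*s)^2 = 4*s^2 by ring]; omega
    obtain ⟨v, hv⟩ : (2:ℤ) ∣ r^2 + 17*(2*s)^2 + A := by
      rw [show (2*s)^2 = 4*s^2 by ring]; omega
    have huv : u*v = 71*(2*s)^4 := by
      have : 4*(u*v) = 4*(71*(2*s)^4) := by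
        rw [show 4*(u*v) = (2*u)*(2*v) by ring, ← hu, ← hv]; linear_combination -hs2
      omega
    have hsum2 : u + v = r^2 + 17*(2*s)^2 := by omega
    obtain ⟨hu0, hv0⟩ := pos_of_mul_add (by rw [huv]; positivity) (by rw [hsum2]; positivity)
    have hcop2 : IsCoprime u v := cop_of fun p hp h1 h2 => by
      have hpt := dvd_of_sqf hp prime71.squarefree huv h1 h2
      have : p ∣ r^2 := by
        have := dvd_sub (hsum2 ▸ dvd_add h1 h2) (Dvd.dvd.mul_left (dvd_pow hpt two_ne_zero) 17)
        simpa using this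
      exact no_p hcrt hp (hp.dvd_of_dvd_pow this) hpt
    obtain ⟨i, j, hij, hcij, hor⟩ := four_p 1 prime71 (k := 2*s) (by norm_num) hu0 hv0 hcop2 (by rw [huv]; ring)
    have hr : r^2 = i^4 - 17*(i^2*j^2) + 71*j^4 := by
      rw [← hij]; rcases hor with ⟨h1, h2⟩ | ⟨h1, h2⟩ <;> rw [h1, h2] at hsum2 <;> linear_combination -hsum2
    have hi0 : i ≠ 0 := by rintro rfl; apply ht0; simpa using hij
    have hj0 : j ≠ 0 := by rintro rfl; apply ht0; simpa using hij
    have hlt : j.natAbs < (2*k).natAbs := by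
      refine nat_lt (c := 4*r^2*i^2) hj0 ?_ (by linear_combination 4*hrt + 4*r^2*hij)
      have : 0 < r^2*i^2 := by positivity
      nlinarith
    exact hj0 (ih j.natAbs (by omega) i j r le_rfl hcij hr)
  · obtain ⟨r, t, hrt, hcrt, hor⟩ := four_p 1 prime5 (by norm_num) (neg_pos.2 hx0) (neg_pos.2 hy0) hcop.neg_neg (k := k) (by rw [neg_mul_neg, hxy]; ring)
    have hs2 : A^2 = - r^4 + 34*(r^2*t^2) - 5*t^4 := by
      rw [← hrt]; rcases hor with ⟨h1, h2⟩ | ⟨h1, h2⟩ <;> linear_combination -hsum - h1 - h2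
    have h8 := c8 hs2
    push_cast at h8
    rw [show (r : ZMod 8)^4 = (r^2)^2 by ring, show (t : ZMod 8)^4 = (t^2)^2 by ring, hA8] at h8
    rcases z8 r with ⟨h1, h2⟩ | ⟨h1, h2 | h2⟩ <;> rcases z8 t with ⟨h3, h4⟩ | ⟨h3, h4 | h4⟩ <;>
       rw [h2, h4] at h8 <;> revert h8 <;> decide


lemma div284 {a b : ℤ} (ha : 0 < a) (hb : 0 < b) (h : a*b = 284) (hc : IsCoprime a b) :
    (a = 1 ∧ b = 284) ∨ (a = 284 ∧ b = 1) ∨ (a = 4 ∧ b = 71) ∨ (a = 71 ∧ b = 4) := by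
  have hle : a ∈ (284 : ℕ).divisors.image (fun n : ℕ => (n : ℤ)) := by
    simp only [Finset.mem_image, Nat.mem_divisors]
    exact ⟨a.toNat, ⟨by rw [← Int.natCast_dvd_natCast, Int.toNat_of_nonneg ha.le]; exact ⟨b, by exact_mod_cast h.symm⟩, by norm_num⟩, Int.toNat_of_nonneg ha.le⟩
  rw [show (284 : ℕ).divisors = {1, 2, 4, 71, 142, 284} by decide +kernel] at hle
  simp only [Finset.image_insert, Finset.image_singleton, Finset.mem_insert, Finset.mem_singleton] at hle
  have h2 : ¬ (2 ∣ a ∧ 2 ∣ b) := fun h => no_p hc prime2 h.1 h.2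
  rcases hle with rfl | rfl | rfl | rfl | rfl | rfl <;> omega

lemma div405 {a b : ℤ} (ha : 0 < a) (hb : 0 < b) (h : a*b = 405) (hc : IsCoprime a b) :
    (a = 1 ∧ b = 405) ∨ (a = 405 ∧ b = 1) ∨ (a = 81 ∧ b = 5) ∨ (a = 5 ∧ b = 81) := by
  have hle : a ∈ (405 : ℕ).divisors.image (fun n : ℕ => (n : ℤ)) := by
    simp only [Finset.mem_image, Nat.mem_divisors]
    exact ⟨a.toNat, ⟨by rw [← Int.natCast_dvd_natCast, Int.toNat_of_nonneg ha.le]; exact ⟨b, by exact_mod_cast h.symm⟩, by norm_num⟩, Int.toNat_of_nonneg ha.le⟩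
  rw [show (405 : ℕ).divisors = {1, 3, 9, 27, 81, 5, 15, 45, 135, 405} by decide +kernel] at hle
  simp only [Finset.image_insert, Finset.image_singleton, Finset.mem_insert, Finset.mem_singleton] at hle
  have h2 : ¬ (3 ∣ a ∧ 3 ∣ b) := fun h => no_p hc prime3 h.1 h.2
  rcases hle with rfl | rfl | rfl | rfl | rfl | rfl | rfl | rfl | rfl | rfl <;> omega

lemma div1620 {a b : ℤ} (ha : 0 < a) (hb : 0 < b) (h : a*b = 1620) (hc : IsCoprime a b) :
    (a = 1 ∧ b = 1620) ∨ (a = 1620 ∧ b = 1) ∨ (a = 81 ∧ b = 20) ∨ (a = 20 ∧ b = 81) ∨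
    (a = 4 ∧ b = 405) ∨ (a = 405 ∧ b = 4) ∨ (a = 5 ∧ b = 324) ∨ (a = 324 ∧ b = 5) := by
  lift a to ℕ using ha.le
  lift b to ℕ using hb.le
  norm_cast at *
  have hcc : Nat.gcd a b = 1 := hc
  have hb' : b = 1620 / a := by rw [← h]; exact (Nat.mul_div_cancel_left b ha).symm
  have hle : a ∈ (1620 : ℕ).divisors.filter (fun n => Nat.gcd n (1620 / n) = 1) := by
    rw [Finset.mem_filter, Nat.mem_divisors, ← hb']
    exact ⟨⟨⟨b, h.symm⟩, by norm_num⟩, hcc⟩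
  rw [show (1620 : ℕ).divisors.filter (fun n => Nat.gcd n (1620 / n) = 1) = {1, 1620, 81, 20, 4, 405, 5, 324} by decide +kernel] at hle
  simp only [Finset.mem_insert, Finset.mem_singleton] at hle
  rcases hle with rfl | rfl | rfl | rfl | rfl | rfl | rfl | rfl <;> simp at hb' <;> subst hb' <;> decide

lemma p4 (x : ZMod 8) : x^4 = (x^2)^2 := by ring

lemma exo1_even {b K d : ℤ} (hc : IsCoprime b K) (hK : K % 2 = 1)
    (h : d^2 = 4*b^4 - 22*(b^2*K^2) - 71*K^4) : False := by
  have hK0 : K ≠ 0 := by rintro rfl; simp at hK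
  have hK8 := z8o hK
  have hbe : b % 2 = 0 := by
    have h8 := c8 h
    push_cast at h8
    simp only [p4, hK8] at h8
    rcases z8 b with ⟨h1, h1'⟩ | ⟨h1, h1'⟩
    · exfalso; rw [h1'] at h8
      rcases z8 d with ⟨-, h3⟩ | ⟨-, h3 | h3⟩ <;> rw [h3] at h8 <;> revert h8 <;> decide
    · exact h1
  obtain ⟨e, rfl⟩ : (2:ℤ) ∣ b := by omega
  have hxy : (16*e^2 - 11*K^2 - 2*d)*(16*e^2 - 11*K^2 + 2*d) = 405*K^4 := by
    linear_combination -4*h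
  have hxo : (16*e^2 - 11*K^2 - 2*d) % 2 = 1 := by have := odd_sq8 hK; omega
  have hsum : (16*e^2 - 11*K^2 - 2*d) + (16*e^2 - 11*K^2 + 2*d) = 32*e^2 - 22*K^2 := by ring
  set x := 16*e^2 - 11*K^2 - 2*d with hx
  set y := 16*e^2 - 11*K^2 + 2*d with hy
  have hcop : IsCoprime x y := cop_of fun p hp h1 h2 => by
    have hp1 : p ∣ 16*e^2 - 11*K^2 := not_two hp hxo h1 (by
      rw [show 2*(16*e^2 - 11*K^2) = x + y by rw [hsum]; ring]; exact dvd_add h1 h2)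
    have hpK : p ∣ K → False := fun hpK => by
      have h3 : p ∣ 2*(8*e^2) := by
        have := dvd_add hp1 (Dvd.dvd.mul_left (dvd_pow hpK two_ne_zero) 11)
        rw [show 2*(8*e^2) = 16*e^2 - 11*K^2 + 11*K^2 by ring]; exact this
      have h4 := not_two hp hxo h1 h3
      rw [show 8*e^2 = 2*(2*(2*e^2)) by ring] at h4
      have h5 := not_two hp hxo h1 (not_two hp hxo h1 (not_two hp hxo h1 h4))
      exact no_p hc hp ((hp.dvd_of_dvd_pow h5).mul_left 2) hpK
    rcases dvd_or_sq hp hxy h1 h2 with h3 | h3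
    · exact hpK h3
    · rcases sq1620 hp (h3.trans (by norm_num)) with h4 | h4
      · exact odd_two hp hxo h1 h4
      · have h5 := dvd3 hp h4 hp1
        have h6 : (3:ℤ) ∣ e^2 + K^2 := by omega
        exact hpK (h4.trans (mod3 h6).2)
  have hxypos : 0 < x*y := by rw [hxy]; positivity
  rcases mul_pos_iff.1 hxypos with ⟨hx0, hy0⟩ | ⟨hx0, hy0⟩
  · obtain ⟨c1, c2, r, t, hc12, hc1, hc2, hcc, hxr, hyt, hrt, -⟩ := four_c (by norm_num) hx0 hy0 hcop hxy
    obtain ⟨hr, ht⟩ := odd_mul_sq (a := r) (b := t) (by rw [← hrt]; have := odd_sq8 hK; omega)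
    rw [hxr, hyt] at hsum
    have h8 := c8 hsum
    push_cast at h8
    simp only [p4, z8o hr, z8o ht, hK8] at h8
    rcases z8 e with ⟨-, h3⟩ | ⟨-, h3 | h3⟩ <;> rw [h3] at h8 <;>
    rcases div405 hc1 hc2 hc12 hcc with ⟨rfl, rfl⟩ | ⟨rfl, rfl⟩ | ⟨rfl, rfl⟩ | ⟨rfl, rfl⟩ <;> revert h8 <;> decide
  · obtain ⟨c1, c2, r, t, hc12, hc1, hc2, hcc, hxr, hyt, hrt, -⟩ := four_c (c := 405) (k := K) (by norm_num) (neg_pos.2 hx0) (neg_pos.2 hy0) hcop.neg_neg (by rw [neg_mul_neg, hxy])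
    have ht0 : t ≠ 0 := by rintro rfl; simp at hyt; omega
    have hs2 : -32*e^2 = c1*r^4 - 22*(r^2*t^2) + c2*t^4 := by
      rw [← hrt]; linear_combination -hsum + hxr + hyt
    have : 0 < t^4 := by positivity
    rcases div405 hc1 hc2 hc12 hcc with ⟨rfl, rfl⟩ | ⟨rfl, rfl⟩ | ⟨rfl, rfl⟩ | ⟨rfl, rfl⟩
    · nlinarith [sq_nonneg (r^2 - 11*t^2), sq_nonneg e]
    · nlinarith [sq_nonneg (r^2*405 - 11*t^2), sq_nonneg e]
    · nlinarith [sq_nonneg (r^2*81 - 11*t^2), sq_nonneg e]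
    · nlinarith [sq_nonneg (r^2*5 - 11*t^2), sq_nonneg e]

lemma exo1_al {R t B : ℤ} (hB : 0 < B) (hR : R % 2 = 1) (hBo : B % 2 = 1) (ht : t ≠ 0)
    (h : B^2 = (R^2 + 22*t^2)^2 + 1136*t^4)
    (hcop : ∀ p : ℤ, Prime p → p ∣ B → p ∣ R^2 → p ∣ t → False) (hte : t % 2 = 0 ∨ t % 2 = 1) :
    ∃ i j : ℤ, IsCoprime j i ∧ R^2 = j^4 - 22*(j^2*i^2) - 284*i^4 ∧ t^2 = i^2*j^2 := by
  have hRs := odd_sq8 hR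
  obtain ⟨u, hu⟩ : (2:ℤ) ∣ B - (R^2 + 22*t^2) := by omega
  obtain ⟨v, hv⟩ : (2:ℤ) ∣ B + (R^2 + 22*t^2) := by omega
  have huv : u*v = 284*t^4 := by
    have : 4*(u*v) = 4*(284*t^4) := by
      rw [show 4*(u*v) = (2*u)*(2*v) by ring, ← hu, ← hv]; linear_combination h
    omega
  have hsum : u + v = B := by omega
  have hvu : v - u = R^2 + 22*t^2 := by omega
  obtain ⟨hu0, hv0⟩ := pos_of_mul_add (by rw [huv]; positivity) (by rw [hsum]; positivity)
  have hc2 : IsCoprime u v := cop_of fun p hp h1 h2 => by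
    have hpB : p ∣ B := hsum ▸ dvd_add h1 h2
    have hpt : p ∣ t := by
      rcases dvd_or_sq hp huv h1 h2 with h3 | h3
      · exact h3
      · exact (odd_two hp hBo hpB (sq284 hp h3)).elim
    refine hcop p hp hpB ?_ hpt
    have h3 : R^2 = v - u - t*(22*t) := by linear_combination -hvu
    rw [h3]; exact dvd_sub (dvd_sub h2 h1) (hpt.mul_right _)
  obtain ⟨c1, c2, i, j, hc12, hc1, hc2, hcc, hxr, hyt, hrt, hij⟩ := four_c (by norm_num) hu0 hv0 hc2 huv
  have hs : R^2 = c2*j^4 - 22*(j^2*i^2) - c1*i^4 := by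
    linear_combination -hvu - hxr + hyt - 22*hrt
  refine ⟨i, j, hij.symm, ?_, hrt⟩
  have h8 := c8 hs
  push_cast at h8
  simp only [p4, z8o hR] at h8
  rcases div284 hc1 hc2 hc12 hcc with ⟨rfl, rfl⟩ | ⟨rfl, rfl⟩ | ⟨rfl, rfl⟩ | ⟨rfl, rfl⟩
  · exfalso
    rcases z8 i with ⟨-, h3⟩ | ⟨-, h3 | h3⟩ <;> rcases z8 j with ⟨-, h4⟩ | ⟨-, h4 | h4⟩ <;> rw [h3, h4] at h8 <;> revert h8 <;> decide
  · rw [hs]; ring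
  · exfalso
    rcases z8 i with ⟨-, h3⟩ | ⟨-, h3 | h3⟩ <;> rcases z8 j with ⟨-, h4⟩ | ⟨-, h4 | h4⟩ <;> rw [h3, h4] at h8 <;> revert h8 <;> decide
  · exfalso
    refine exo1_even hij.symm ?_ hs
    rcases z8 i with ⟨h5, h3⟩ | ⟨-, h3 | h3⟩ <;> rcases z8 j with ⟨-, h4⟩ | ⟨-, h4 | h4⟩ <;> rw [h3, h4] at h8 <;> 
      first | exact h5 | (exfalso; revert h8; decide)

lemma exo1 (n : ℕ) : ∀ B K D : ℤ, K.natAbs ≤ n → IsCoprime B K →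
    D^2 = B^4 - 22*(B^2*K^2) - 284*K^4 → K = 0 := by
  induction n using Nat.strong_induction_on with
  | _ n ih =>
  intro B0 K D hn hc0 h0
  by_contra hK
  obtain ⟨B, hB, hB2⟩ : ∃ B : ℤ, 0 ≤ B ∧ B^2 = B0^2 := ⟨|B0|, abs_nonneg _, sq_abs _⟩
  have hc : IsCoprime B K := by
    have : IsCoprime (B0^2) K := IsCoprime.pow_left hc0
    rw [← hB2] at this
    exact (IsCoprime.pow_left_iff (by norm_num)).1 this
  have h : D^2 = B^4 - 22*(B^2*K^2) - 284*K^4 := by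
    rw [h0]; linear_combination (-B^2 - B0^2 + 22*K^2)*hB2
  clear h0 hc0 hB2
  have hBK : ¬ (B % 2 = 0 ∧ K % 2 = 0) := fun hh =>
    no_p hc prime2 (Int.dvd_of_emod_eq_zero hh.1) (Int.dvd_of_emod_eq_zero hh.2)
  rcases Int.emod_two_eq_zero_or_one B with hBe | hBo
  · obtain ⟨b, rfl⟩ : (2:ℤ) ∣ B := by omega
    obtain ⟨d, rfl⟩ : (2:ℤ) ∣ D := by
      have : D^2 = 2*(2*(4*b^4 - 22*(b^2*K^2) - 71*K^4)) := by rw [h]; ring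
      have := even_of_sq (a := D) (by omega)
      omega
    refine exo1_even (b := b) (K := K) (d := d) hc.of_mul_left_right (by omega) ?_
    linarith
  have hB8 := z8o hBo
  have hKe : K % 2 = 0 := by
    have h8 := c8 h
    push_cast at h8
    simp only [p4, hB8] at h8
    rcases z8 K with ⟨h1, h1'⟩ | ⟨h1, h1'⟩
    · exfalso; rw [h1'] at h8
      rcases z8 D with ⟨-, h3⟩ | ⟨-, h3 | h3⟩ <;> rw [h3] at h8 <;> revert h8 <;> decide
    · exact h1
  obtain ⟨k, rfl⟩ : (2:ℤ) ∣ K := by omega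
  have hk : k ≠ 0 := by rintro rfl; simp at hK
  have hBs := odd_sq8 hBo
  have hDo : D % 2 = 1 := by
    rcases sq4 D with ⟨h1, h2⟩ | h1
    · exfalso
      have h8 := c8 h
      push_cast at h8
      simp only [p4, hB8, mul_pow] at h8
      rcases z8 D with ⟨h5, h3⟩ | ⟨-, h3 | h3⟩ <;> [omega; skip; skip] <;> rw [h3] at h8 <;>
      rcases z8 k with ⟨-, h3⟩ | ⟨-, h3 | h3⟩ <;> rw [h3] at h8 <;> revert h8 <;> decide
    · exact h1.1
  obtain ⟨x, hx⟩ : (2:ℤ) ∣ B^2 - 44*k^2 - D := by omega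
  obtain ⟨y, hy⟩ : (2:ℤ) ∣ B^2 - 44*k^2 + D := by omega
  have hxy : x*y = 1620*k^4 := by
    have : 4*(x*y) = 4*(1620*k^4) := by
      rw [show 4*(x*y) = (2*x)*(2*y) by ring, ← hx, ← hy]; linear_combination -h
    omega
  have hsum : x + y = B^2 - 44*k^2 := by omega
  have hcop : IsCoprime x y := cop_of fun p hp h1 h2 => by
    have hp1 : p ∣ B^2 - 44*k^2 := hsum ▸ dvd_add h1 h2
    have hpk : p ∣ k → False := fun hpk => by
      have h3 : p ∣ B^2 := by
        have := dvd_add hp1 (Dvd.dvd.mul_left (dvd_pow hpk two_ne_zero) 44)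
        rw [show B^2 = B^2 - 44*k^2 + 44*k^2 by ring]; exact this
      exact no_p hc hp (hp.dvd_of_dvd_pow h3) (hpk.mul_left 2)
    rcases dvd_or_sq hp hxy h1 h2 with h3 | h3
    · exact hpk h3
    · rcases sq1620 hp h3 with h4 | h4
      · exact odd_two hp (show (B^2 - 44*k^2) % 2 = 1 by omega) hp1 h4
      · have h5 := dvd3 hp h4 hp1
        have h6 : (3:ℤ) ∣ B^2 + k^2 := by omega
        exact hpk (h4.trans (mod3 h6).2)
  -- descent step
  have key : ∀ r t R : ℤ, k^2 = r^2*t^2 → ∀ i j : ℤ, IsCoprime j i →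
      R^2 = j^4 - 22*(j^2*i^2) - 284*i^4 → t^2 = i^2*j^2 → False := by
    intro r t R hrt i j hij hR hti
    have ht0 : t ≠ 0 := by rintro rfl; simp at hrt; exact hk hrt
    have hr0 : r ≠ 0 := by rintro rfl; simp at hrt; exact hk hrt
    have hi0 : i ≠ 0 := by rintro rfl; simp at hti; exact ht0 hti
    have hj0 : j ≠ 0 := by rintro rfl; simp at hti; exact ht0 hti
    have hlt : i.natAbs < (2*k).natAbs := by
      refine nat_lt (c := 4*r^2*j^2) hi0 ?_ (by linear_combination 4*hrt + 4*r^2*hti)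
      have : 0 < r^2*j^2 := by positivity
      nlinarith
    exact hi0 (ih i.natAbs (by omega) j i R le_rfl hij hR)
  have hal : ∀ r t : ℤ, k^2 = r^2*t^2 → IsCoprime r t → r % 2 = 1 →
      B^2 = r^4 + 44*(r^2*t^2) + 1620*t^4 → False := by
    intro r t hrt hcrt hro hs
    have ht0 : t ≠ 0 := by rintro rfl; simp at hrt; exact hk hrt
    obtain ⟨i, j, h1, h2, h3⟩ := exo1_al (R := r) (t := t) (B := B) (by omega) hro hBo ht0 (by rw [hs]; ring)
      (fun p hp _ h2 h3 => no_p hcrt hp (hp.dvd_of_dvd_pow h2) h3) (by omega)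
    exact key r t r hrt i j h1 h2 h3
  have hbe : ∀ r t : ℤ, k^2 = r^2*t^2 → IsCoprime r t → r % 2 = 1 →
      B^2 = 81*r^4 + 44*(r^2*t^2) + 20*t^4 → False := by
    intro r t hrt hcrt hro hs
    have ht0 : t ≠ 0 := by rintro rfl; simp at hrt; exact hk hrt
    have ht3 : ¬ (3:ℤ) ∣ t := fun h3 => by
      have hB3 : (3:ℤ) ∣ B^2 := by
        rw [hs, show 81*r^4 + 44*(r^2*t^2) + 20*t^4 = 3*(27*r^4) + t*(44*r^2*t + 20*t^3) by ring]
        exact dvd_add (dvd_mul_right _ _) (h3.mul_right _)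
      have hk3 : (3:ℤ) ∣ k^2 := by rw [hrt]; exact Dvd.dvd.mul_left (dvd_pow h3 two_ne_zero) _
      exact no_p hc prime3 (prime3.dvd_of_dvd_pow hB3) ((prime3.dvd_of_dvd_pow hk3).mul_left 2)
    obtain ⟨i, j, h1, h2, h3⟩ := exo1_al (R := 9*r) (t := t) (B := 9*B) (by omega) (by omega) (by omega) ht0
      (by linear_combination 81*hs)
      (fun p hp _ h2 h3 => by
        have h4 := hp.dvd_of_dvd_pow h2
        rw [show 9*r = 3*(3*r) by ring] at h4
        have h5 : ¬ p ∣ 3 := fun h => ht3 (dvd3 hp h h3)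
        rcases hp.dvd_or_dvd h4 with h | h
        · exact h5 h
        · rcases hp.dvd_or_dvd h with h | h
          · exact h5 h
          · exact no_p hcrt hp h h3) (by omega)
    exact key r t (9*r) hrt i j h1 h2 h3
  have hxypos : 0 < x*y := by rw [hxy]; positivity
  rcases mul_pos_iff.1 hxypos with ⟨hx0, hy0⟩ | ⟨hx0, hy0⟩
  · obtain ⟨c1, c2, r, t, hc12, hc1, hc2, hcc, hxr, hyt, hrt, hcrt⟩ := four_c (by norm_num) hx0 hy0 hcop hxy
    have hs : B^2 = c1*r^4 + 44*(r^2*t^2) + c2*t^4 := by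
      rw [← hrt]; linear_combination -hsum + hxr + hyt
    have h8 := c8 hs
    push_cast at h8
    simp only [p4, hB8] at h8
    rcases div1620 hc1 hc2 hc12 hcc with ⟨rfl, rfl⟩ | ⟨rfl, rfl⟩ | ⟨rfl, rfl⟩ | ⟨rfl, rfl⟩ | ⟨rfl, rfl⟩ | ⟨rfl, rfl⟩ | ⟨rfl, rfl⟩ | ⟨rfl, rfl⟩
    · refine hal r t hrt hcrt ?_ (by rw [hs]; ring)
      rcases z8 r with ⟨h1, h3⟩ | ⟨-, h3 | h3⟩ <;> rcases z8 t with ⟨-, h4⟩ | ⟨-, h4 | h4⟩ <;> rw [h3, h4] at h8 <;>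
        first | exact h1 | (exfalso; revert h8; decide)
    · refine hal t r (by rw [hrt]; ring) hcrt.symm ?_ (by rw [hs]; ring)
      rcases z8 t with ⟨h1, h3⟩ | ⟨-, h3 | h3⟩ <;> rcases z8 r with ⟨-, h4⟩ | ⟨-, h4 | h4⟩ <;> rw [h3, h4] at h8 <;>
        first | exact h1 | (exfalso; revert h8; decide)
    · refine hbe r t hrt hcrt ?_ (by rw [hs])
      rcases z8 r with ⟨h1, h3⟩ | ⟨-, h3 | h3⟩ <;> rcases z8 t with ⟨-, h4⟩ | ⟨-, h4 | h4⟩ <;> rw [h3, h4] at h8 <;>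
        first | exact h1 | (exfalso; revert h8; decide)
    · refine hbe t r (by rw [hrt]; ring) hcrt.symm ?_ (by rw [hs]; ring)
      rcases z8 t with ⟨h1, h3⟩ | ⟨-, h3 | h3⟩ <;> rcases z8 r with ⟨-, h4⟩ | ⟨-, h4 | h4⟩ <;> rw [h3, h4] at h8 <;>
        first | exact h1 | (exfalso; revert h8; decide)
    all_goals
      rcases z8 r with ⟨h1, h3⟩ | ⟨-, h3 | h3⟩ <;> rcases z8 t with ⟨-, h4⟩ | ⟨-, h4 | h4⟩ <;> rw [h3, h4] at h8 <;>
        (revert h8; decide)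
  · obtain ⟨c1, c2, r, t, hc12, hc1, hc2, hcc, hxr, hyt, hrt, hcrt⟩ := four_c (c := 1620) (k := k) (by norm_num) (neg_pos.2 hx0) (neg_pos.2 hy0) hcop.neg_neg (by rw [neg_mul_neg, hxy])
    have hs : B^2 = - (c1*r^4) + 44*(r^2*t^2) - c2*t^4 := by
      rw [← hrt]; linear_combination -hsum - hxr - hyt
    have h8 := c8 hs
    push_cast at h8
    simp only [p4, hB8] at h8
    rcases div1620 hc1 hc2 hc12 hcc with ⟨rfl, rfl⟩ | ⟨rfl, rfl⟩ | ⟨rfl, rfl⟩ | ⟨rfl, rfl⟩ | ⟨rfl, rfl⟩ | ⟨rfl, rfl⟩ | ⟨rfl, rfl⟩ | ⟨rfl, rfl⟩ <;>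
      rcases z8 r with ⟨h1, h3⟩ | ⟨-, h3 | h3⟩ <;> rcases z8 t with ⟨-, h4⟩ | ⟨-, h4 | h4⟩ <;> rw [h3, h4] at h8 <;>
        (revert h8; decide)

end QP

namespace QP
section ufd
variable {R : Type*} [CommRing R] [IsDomain R] [UniqueFactorizationMonoid R]

lemma fin_mul {p x : R} (hp : Prime p) (hx : x ≠ 0) : FiniteMultiplicity p x :=
  FiniteMultiplicity.of_not_isUnit hp.not_isUnit hx

lemma mult_mul {p x y : R} (hp : Prime p) (hx : x ≠ 0) (hy : y ≠ 0) :
    multiplicity p (x*y) = multiplicity p x + multiplicity p y :=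
  multiplicity_mul hp (fin_mul hp (mul_ne_zero hx hy))

lemma mult_sq {p x : R} (hp : Prime p) (hx : x ≠ 0) :
    multiplicity p (x^2) = 2*multiplicity p x := by
  rw [pow_two, mult_mul hp hx hx]; ring

lemma mult_zero {p x : R} (h : ¬ p ∣ x) : multiplicity p x = 0 := multiplicity_eq_zero.2 h

lemma dvd_of_odd {p x : R} (h : Odd (multiplicity p x)) : p ∣ x := by
  by_contra hh; rw [mult_zero hh] at h; simp at h

/-- odd valuations transfer across a product that is a square -/
lemma odd_trans {p x y z : R} (hp : Prime p) (hz : z ≠ 0) (h : x*y = z^2)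
    (ho : Odd (multiplicity p x)) : Odd (multiplicity p y) := by
  have hxy : x*y ≠ 0 := h ▸ pow_ne_zero 2 hz
  have := mult_mul hp (left_ne_zero_of_mul hxy) (right_ne_zero_of_mul hxy)
  rw [h, mult_sq hp hz] at this
  rw [Nat.odd_iff] at *; omega

lemma sqf_dec (x : R) (hx : x ≠ 0) : ∃ d k : R, x = d*k^2 ∧ Squarefree d := by
  revert hx
  refine UniqueFactorizationMonoid.induction_on_prime x (by simp) ?_ ?_
  · intro x hx _; exact ⟨x, 1, by ring, hx.squarefree⟩
  · intro a p ha hp ih _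
    obtain ⟨d, k, h, hd⟩ := ih ha
    by_cases hpd : p ∣ d
    · obtain ⟨e, rfl⟩ := hpd
      exact ⟨e, p*k, by rw [h]; ring, hd.of_mul_right⟩
    · refine ⟨p*d, k, by rw [h]; ring, ?_⟩
      rw [squarefree_mul_iff]
      exact ⟨(hp.irreducible.isRelPrime_iff_not_dvd).2 hpd, hp.squarefree, hd⟩

lemma sqf_dvd (d : R) (P : R) (hd : Squarefree d) (h : ∀ p : R, Prime p → p ∣ d → p ∣ P) : d ∣ P := by
  revert hd h
  refine UniqueFactorizationMonoid.induction_on_prime d (by simp) ?_ ?_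
  · intro x hx _ _; exact hx.dvd
  · intro a p ha hp ih hsq h
    rw [squarefree_mul_iff] at hsq
    obtain ⟨P', rfl⟩ := ih hsq.2.2 (fun q hq hqa => h q hq (hqa.mul_left p))
    have hpa : ¬ p ∣ a := (hp.irreducible.isRelPrime_iff_not_dvd).1 hsq.1
    rcases hp.dvd_or_dvd (h p hp (dvd_mul_right _ _)) with h1 | h1
    · exact (hpa h1).elim
    · rw [mul_comm]; exact mul_dvd_mul_left a h1

lemma sqpart (x P : R) (hx : x ≠ 0) (h : ∀ p : R, Prime p → Odd (multiplicity p x) → p ∣ P) :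
    ∃ d k : R, x = d*k^2 ∧ d ∣ P := by
  obtain ⟨d, k, hdk, hd⟩ := sqf_dec x hx
  refine ⟨d, k, hdk, sqf_dvd d P hd fun p hp hpd => h p hp ?_⟩
  have hd0 : d ≠ 0 := hd.ne_zero
  have hk0 : k ≠ 0 := by rintro rfl; simp at hdk; exact hx hdk
  have h1 : multiplicity p d = 1 := by
    obtain ⟨e, rfl⟩ := hpd
    have he : ¬ p ∣ e := (hp.irreducible.isRelPrime_iff_not_dvd).1 (squarefree_mul_iff.1 hd).1
    rw [mult_mul hp hp.ne_zero (right_ne_zero_of_mul hd0), mult_zero he, multiplicity_self]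
  rw [hdk, mult_mul hp hd0 (pow_ne_zero 2 hk0), mult_sq hp hk0, h1]
  exact ⟨multiplicity p k, by ring⟩

end ufd

lemma dvd_prime {d p : ℤ} (hp : Prime p) (h : d ∣ p) : d = 1 ∨ d = -1 ∨ d = p ∨ d = -p := by
  rcases hp.irreducible.dvd_iff.1 h with h1 | h1
  · rcases Int.isUnit_iff.1 h1 with h | h <;> simp [h]
  · rcases Int.associated_iff.1 h1 with h | h
    · simp [h]
    · right; right; right; omega

lemma sqpart_p {x y z p : ℤ} (hz : z ≠ 0) (h : x*y = z^2) (hp : Prime p)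
    (hq : ∀ q : ℤ, Prime q → q ∣ x → q ∣ y → q ∣ p) :
    ∃ k : ℤ, x = k^2 ∨ x = -k^2 ∨ x = p*k^2 ∨ x = - p*k^2 := by
  have hxy : x*y ≠ 0 := h ▸ pow_ne_zero 2 hz
  obtain ⟨d, k, hdk, hd⟩ := sqpart x p (left_ne_zero_of_mul hxy)
    (fun q hq' ho => hq q hq' (dvd_of_odd ho) (dvd_of_odd (odd_trans hq' hz h ho)))
  refine ⟨k, ?_⟩
  rcases dvd_prime hp hd with rfl | rfl | rfl | rfl <;> simp [hdk]


lemma gcd_red {A K : ℤ} (hK : K ≠ 0) : ∃ g A' K' : ℤ, g ≠ 0 ∧ A = g*A' ∧ K = g*K' ∧ IsCoprime A' K' := by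
  have hg : Int.gcd A K ≠ 0 := fun h => hK (Int.gcd_eq_zero_iff.1 h).2
  obtain ⟨A', hA⟩ := Int.gcd_dvd_left A K
  obtain ⟨K', hK'⟩ := Int.gcd_dvd_right A K
  have hg' : (Int.gcd A K : ℤ) ≠ 0 := by exact_mod_cast hg
  obtain ⟨x, y, h⟩ : ∃ x y : ℤ, (Int.gcd A K : ℤ) = A*x + K*y := ⟨_, _, Int.gcd_eq_gcd_ab A K⟩
  generalize (Int.gcd A K : ℤ) = g at *
  refine ⟨g, A', K', hg', hA, hK', x, y, ?_⟩
  apply mul_left_cancel₀ hg'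
  linear_combination -h - x*hA - y*hK'

lemma exo0g {A K C : ℤ} (h : C^2 = A^4 - 17*(A^2*K^2) + 71*K^4) : K = 0 := by
  by_contra hK
  obtain ⟨g, A', K', hg, rfl, rfl, hc⟩ := gcd_red (A := A) hK
  obtain ⟨C', rfl⟩ : g^2 ∣ C := by
    rw [← Int.pow_dvd_pow_iff two_ne_zero, h]
    exact ⟨A'^4 - 17*(A'^2*K'^2) + 71*K'^4, by ring⟩
  have := exo0 _ A' K' C' le_rfl hc (by
    apply mul_left_cancel₀ (pow_ne_zero 4 hg); linear_combination h)
  simp [this] at hK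

lemma exo1g {A K C : ℤ} (h : C^2 = A^4 - 22*(A^2*K^2) - 284*K^4) : K = 0 := by
  by_contra hK
  obtain ⟨g, A', K', hg, rfl, rfl, hc⟩ := gcd_red (A := A) hK
  obtain ⟨C', rfl⟩ : g^2 ∣ C := by
    rw [← Int.pow_dvd_pow_iff two_ne_zero, h]
    exact ⟨A'^4 - 22*(A'^2*K'^2) - 284*K'^4, by ring⟩
  have := exo1 _ A' K' C' le_rfl hc (by
    apply mul_left_cancel₀ (pow_ne_zero 4 hg); linear_combination h)
  simp [this] at hK

/-- removing square factors -/
lemma rem_sq {x k y : ℤ} (hk : k ≠ 0) (h : x*k^2 = y^2) : ∃ z, x = z^2 := by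
  obtain ⟨z, rfl⟩ : k ∣ y := by
    rw [← Int.pow_dvd_pow_iff two_ne_zero, ← h]; exact dvd_mul_left _ _
  exact ⟨z, by apply mul_right_cancel₀ (pow_ne_zero 2 hk); rw [h]; ring⟩

lemma Rneg {n N u m q A C z M B : ℤ} (hu : u = 8*n + m) (hm : m = n - N) (hq : q = n^2 + n*m - m^2)
    (hn : n = - A^2) (hN : N = - B^2) (hqC : q = -71*C^2) (hM : m = M^2 ∨ m = 2*M^2)
    (hu0 : u ≠ 0) (h1 : m = M^2 → -71*u = z^2) (h2 : m = 2*M^2 → -142*u = z^2) : False := by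
  rcases hM with hM | hM
  · have h1 := h1 hM
    obtain ⟨K, rfl⟩ : (71:ℤ) ∣ z := prime71.dvd_of_dvd_pow (n := 2) (h1 ▸ ⟨-u, by ring⟩)
    have hK : u = -71*K^2 := by linarith
    have hmm : M^2 = 8*A^2 - 71*K^2 := by linarith
    have := exo0g (A := A) (K := K) (C := C) (by
      rw [hqC, hM, hn, show (M^2)^2 = M^2*M^2 by ring, hmm] at hq; linarith)
    rw [this] at hK; omega
  · have h2 := h2 hM
    obtain ⟨K, rfl⟩ : (142:ℤ) ∣ z := by
      have e1 : (71:ℤ) ∣ z := prime71.dvd_of_dvd_pow (n := 2) (h2 ▸ ⟨-2*u, by ring⟩)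
      have e2 : (2:ℤ) ∣ z := prime2.dvd_of_dvd_pow (n := 2) (h2 ▸ ⟨-71*u, by ring⟩)
      omega
    have hK : u = -142*K^2 := by linarith
    have := exo1g (A := B) (K := K) (C := 9*C) (by
      have e : 81*q = -71*N^2 + 11*N*u + u^2 := by rw [hq, hu, hm]; ring
      rw [hqC, hN, hK] at e; linarith)
    rw [this] at hK; omega

lemma not_sq5 {y : ℤ} (hy : 5 = y^2) : False := by
  have h1 : y < 3 := by nlinarith
  have h2 : -3 < y := by nlinarith
  interval_cases y <;> omega

set_option maxHeartbeats 1000000 in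
lemma lemR {w z : ℚ} (h : z^2 = 8*w^5 + w^4 - 16*w^3 + 6*w^2 + w) :
    w = 0 ∨ w = 1 ∨ w = -1 / 8 := by
  obtain ⟨n, m, hm, hnm, rfl⟩ : ∃ n m : ℤ, 0 < m ∧ IsCoprime n m ∧ w = n / m :=
    ⟨w.num, w.den, by exact_mod_cast w.den_pos, Int.isCoprime_iff_gcd_eq_one.2 w.reduced,
      by exact_mod_cast (Rat.num_div_den w).symm⟩
  have hm' : (m : ℚ) ≠ 0 := by exact_mod_cast hm.ne'
  by_contra hcon
  have hn : n ≠ 0 := by rintro rfl; apply hcon; left; simp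
  have hN : n - m ≠ 0 := by intro hh; apply hcon; right; left; rw [show n = m by omega]; field_simp
  have hu : 8*n + m ≠ 0 := by
    intro hh; apply hcon; right; right; rw [show m = -8*n by omega]
    have : (n : ℚ) ≠ 0 := by exact_mod_cast hn
    push_cast; field_simp
  have hq := q_ne (n := n) hm.ne'
  obtain ⟨N, hNe⟩ : ∃ N, N = n - m := ⟨_, rfl⟩
  obtain ⟨u, hue⟩ : ∃ u, u = 8*n + m := ⟨_, rfl⟩
  obtain ⟨q, hqe⟩ : ∃ q, q = n^2 + n*m - m^2 := ⟨_, rfl⟩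
  rw [← hNe] at hN; rw [← hue] at hu; rw [← hqe] at hq
  obtain ⟨y, hy⟩ : ∃ y : ℤ, u*m*n*N*q = y^2 := by
    apply int_sq (r := z*(m : ℤ)^3)
    rw [mul_pow, h, hNe, hue, hqe]; push_cast
    field_simp; ring
  have hy0 : y ≠ 0 := by
    rintro rfl
    have : u*m*n*N*q ≠ 0 := mul_ne_zero (mul_ne_zero (mul_ne_zero (mul_ne_zero hu hm.ne') hn) hN) hq
    apply this; rw [hy]; norm_num
  have p9 : ∀ p : ℤ, Prime p → p ∣ 9 → p ∣ 3 := fun p hp h9 => hp.dvd_of_dvd_pow (n := 2) (by simpa using h9)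
  -- basic coprimality facts
  have cnm : ∀ p : ℤ, Prime p → p ∣ n → p ∣ m → False := fun p hp => no_p hnm hp
  have ds : ∀ p a b : ℤ, Prime p → p ∣ a^2 + a*b - b^2 → p ∣ a → p ∣ b := fun p a b hp h1 h2 =>
    hp.dvd_of_dvd_pow (n := 2) (by
      rw [show b^2 = a*(a + b) - (a^2 + a*b - b^2) by ring]; exact dvd_sub (h2.mul_right _) h1)
  have ds' : ∀ p a b : ℤ, Prime p → p ∣ a^2 + a*b - b^2 → p ∣ b → p ∣ a := fun p a b hp h1 h2 =>
    hp.dvd_of_dvd_pow (n := 2) (by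
      rw [show a^2 = (a^2 + a*b - b^2) - b*(a - b) by ring]; exact dvd_sub h1 (h2.mul_right _))
  have q2 : q = n^2 + n*N - N^2 := by rw [hqe, hNe]; ring
  have cnu : ∀ p : ℤ, Prime p → p ∣ n → p ∣ u → False := fun p hp h1 h2 => cnm p hp h1 (by
    rw [show m = u - n*8 by rw [hue]; ring]; exact dvd_sub h2 (h1.mul_right _))
  have cnN : ∀ p : ℤ, Prime p → p ∣ n → p ∣ N → False := fun p hp h1 h2 => cnm p hp h1 (by
    rw [show m = n - N by rw [hNe]; ring]; exact dvd_sub h1 h2)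
  have cnq : ∀ p : ℤ, Prime p → p ∣ n → p ∣ q → False := fun p hp h1 h2 =>
    cnm p hp h1 (ds p n m hp (hqe ▸ h2) h1)
  have cmN : ∀ p : ℤ, Prime p → p ∣ m → p ∣ N → False := fun p hp h1 h2 => cnm p hp (by
    rw [show n = m + N by rw [hNe]; ring]; exact dvd_add h1 h2) h1
  have cmq : ∀ p : ℤ, Prime p → p ∣ m → p ∣ q → False := fun p hp h1 h2 =>
    cnm p hp (ds' p n m hp (hqe ▸ h2) h1) h1
  have cNq : ∀ p : ℤ, Prime p → p ∣ N → p ∣ q → False := fun p hp h1 h2 =>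
    cnN p hp (ds' p n N hp (q2 ▸ h2) h1) h1
  obtain ⟨A, hA⟩ : ∃ A, n = A^2 ∨ n = -A^2 := by
    refine Int.sq_of_isCoprime (a := n) (b := u*m*N*q) (c := y) (cop_of fun p hp h1 h2 => ?_) (by rw [← hy]; ring)
    rcases hp.dvd_or_dvd h2 with h2 | h2
    · rcases hp.dvd_or_dvd h2 with h2 | h2
      · rcases hp.dvd_or_dvd h2 with h2 | h2
        · exact cnu p hp h1 h2
        · exact cnm p hp h1 h2
      · exact cnN p hp h1 h2
    · exact cnq p hp h1 h2
  obtain ⟨B, hB⟩ := sqpart_p (x := N) (y := u*m*n*q) hy0 (by rw [← hy]; ring) prime3 (fun p hp h1 h2 => by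
    rcases hp.dvd_or_dvd h2 with h2 | h2
    · rcases hp.dvd_or_dvd h2 with h2 | h2
      · rcases hp.dvd_or_dvd h2 with h2 | h2
        · have : p ∣ 9*n := by
            rw [show 9*n = u + N by rw [hue, hNe]; ring]; exact dvd_add h2 h1
          rcases hp.dvd_or_dvd this with h3 | h3
          · exact p9 p hp h3
          · exact (cnN p hp h3 h1).elim
        · exact (cmN p hp h2 h1).elim
      · exact (cnN p hp h2 h1).elim
    · exact (cNq p hp h1 h2).elim)
  obtain ⟨M, hM⟩ := sqpart_p (x := m) (y := u*N*n*q) hy0 (by rw [← hy]; ring) prime2 (fun p hp h1 h2 => by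
    rcases hp.dvd_or_dvd h2 with h2 | h2
    · rcases hp.dvd_or_dvd h2 with h2 | h2
      · rcases hp.dvd_or_dvd h2 with h2 | h2
        · have : p ∣ 2^3*n := by
            rw [show 2^3*n = u - m by rw [hue]; ring]; exact dvd_sub h2 h1
          rcases hp.dvd_or_dvd this with h3 | h3
          · exact hp.dvd_of_dvd_pow h3
          · exact (cnm p hp h3 h1).elim
        · exact (cmN p hp h1 h2).elim
      · exact (cnm p hp h2 h1).elim
    · exact (cmq p hp h1 h2).elim)
  obtain ⟨C, hC⟩ := sqpart_p (x := q) (y := u*m*n*N) hy0 (by rw [← hy]; ring) prime71 (fun p hp h1 h2 => by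
    rcases hp.dvd_or_dvd h2 with h2 | h2
    · rcases hp.dvd_or_dvd h2 with h2 | h2
      · rcases hp.dvd_or_dvd h2 with h2 | h2
        · have : p ∣ 71*m^2 := by
            rw [show 71*m^2 = u*(u + 6*m) - q*64 by rw [hue, hqe]; ring]
            exact dvd_sub (h2.mul_right _) (h1.mul_right _)
          rcases hp.dvd_or_dvd this with h3 | h3
          · exact h3
          · exact (cmq p hp (hp.dvd_of_dvd_pow h3) h1).elim
        · exact (cmq p hp h2 h1).elim
      · exact (cnq p hp h2 h1).elim
    · exact (cNq p hp h2 h1).elim)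
  obtain ⟨e1, he1, hA⟩ : ∃ e : ℤ, (e = 1 ∨ e = -1) ∧ n = e*A^2 := by
    rcases hA with h | h
    · exact ⟨1, by simp, by rw [h]; ring⟩
    · exact ⟨-1, by simp, by rw [h]; ring⟩
  obtain ⟨e2, he2, hB⟩ : ∃ e : ℤ, (e = 1 ∨ e = -1 ∨ e = 3 ∨ e = -3) ∧ N = e*B^2 := by
    rcases hB with h | h | h | h
    · exact ⟨1, by simp, by rw [h]; ring⟩
    · exact ⟨-1, by simp, by rw [h]; ring⟩
    · exact ⟨3, by simp, by rw [h]⟩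
    · exact ⟨-3, by simp, by rw [h]⟩
  obtain ⟨e3, he3, hC⟩ : ∃ e : ℤ, (e = 1 ∨ e = -1 ∨ e = 71 ∨ e = -71) ∧ q = e*C^2 := by
    rcases hC with h | h | h | h
    · exact ⟨1, by simp, by rw [h]; ring⟩
    · exact ⟨-1, by simp, by rw [h]; ring⟩
    · exact ⟨71, by simp, by rw [h]⟩
    · exact ⟨-71, by simp, by rw [h]⟩
  have hM : m = M^2 ∨ m = 2*M^2 := by
    rcases hM with h | h | h | h
    · exact Or.inl h
    · nlinarith [sq_nonneg M]
    · exact Or.inr h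
    · nlinarith [sq_nonneg M]
  have hA0 : A ≠ 0 := by rintro rfl; simp at hA; exact hn hA
  have hB0 : B ≠ 0 := by rintro rfl; simp at hB; exact hN hB
  have hC0 : C ≠ 0 := by rintro rfl; simp at hC; exact hq hC
  have hM0 : M ≠ 0 := by rintro rfl; simp at hM; omega
  have hABC : A*B*C ≠ 0 := mul_ne_zero (mul_ne_zero hA0 hB0) hC0
  have hprod : n*N*q = (e1*e2*e3)*(A*B*C)^2 := by rw [hA, hB, hC]; ring
  have hprod2 : n*N*q = n^4 - 2*(n*m)^2 + n*m^3 := by rw [hNe, hqe]; ring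
  have hums : (u*m*(e1*e2*e3))*(A*B*C)^2 = y^2 := by
    rw [← hy]; linear_combination -(u*m)*hprod
  obtain ⟨σ, hσ⟩ : ∃ σ, σ = e1*e2*e3 := ⟨_, rfl⟩
  rw [← hσ] at hprod hums
  have hσo : σ % 2 = 1 := by
    rw [hσ]; rcases he1 with rfl | rfl <;> rcases he2 with rfl | rfl | rfl | rfl <;>
      rcases he3 with rfl | rfl | rfl | rfl <;> norm_num
  have hσ8 : σ % 8 = 1 := by
    rcases Int.emod_two_eq_zero_or_one m with hm2 | hm2
    · obtain ⟨m', rfl⟩ : ∃ k, m = 2*k := ⟨m / 2, by omega⟩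
      have hno : n % 2 = 1 := by
        by_contra hh
        exact cnm 2 prime2 (Int.dvd_of_emod_eq_zero (by omega)) (Int.dvd_of_emod_eq_zero hm2)
      have h8 : (n*N*q) % 8 = 1 := by
        have := odd_sq8 (a := n^2) (by rw [pow_two, Int.mul_emod, hno]; rfl)
        rw [hprod2, show n^4 - 2*(n*(2*m'))^2 + n*(2*m')^3 =
          (n^2)^2 + 8*(n*m'^3 - n^2*m'^2) by ring]
        omega
      have ho : (A*B*C) % 2 = 1 := by
        rcases Int.emod_two_eq_zero_or_one (A*B*C) with h0 | h0
        · obtain ⟨k, hk⟩ : ∃ k, A*B*C = 2*k := ⟨A*B*C / 2, by omega⟩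
          rw [hprod, hk, show σ*(2*k)^2 = 2*(2*σ*k^2) by ring] at h8; omega
        · exact h0
      have := odd_sq8 ho
      rw [hprod, Int.mul_emod, this] at h8; omega
    · obtain ⟨z, hz⟩ := rem_sq hABC hums
      have h1 : (u*m) % 8 = 1 := by
        have := odd_sq8 hm2
        rw [hue, show (8*n + m)*m = m^2 + 8*(n*m) by ring]; omega
      have hzo : z % 2 = 1 := by
        rcases Int.emod_two_eq_zero_or_one z with h0 | h0
        · exfalso
          obtain ⟨k, hk⟩ : ∃ k, z = 2*k := ⟨z / 2, by omega⟩
          have : (u*m*σ) % 2 = 1 := by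
            rw [Int.mul_emod, hσo, show (u*m) % 2 = 1 by omega]; rfl
          rw [hz, hk, show (2*k)^2 = 2*(2*k^2) by ring] at this; omega
        · exact h0
      have := odd_sq8 hzo
      rw [← hz, Int.mul_emod, h1] at this; omega
  have hσ1 : σ = 1 ∨ (σ = -71 ∧ (e1 = -1 → (e2 = -1 ∨ e2 = -3) → e2 = -1 ∧ e3 = -71)) := by
    rw [hσ] at hσ8 ⊢
    rcases he1 with rfl | rfl <;> rcases he2 with rfl | rfl | rfl | rfl <;>
      rcases he3 with rfl | rfl | rfl | rfl <;>
      first | (exfalso; revert hσ8; norm_num; done) | norm_num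
  rcases hσ1 with h1 | ⟨h1, hs⟩
  · have := EQ (w := n / m) (Y := (A*B*C : ℤ) / m^2) (by
      have : ((A*B*C : ℤ) : ℚ)^2 = n^4 - 2*(n*m)^2 + n*m^3 := by
        rw [h1] at hprod; exact_mod_cast (by rw [← hprod2, hprod]; ring)
      rw [div_pow, this]; field_simp)
    rcases this with h2 | h2 | h2
    · exact hcon (Or.inl h2)
    · exact hcon (Or.inr (Or.inl h2))
    · rw [h2] at h
      obtain ⟨y, hy⟩ := int_sq (r := 4*z) (N := 5) (by push_cast; linear_combination 16*h)
      exact not_sq5 hy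
  · rw [h1] at hums
    have hu1 : u < 0 := by
      by_contra hh
      have hu2 : 0 < u := lt_of_le_of_ne (not_lt.1 hh) hu.symm
      have : 0 < u*m*(A*B*C)^2 := mul_pos (mul_pos hu2 hm) (by positivity)
      have h3 := sq_nonneg y
      rw [← hums, show u*m * -71*(A*B*C)^2 = -71*(u*m*(A*B*C)^2) by ring] at h3
      linarith
    have hn1 : n < 0 := by linarith
    have hN1 : N < 0 := by linarith
    have he1' : e1 = -1 := by
      rcases he1 with rfl | rfl
      · nlinarith [sq_nonneg A]
      · rfl
    have he2' : e2 = -1 ∨ e2 = -3 := by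
      rcases he2 with rfl | rfl | rfl | rfl
      · nlinarith [sq_nonneg B]
      · simp
      · nlinarith [sq_nonneg B]
      · simp
    obtain ⟨hs1, hs2⟩ := hs he1' he2'
    have hz : ∃ z, (m = M^2 → -71*u = z^2) ∧ (m = 2*M^2 → -142*u = z^2) := by
      rcases hM with hM | hM
      · obtain ⟨z, hz⟩ := rem_sq (x := -71*u) (k := M*(A*B*C)) (y := y) (mul_ne_zero hM0 hABC) (by
          rw [← hums, hM]; ring)
        refine ⟨z, fun _ => hz, fun hh => ?_⟩
        have : 0 < M^2 := by positivity
        omega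
      · obtain ⟨z, hz⟩ := rem_sq (x := -142*u) (k := M*(A*B*C)) (y := y) (mul_ne_zero hM0 hABC) (by
          rw [← hums, hM]; ring)
        refine ⟨z, fun hh => ?_, fun _ => hz⟩
        have : 0 < M^2 := by positivity
        omega
    obtain ⟨z, hz1, hz2⟩ := hz
    exact Rneg (n := n) (N := N) (u := u) (m := m) (q := q) (A := A) (C := C) (z := z) (M := M) (B := B)
      hue (by omega) hqe (by rw [hA, he1']; ring) (by rw [hB, hs1]; ring) (by rw [hC, hs2]) hM hu hz1 hz2

end QP

namespace QP
section lemL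
variable {R : Type*} [CommRing R] [IsDomain R] [UniqueFactorizationMonoid R]

lemma mult_pos_div {q l : R} (hq : Prime q) (hl : q*l ≠ 0) {n : ℕ} (h : multiplicity q (q*l) ≤ n + 1) :
    multiplicity q l ≤ n := by
  have := mult_mul hq (left_ne_zero_of_mul hl) (right_ne_zero_of_mul hl)
  rw [multiplicity_self] at this; omega

lemma mult_pos_zero {q l : R} (hq : Prime q) (hl : q*l ≠ 0) (h : multiplicity q (q*l) ≤ 0) : False := by
  have := mult_mul hq (left_ne_zero_of_mul hl) (right_ne_zero_of_mul hl)
  rw [multiplicity_self] at this; omega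

lemma odd_sq_dvd {q a x y : R} (hq : Prime q) (ha : a ≠ 0) (ho : Odd (multiplicity q a)) (h : y^2 = a*x) :
    q ∣ x := by
  by_contra hx
  have hx0 : x ≠ 0 := by rintro rfl; simp at hx
  have hy : y ≠ 0 := by rintro rfl; simp at h; tauto
  have := odd_trans hq hy h.symm ho
  rw [mult_zero hx] at this; simp at this

lemma sq_dvd_of_mul {q a x : R} (hq : Prime q) (ha : ¬ q ∣ a) (h : q^2 ∣ a*x) : q^2 ∣ x :=
  hq.pow_dvd_of_dvd_mul_left 2 ha h

lemma L1 {q : R} (hq : Prime q) {g1 g2 g3 g4 g5 a2 a1 a0 : R} (hg : ¬ q ∣ g1) (ha : ¬ q ∣ a2) (ha0 : a0 ≠ 0)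
    (ho : Odd (multiplicity q a0)) : ∀ (n : ℕ) (l b1 b0 h3 h2 h1 h0 : R), l ≠ 0 → multiplicity q l ≤ n →
    b0^2 = a0*h0 → l^2*g1 = 2*b0*b1 - (a0*h1 + a1*h0) →
    l^2*g2 = b1^2 - (a0*h2 + a1*h1 + a2*h0) → l^2*g3 = - (a0*h3 + a1*h2 + a2*h1) →
    l^2*g4 = - (a1*h3 + a2*h2) → l^2*g5 = - (a2*h3) → False := by
  obtain ⟨a0', rfl⟩ := dvd_of_odd ho
  intro n
  induction n using Nat.strong_induction_on with
  | _ n ih =>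
  intro l b1 b0 h3 h2 h1 h0 hl hn e0 e1 e2 e3 e4 e5
  obtain ⟨k0, rfl⟩ := odd_sq_dvd hq ha0 ho e0
  obtain ⟨c0, rfl⟩ : q ∣ b0 := hq.dvd_of_dvd_pow (n := 2) (e0 ▸ ⟨a0'*(q*k0), by ring⟩)
  obtain ⟨l', rfl⟩ : q ∣ l := by
    have : q ∣ l^2*g1 := e1 ▸ ⟨2*c0*b1 - (a0'*h1 + a1*k0), by ring⟩
    exact hq.dvd_of_dvd_pow ((hq.dvd_or_dvd this).resolve_right hg)
  obtain ⟨k3, rfl⟩ : q^2 ∣ h3 := sq_dvd_of_mul hq ha ⟨-(l'^2*g5), by linear_combination e5⟩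
  obtain ⟨k2, rfl⟩ : q^2 ∣ h2 := sq_dvd_of_mul hq ha ⟨-(l'^2*g4) - a1*k3, by linear_combination e4⟩
  obtain ⟨k1, rfl⟩ : q^2 ∣ h1 := sq_dvd_of_mul hq ha ⟨-(l'^2*g3) - a1*k2 - q*a0'*k3, by linear_combination e3⟩
  obtain ⟨c1, rfl⟩ : q ∣ b1 := hq.dvd_of_dvd_pow (n := 2)
    ⟨q*l'^2*g2 + (q*a0'*(q*k2) + a1*(q*k1) + a2*k0), by linear_combination -e2⟩
  obtain ⟨k0', hk0⟩ : q^2 ∣ q*k0 := sq_dvd_of_mul hq ha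
    ⟨c1^2 - (q*a0'*k2 + a1*k1) - l'^2*g2, by linear_combination e2⟩
  rw [hk0] at e0 e1 e2
  have hq2 : q^2 ≠ 0 := pow_ne_zero 2 hq.ne_zero
  have f0 : c0^2 = q*a0'*k0' := mul_left_cancel₀ hq2 (by linear_combination e0)
  have f1 : l'^2*g1 = 2*c0*c1 - (q*a0'*k1 + a1*k0') := mul_left_cancel₀ hq2 (by linear_combination e1)
  have f2 : l'^2*g2 = c1^2 - (q*a0'*k2 + a1*k1 + a2*k0') := mul_left_cancel₀ hq2 (by linear_combination e2)
  have f3 : l'^2*g3 = - (q*a0'*k3 + a1*k2 + a2*k1) := mul_left_cancel₀ hq2 (by linear_combination e3)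
  have f4 : l'^2*g4 = - (a1*k3 + a2*k2) := mul_left_cancel₀ hq2 (by linear_combination e4)
  have f5 : l'^2*g5 = - (a2*k3) := mul_left_cancel₀ hq2 (by linear_combination e5)
  rcases n with _ | n
  · exact mult_pos_zero hq hl hn
  · exact ih n (Nat.lt_succ_self n) l' c1 c0 k3 k2 k1 k0' (right_ne_zero_of_mul hl) (mult_pos_div hq hl hn) f0 f1 f2 f3 f4 f5

lemma L2 {q : R} (hq : Prime q) {g1 g2 g3 g4 g5 a2 a1 a0 : R} (hg : ¬ q ∣ g1) (ha2 : q ∣ a2) (ha : ¬ q ∣ a1) (ha0 : a0 ≠ 0)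
    (ho : Odd (multiplicity q a0)) : ∀ (n : ℕ) (l b3 b0 h4 h3 h2 h1 h0 : R), l ≠ 0 → multiplicity q l ≤ n →
    b0^2 = a0*h0 → l^2*g1 = - (a0*h1 + a1*h0) →
    l^2*g2 = - (a0*h2 + a1*h1 + a2*h0) → l^2*g3 = 2*b0*b3 - (a0*h3 + a1*h2 + a2*h1) →
    l^2*g4 = - (a0*h4 + a1*h3 + a2*h2) → l^2*g5 = - (a1*h4 + a2*h3) → b3^2 = a2*h4 → False := by
  obtain ⟨a0', rfl⟩ := dvd_of_odd ho
  obtain ⟨a2', rfl⟩ := ha2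
  intro n
  induction n using Nat.strong_induction_on with
  | _ n ih =>
  intro l b3 b0 h4 h3 h2 h1 h0 hl hn e0 e1 e2 e3 e4 e5 e6
  have res : ∀ x, q ∣ a1*x → q ∣ x := fun x hx => (hq.dvd_or_dvd hx).resolve_left ha
  obtain ⟨k0, rfl⟩ := odd_sq_dvd hq ha0 ho e0
  obtain ⟨c0, rfl⟩ : q ∣ b0 := hq.dvd_of_dvd_pow (n := 2) (e0 ▸ ⟨a0'*(q*k0), by ring⟩)
  obtain ⟨l', rfl⟩ : q ∣ l := by
    have : q ∣ l^2*g1 := e1 ▸ ⟨- (a0'*h1 + a1*k0), by ring⟩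
    exact hq.dvd_of_dvd_pow ((hq.dvd_or_dvd this).resolve_right hg)
  obtain ⟨k4, rfl⟩ : q ∣ h4 := res _ ⟨-(q*l'^2*g5) - a2'*h3, by linear_combination e5⟩
  obtain ⟨c3, rfl⟩ : q ∣ b3 := hq.dvd_of_dvd_pow (n := 2) (e6 ▸ ⟨a2'*(q*k4), by ring⟩)
  obtain ⟨k2, rfl⟩ : q ∣ h2 := res _ ⟨-(q*l'^2*g3) + 2*c0*(q*c3) - a0'*h3 - a2'*h1, by linear_combination e3⟩
  obtain ⟨k3, rfl⟩ : q ∣ h3 := res _ ⟨-(q*l'^2*g4) - q*a0'*k4 - q*a2'*k2, by linear_combination e4⟩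
  obtain ⟨k1, rfl⟩ : q ∣ h1 := res _ ⟨-(q*l'^2*g2) - q*a0'*k2 - q*a2'*k0, by linear_combination e2⟩
  obtain ⟨m4, hm4⟩ : q^2 ∣ q*k4 := sq_dvd_of_mul hq ha ⟨-(l'^2*g5) - a2'*k3, by linear_combination e5⟩
  obtain ⟨m3, hm3⟩ : q^2 ∣ q*k3 := sq_dvd_of_mul hq ha ⟨-(l'^2*g4) - a2'*k2 - a0'*k4, by linear_combination e4⟩
  obtain ⟨m2, hm2⟩ : q^2 ∣ q*k2 := sq_dvd_of_mul hq ha ⟨-(l'^2*g3) - a2'*k1 - a0'*k3 + 2*c0*c3, by linear_combination e3⟩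
  obtain ⟨m1, hm1⟩ : q^2 ∣ q*k1 := sq_dvd_of_mul hq ha ⟨-(l'^2*g2) - a2'*k0 - a0'*k2, by linear_combination e2⟩
  obtain ⟨m0, hm0⟩ : q^2 ∣ q*k0 := sq_dvd_of_mul hq ha ⟨-(l'^2*g1) - a0'*k1, by linear_combination e1⟩
  rw [hm0] at e0 e1 e2
  rw [hm1] at e1 e2 e3
  rw [hm2] at e2 e3 e4
  rw [hm3] at e3 e4 e5
  rw [hm4] at e4 e5 e6
  have hq2 : q^2 ≠ 0 := pow_ne_zero 2 hq.ne_zero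
  have f0 : c0^2 = q*a0'*m0 := mul_left_cancel₀ hq2 (by linear_combination e0)
  have f1 : l'^2*g1 = - (q*a0'*m1 + a1*m0) := mul_left_cancel₀ hq2 (by linear_combination e1)
  have f2 : l'^2*g2 = - (q*a0'*m2 + a1*m1 + q*a2'*m0) := mul_left_cancel₀ hq2 (by linear_combination e2)
  have f3 : l'^2*g3 = 2*c0*c3 - (q*a0'*m3 + a1*m2 + q*a2'*m1) := mul_left_cancel₀ hq2 (by linear_combination e3)
  have f4 : l'^2*g4 = - (q*a0'*m4 + a1*m3 + q*a2'*m2) := mul_left_cancel₀ hq2 (by linear_combination e4)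
  have f5 : l'^2*g5 = - (a1*m4 + q*a2'*m3) := mul_left_cancel₀ hq2 (by linear_combination e5)
  have f6 : c3^2 = q*a2'*m4 := mul_left_cancel₀ hq2 (by linear_combination e6)
  rcases n with _ | n
  · exact mult_pos_zero hq hl hn
  · exact ih n (Nat.lt_succ_self n) l' c3 c0 m4 m3 m2 m1 m0 (right_ne_zero_of_mul hl) (mult_pos_div hq hl hn) f0 f1 f2 f3 f4 f5 f6

/-- combination of the two cases, linear `b`. -/
lemma L12 {q : R} (hq : Prime q) {g1 g2 g3 g4 g5 a2 a1 a0 : R} (hg : ¬ q ∣ g1) (hp : ¬ (q ∣ a2 ∧ q ∣ a1 ∧ q ∣ a0))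
    (ha0 : a0 ≠ 0) {l b1 b0 h3 h2 h1 h0 : R} (hl : l ≠ 0)
    (e0 : b0^2 = a0*h0) (e1 : l^2*g1 = 2*b0*b1 - (a0*h1 + a1*h0))
    (e2 : l^2*g2 = b1^2 - (a0*h2 + a1*h1 + a2*h0)) (e3 : l^2*g3 = - (a0*h3 + a1*h2 + a2*h1))
    (e4 : l^2*g4 = - (a1*h3 + a2*h2)) (e5 : l^2*g5 = - (a2*h3)) : ¬ Odd (multiplicity q a0) := by
  intro ho
  by_cases h2' : q ∣ a2
  · have hqa := dvd_of_odd ho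
    have h1' : ¬ q ∣ a1 := fun h => hp ⟨h2', h, hqa⟩
    have hD : a1^2 - a0*a2 ≠ 0 := by
      intro hh
      exact h1' (hq.dvd_of_dvd_pow (n := 2) (by rw [sub_eq_zero.1 hh]; exact hqa.mul_right _))
    obtain ⟨D, hDD⟩ : ∃ D, D = a1^2 - a0*a2 := ⟨_, rfl⟩
    rw [← hDD] at hD
    obtain ⟨x, hx⟩ : ∃ x, x = b1*a2 := ⟨_, rfl⟩
    obtain ⟨y, hy⟩ : ∃ y, y = - b1*a1 := ⟨_, rfl⟩
    refine L2 hq hg h2' h1' ha0 ho (g2 := g2) (g3 := g3) (g4 := g4) (g5 := g5) _ (D*l) (a2*x) (D*b0 + a0*y)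
      (a2*x^2) (D^2*h3 + 2*a2*x*y + a1*x^2)
      (D^2*h2 + 2*D*b1*x + a2*y^2 + 2*a1*x*y + a0*x^2)
      (D^2*h1 + 2*D*(b1*y + b0*x) + a1*y^2 + 2*a0*x*y)
      (D^2*h0 + 2*D*b0*y + a0*y^2) (mul_ne_zero hD hl) le_rfl ?_ ?_ ?_ ?_ ?_ ?_ ?_
    · linear_combination D^2*e0
    · subst hDD hx hy; linear_combination (a1^2 - a0*a2)^2*e1
    · subst hDD hx hy; linear_combination (a1^2 - a0*a2)^2*e2
    · subst hDD hx hy; linear_combination (a1^2 - a0*a2)^2*e3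
    · subst hDD hx hy; linear_combination (a1^2 - a0*a2)^2*e4
    · subst hDD hx hy; linear_combination (a1^2 - a0*a2)^2*e5
    · ring
  · exact L1 hq hg h2' ha0 ho _ l b1 b0 h3 h2 h1 h0 hl le_rfl e0 e1 e2 e3 e4 e5

/-- version for the point at infinity: `b = b2 w^2 + b3 w^3`. -/
lemma L12i {q : R} (hq : Prime q) {g1 g2 g3 g4 g5 a2 a1 a0 : R} (hg : ¬ q ∣ g1) (hp : ¬ (q ∣ a2 ∧ q ∣ a1 ∧ q ∣ a0))
    (ha0 : a0 ≠ 0) (ha2 : a2 ≠ 0) {l b3 b2 h4 h3 h2 h1 : R} (hl : l ≠ 0)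
    (e1 : l^2*g1 = - (a0*h1)) (e2 : l^2*g2 = - (a0*h2 + a1*h1))
    (e3 : l^2*g3 = - (a0*h3 + a1*h2 + a2*h1)) (e4 : l^2*g4 = b2^2 - (a0*h4 + a1*h3 + a2*h2))
    (e5 : l^2*g5 = 2*b2*b3 - (a1*h4 + a2*h3)) (e6 : b3^2 = a2*h4) : ¬ Odd (multiplicity q a0) := by
  obtain ⟨x, hx⟩ : ∃ x, x = a2*b3 := ⟨_, rfl⟩
  obtain ⟨y, hy⟩ : ∃ y, y = a2*b2 - a1*b3 := ⟨_, rfl⟩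
  -- a2^2*b = A*(x w + y) + r1 w + r0
  refine L12 hq hg hp ha0 (g2 := g2) (g3 := g3) (g4 := g4) (g5 := g5) (a2 := a2) (a1 := a1)
    (l := a2^2*l) (b1 := -(a1*y + a0*x)) (b0 := -(a0*y))
    (h3 := a2^4*h3 - 2*(-(a1*y + a0*x))*0 - (2*a2*x*y + a1*x^2))
    (h2 := a2^4*h2 - 2*(-(a1*y + a0*x))*x - (a2*y^2 + 2*a1*x*y + a0*x^2))
    (h1 := a2^4*h1 - 2*(-(a1*y + a0*x)*y - a0*y*x) - (a1*y^2 + 2*a0*x*y))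
    (h0 := a0*y^2) (mul_ne_zero (pow_ne_zero 2 ha2) hl) ?_ ?_ ?_ ?_ ?_ ?_
  · ring
  · linear_combination a2^4*e1
  · linear_combination a2^4*e2
  · linear_combination a2^4*e3
  · subst hx hy; linear_combination a2^4*e4 + a2^3*a0*e6
  · subst hx hy; linear_combination a2^4*e5 + a1*a2^3*e6
end lemL
end QP

namespace QP
open QuadraticAlgebra

abbrev ZB := QuadraticAlgebra ℤ 1 (-1)

def nm (z : ZB) : ℤ := z.re^2 - z.re*z.im - z.im^2

lemma nm_mul (x y : ZB) : nm (x*y) = nm x*nm y := by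
  simp only [nm, re_mul, im_mul]; ring

lemma nm_ne {z : ZB} (h : z ≠ 0) : nm z ≠ 0 := by
  intro hz
  have : z.im = 0 := by
    by_contra him
    apply q_ne (n := z.re) (m := - z.im) (by omega)
    rw [← hz, nm]; ring
  apply h
  rw [nm, this] at hz
  ext
  · simp at hz ⊢; exact hz
  · simpa using this

instance : IsDomain ZB := by
  haveI : NoZeroDivisors ZB := ⟨by
    intro a b h
    by_contra hh
    push Not at hh
    have := nm_mul a b
    rw [h] at this
    exact mul_ne_zero (nm_ne hh.1) (nm_ne hh.2) (by rw [← this]; simp [nm])⟩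
  exact NoZeroDivisors.to_isDomain ZB

lemma rnd (P n : ℤ) (hn : n ≠ 0) : ∃ r P', P = r*n + P' ∧ (2*P')^2 ≤ n^2 := by
  have h1 := Int.emod_nonneg P hn
  have h2 := Int.emod_lt_abs P hn
  have h3 := Int.mul_ediv_add_emod P n
  by_cases h : 2*(P % n) ≤ |n|
  · exact ⟨P / n, P % n, by linarith, by rw [← sq_abs n]; nlinarith⟩
  · push Not at h
    rcases abs_choice n with h4 | h4
    · refine ⟨P / n + 1, P % n - n, by linarith, ?_⟩
      rw [h4] at h h2; nlinarith
    · refine ⟨P / n - 1, P % n + n, by linarith, ?_⟩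
      rw [h4] at h h2; nlinarith

lemma bnd {P Q n : ℤ} (hn : n ≠ 0) (h1 : (2*P)^2 ≤ n^2) (h2 : (2*Q)^2 ≤ n^2) :
    |P^2 - P*Q - Q^2| < n^2 := by
  have : 0 < n^2 := by positivity
  rw [abs_lt]
  constructor <;> nlinarith [sq_nonneg (P + Q), sq_nonneg (P - Q)]

lemma edi (x y : ZB) (hy : y ≠ 0) : ∃ q : ZB, (nm (x - y*q)).natAbs < (nm y).natAbs := by
  obtain ⟨r, P', hP, hP2⟩ := rnd (x*star y).re (nm y) (nm_ne hy)
  obtain ⟨t, Q', hQ, hQ2⟩ := rnd (x*star y).im (nm y) (nm_ne hy)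
  refine ⟨⟨r, t⟩, ?_⟩
  have h := bnd (nm_ne hy) hP2 hQ2
  have key : nm (x - y * ⟨r, t⟩)*nm y = P'^2 - P'*Q' - Q'^2 := by
    have e1 : P' = (x*star y).re - r*nm y := by linarith
    have e2 : Q' = (x*star y).im - t*nm y := by linarith
    rw [e1, e2]
    simp only [nm, re_mul, im_mul, re_sub, im_sub, re_star, im_star]; ring
  rw [← key, abs_mul] at h
  have h0 : 0 < |nm y| := abs_pos.2 (nm_ne hy)
  rw [← Int.ofNat_lt, Int.natCast_natAbs, Int.natCast_natAbs]
  rw [← sq_abs (nm y)] at h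
  nlinarith

open Classical in
noncomputable abbrev eD : EuclideanDomain ZB :=
  { (inferInstance : CommRing ZB), (inferInstance : Nontrivial ZB) with
    quotient := fun x y => if hy : y = 0 then 0 else Classical.choose (edi x y hy)
    remainder := fun x y => x - y*(if hy : y = 0 then 0 else Classical.choose (edi x y hy))
    quotient_zero := by intro a; simp
    quotient_mul_add_remainder_eq := by intro a b; ring
    r := fun x y => (nm x).natAbs < (nm y).natAbs
    r_wellFounded := (measure (fun x => (nm x).natAbs)).wf
    remainder_lt := by
      intro a b hb
      simp only [hb, dite_false]
      exact Classical.choose_spec (edi a b hb)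
    mul_left_not_lt := by
      intro a b hb
      rw [nm_mul, Int.natAbs_mul, not_lt]
      exact Nat.le_mul_of_pos_right _ (Int.natAbs_pos.2 (nm_ne hb)) }

instance : IsPrincipalIdealRing ZB := @EuclideanDomain.to_principal_ideal_domain ZB eD

noncomputable instance : UniqueFactorizationMonoid ZB := inferInstance

lemma unit_desc : ∀ (n : ℕ) (x y : ℤ), x.natAbs + y.natAbs ≤ n → x^2 - x*y - y^2 = 1 →
    ∃ a b : ℤ, (x = a^2 + b^2 ∧ y = 2*a*b - b^2) ∨ (-x = a^2 + b^2 ∧ -y = 2*a*b - b^2) := by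
  intro n
  induction n using Nat.strong_induction_on with
  | _ n ih =>
  have pos : ∀ x y : ℤ, 0 < x → x.natAbs + y.natAbs ≤ n → x^2 - x*y - y^2 = 1 →
    ∃ a b : ℤ, (x = a^2 + b^2 ∧ y = 2*a*b - b^2) ∨ (-x = a^2 + b^2 ∧ -y = 2*a*b - b^2) := by
    intro x y hx hn h
    rcases lt_trichotomy y 0 with hy | hy | hy
    · have h1 : x ≤ -y := by nlinarith
      have h2 : -y ≤ 2*x := by nlinarith
      obtain ⟨a, b, hab⟩ := ih (x.natAbs) (by omega) (2*x + y) (x + y) (by omega) (by linear_combination h)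
      refine ⟨b, a - b, ?_⟩
      rcases hab with ⟨h3, h4⟩ | ⟨h3, h4⟩
      · left; constructor <;> nlinarith
      · right; constructor <;> nlinarith
    · subst hy
      have : x = 1 := by nlinarith
      exact ⟨1, 0, by subst this; simp⟩
    · have h1 : y < x := by nlinarith
      have h2 : x ≤ 2*y := by
        by_contra hh
        have : 2*y + 1 ≤ x := by omega
        nlinarith
      obtain ⟨a, b, hab⟩ := ih (y.natAbs) (by omega) (x - y) (2*y - x) (by omega) (by linear_combination h)
      refine ⟨a + b, a, ?_⟩
      rcases hab with ⟨h3, h4⟩ | ⟨h3, h4⟩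
      · left; constructor <;> nlinarith
      · right; constructor <;> nlinarith
  intro x y hn h
  rcases lt_trichotomy x 0 with hx | hx | hx
  · obtain ⟨a, b, hab⟩ := pos (-x) (-y) (by omega) (by omega) (by linear_combination h)
    exact ⟨a, b, by simpa using hab.symm⟩
  · subst hx; nlinarith [sq_nonneg y]
  · exact pos x y hx hn h

lemma unit_sq {u : ZB} (h : nm u = 1) : ∃ v : ZB, u = v^2 ∨ u = - v^2 := by
  obtain ⟨a, b, hab⟩ := unit_desc _ u.re u.im le_rfl h
  refine ⟨⟨a, b⟩, ?_⟩
  rcases hab with ⟨h1, h2⟩ | ⟨h1, h2⟩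
  · left; ext
    · simp only [pow_two, re_mul]; linarith
    · simp only [pow_two, im_mul]; linarith
  · right; ext
    · simp only [pow_two, re_mul, re_neg]; linarith
    · simp only [pow_two, im_mul, im_neg]; linarith
end QP

namespace QP
open QuadraticAlgebra

structure Sp (s p c d : ℚ) : Prop where
  irr : ∀ r : ℚ, r^2 + s*r + p ≠ 0
  E1 : 8*(s^4 - 3*s^2*p + p^2) + (-s^3 + 2*s*p) - 16*(s^2 - p) - 6*s + 1 = -s*c^2 + 2*c*d
  E0 : 8*(s^3*p - 2*s*p^2) + (-s^2*p + p^2) - 16*s*p - 6*p = d^2 - p*c^2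
  nz : c ≠ 0 ∨ d ≠ 0

lemma Sp.fac {K : Type*} [Field K] [CharZero K] {s p c d : ℚ} (h : Sp s p c d) (w : K) :
    8*w^5 + w^4 - 16*w^3 + 6*w^2 + w - (c*w + d)^2 =
      (w^2 + s*w + p)*(8*w^3 + (1 - 8*s)*w^2 + (-16 - 8*p - s + 8*s^2)*w
        + (6 - c^2 - s*(-16 - 8*p - s + 8*s^2) - p*(1 - 8*s))) := by
  have e1 : ((8*(s^4 - 3*s^2*p + p^2) + (-s^3 + 2*s*p) - 16*(s^2 - p) - 6*s + 1 : ℚ) : K)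
    = ((-s*c^2 + 2*c*d : ℚ) : K) := by rw [h.E1]
  have e0 : ((8*(s^3*p - 2*s*p^2) + (-s^2*p + p^2) - 16*s*p - 6*p : ℚ) : K)
    = ((d^2 - p*c^2 : ℚ) : K) := by rw [h.E0]
  push_cast at e1 e0
  linear_combination w*e1 + e0

lemma prim3 (s p : ℚ) : ∃ a2 a1 a0 : ℤ, 0 < a2 ∧ (a2 : ℚ)*s = a1 ∧ (a2 : ℚ)*p = a0 ∧
    ∃ x y z : ℤ, x*a2 + y*a1 + z*a0 = 1 := by
  classical
  have hex : ∃ n : ℕ, 0 < n ∧ ∃ a1 a0 : ℤ, (n : ℚ)*s = a1 ∧ (n : ℚ)*p = a0 := by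
    refine ⟨s.den*p.den, Nat.mul_pos s.den_pos p.den_pos, s.num*p.den, p.num*s.den, ?_, ?_⟩
    · push_cast; rw [← Rat.mul_den_eq_num s]; ring
    · push_cast; rw [← Rat.mul_den_eq_num p]; ring
  obtain ⟨hn, a1, a0, h1, h0⟩ := Nat.find_spec hex
  have hmin := fun m hm => Nat.find_min hex (m := m) hm
  generalize Nat.find hex = n at *
  refine ⟨n, a1, a0, by exact_mod_cast hn, by exact_mod_cast h1, by exact_mod_cast h0, ?_⟩
  have hc : IsCoprime (Int.gcd n a1 : ℤ) a0 := by
    refine cop_of fun q hq hg h => ?_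
    have hqn : q ∣ (n : ℤ) := hg.trans (Int.gcd_dvd_left _ _)
    have hq1 : q ∣ a1 := hg.trans (Int.gcd_dvd_right _ _)
    obtain ⟨r, hr⟩ := Int.natAbs_dvd_natAbs.2 hqn
    rw [Int.natAbs_natCast] at hr
    have hqa : 1 < q.natAbs := by
      have := Int.prime_iff_natAbs_prime.1 hq; exact this.one_lt
    have hq0 : ((q.natAbs : ℕ) : ℚ) ≠ 0 := by positivity
    obtain ⟨b1, rfl⟩ := Int.natAbs_dvd.2 hq1
    obtain ⟨b0, rfl⟩ := Int.natAbs_dvd.2 h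
    apply hmin r
    · rw [hr]
      have : 0 < r := by
        rcases Nat.eq_zero_or_pos r with h | h
        · rw [hr, h] at hn; omega
        · exact h
      nlinarith
    · refine ⟨?_, b1, b0, ?_, ?_⟩
      · rcases Nat.eq_zero_or_pos r with h | h
        · rw [hr, h] at hn; omega
        · exact h
      · apply mul_left_cancel₀ hq0
        rw [hr, Nat.cast_mul, Int.cast_mul, Int.cast_natCast] at h1; rw [← h1]; ring
      · apply mul_left_cancel₀ hq0
        rw [hr, Nat.cast_mul, Int.cast_mul, Int.cast_natCast] at h0; rw [← h0]; ring
  obtain ⟨x, y, hxy⟩ := hc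
  refine ⟨x*Int.gcdA n a1, x*Int.gcdB n a1, y, ?_⟩
  rw [← hxy, Int.gcd_eq_gcd_ab]; ring

lemma clr : ∀ l : List ℚ, ∃ m : ℤ, m ≠ 0 ∧ ∀ x ∈ l, ∃ n : ℤ, (m : ℚ)*x = n := by
  intro l
  induction l with
  | nil => exact ⟨1, one_ne_zero, by simp⟩
  | cons x l ih =>
    obtain ⟨m, hm, h⟩ := ih
    refine ⟨m*x.den, mul_ne_zero hm (by exact_mod_cast x.den_nz), ?_⟩
    intro y hy
    rcases List.mem_cons.1 hy with rfl | hy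
    · exact ⟨m*y.num, by push_cast; rw [← Rat.mul_den_eq_num y]; ring⟩
    · obtain ⟨n, hn⟩ := h y hy
      exact ⟨n*x.den, by push_cast; rw [← hn]; ring⟩

/-- integral model of a point -/
structure IM (s p : ℚ) (a2 a1 a0 l B1 B0 H3 H2 H1 H0 : ℤ) : Prop where
  pos : 0 < a2
  hs : (a2 : ℚ)*s = a1
  hp : (a2 : ℚ)*p = a0
  bez : ∃ x y z : ℤ, x*a2 + y*a1 + z*a0 = 1
  hl : l ≠ 0
  e0 : B0^2 = a0*H0
  e1 : l^2 = 2*B0*B1 - (a0*H1 + a1*H0)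
  e2 : l^2*6 = B1^2 - (a0*H2 + a1*H1 + a2*H0)
  e3 : l^2*(-16) = - (a0*H3 + a1*H2 + a2*H1)
  e4 : l^2 = - (a1*H3 + a2*H2)
  e5 : l^2*8 = - (a2*H3)

lemma Sp.im {s p c d : ℚ} (h : Sp s p c d) : ∃ a2 a1 a0 l B1 B0 H3 H2 H1 H0 : ℤ, IM s p a2 a1 a0 l B1 B0 H3 H2 H1 H0 := by
  obtain ⟨a2, a1, a0, ha2, h1, h0, hb⟩ := prim3 s p
  obtain ⟨h₂, hh2⟩ : ∃ t, t = 1 - 8*s := ⟨_, rfl⟩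
  obtain ⟨h₁, hh1⟩ : ∃ t, t = -16 - 8*p - s*h₂ := ⟨_, rfl⟩
  obtain ⟨h₀, hh0⟩ : ∃ t, t = 6 - c^2 - s*h₁ - p*h₂ := ⟨_, rfl⟩
  obtain ⟨l, hl, hm⟩ := clr [c, d, 8 / a2, h₂ / a2, h₁ / a2, h₀ / a2]
  have ha : (a2 : ℚ) ≠ 0 := by exact_mod_cast ha2.ne'
  obtain ⟨B1, hB1⟩ := hm c (by simp)
  obtain ⟨B0, hB0⟩ := hm d (by simp)
  obtain ⟨k3, hk3⟩ := hm (8 / a2) (by simp)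
  obtain ⟨k2, hk2⟩ := hm (h₂ / a2) (by simp)
  obtain ⟨k1, hk1⟩ := hm (h₁ / a2) (by simp)
  obtain ⟨k0, hk0⟩ := hm (h₀ / a2) (by simp)
  have q3 : (a2 : ℚ)*k3 = l*8 := by rw [← hk3]; field_simp
  have q2 : (a2 : ℚ)*k2 = l*h₂ := by rw [← hk2]; field_simp
  have q1 : (a2 : ℚ)*k1 = l*h₁ := by rw [← hk1]; field_simp
  have q0 : (a2 : ℚ)*k0 = l*h₀ := by rw [← hk0]; field_simp
  have E1 := h.E1
  have E0 := h.E0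
  refine ⟨a2, a1, a0, l, B1, B0, -l*k3, -l*k2, -l*k1, -l*k0, ha2, h1, h0, hb, hl, ?_, ?_, ?_, ?_, ?_, ?_⟩
  all_goals (rw [← Int.cast_inj (α := ℚ)]; push_cast)
  all_goals try simp only [← h1, ← h0, ← hB1, ← hB0]
  · have : (a2 : ℚ)*p*(-l*k0) = -l*p*(l*h₀) := by rw [← q0]; ring
    rw [this, hh0, hh1, hh2]; linear_combination -(l : ℚ)^2*E0
  · have : (a2 : ℚ)*p*(-l*k1) + a2*s*(-l*k0) = -l*(p*(l*h₁) + s*(l*h₀)) := by rw [← q0, ← q1]; ring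
    rw [this, hh0, hh1, hh2]; linear_combination (l : ℚ)^2*E1
  · have : (a2 : ℚ)*p*(-l*k2) + a2*s*(-l*k1) + a2*(-l*k0) = -l*(p*(l*h₂) + s*(l*h₁) + l*h₀) := by
      rw [← q0, ← q1, ← q2]; ring
    rw [this, hh0, hh1, hh2]; ring
  · have : (a2 : ℚ)*p*(-l*k3) + a2*s*(-l*k2) + a2*(-l*k1) = -l*(p*(l*8) + s*(l*h₂) + l*h₁) := by
      rw [← q3, ← q1, ← q2]; ring
    rw [this, hh1, hh2]; ring
  · have : (a2 : ℚ)*s*(-l*k3) + a2*(-l*k2) = -l*(s*(l*8) + l*h₂) := by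
      rw [← q3, ← q2]; ring
    rw [this, hh2]; ring
  · have : (a2 : ℚ)*(-l*k3) = -l*(l*8) := by
      rw [← q3]; ring
    rw [this]; ring

lemma im_ne {s p : ℚ} {a2 a1 a0 : ℤ} (h : ∀ r : ℚ, r^2 + s*r + p ≠ 0) (h2 : 0 < a2) (h1 : (a2 : ℚ)*s = a1)
    (h0 : (a2 : ℚ)*p = a0) (x y : ℤ) (hy : y ≠ 0) : a2*x^2 + a1*x*y + a0*y^2 ≠ 0 := by
  intro hh
  have hy' : (y : ℚ) ≠ 0 := by exact_mod_cast hy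
  have ha : (a2 : ℚ) ≠ 0 := by exact_mod_cast h2.ne'
  apply h (x / y)
  have : (a2 : ℚ)*x^2 + a1*x*y + a0*y^2 = 0 := by exact_mod_cast hh
  rw [← h1, ← h0] at this
  field_simp
  apply mul_left_cancel₀ ha
  linear_combination this

variable {s p : ℚ} {a2 a1 a0 l B1 B0 H3 H2 H1 H0 : ℤ}

lemma IM.s0 (h : IM s p a2 a1 a0 l B1 B0 H3 H2 H1 H0) (hi : ∀ r : ℚ, r^2 + s*r + p ≠ 0) :
    ∃ k : ℤ, a0 = k^2 ∨ a0 = -k^2 := by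
  have hn := im_ne hi h.pos h.hs h.hp 0 1 one_ne_zero
  simp at hn
  obtain ⟨x, y, z, hb⟩ := h.bez
  obtain ⟨d, k, hdk, hd⟩ := sqpart a0 1 hn (fun q hq ho => absurd ho
    (L12 hq (g1 := 1) (g2 := 6) (g3 := -16) (g4 := 1) (g5 := 8) (a2 := a2) (a1 := a1) (fun hh => hq.not_isUnit (isUnit_of_dvd_one hh))
      (fun ⟨t2, t1, t0⟩ => hq.not_isUnit (isUnit_of_dvd_one (hb ▸ dvd_add (dvd_add (t2.mul_left _) (t1.mul_left _)) (t0.mul_left _))))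
      hn h.hl h.e0 (by rw [mul_one]; exact h.e1) h.e2 h.e3 (by rw [mul_one]; exact h.e4) h.e5))
  refine ⟨k, ?_⟩
  rcases Int.isUnit_iff.1 (isUnit_of_dvd_one hd) with rfl | rfl
  · left; rw [hdk]; ring
  · right; rw [hdk]; ring

lemma IM.s1 (h : IM s p a2 a1 a0 l B1 B0 H3 H2 H1 H0) (hi : ∀ r : ℚ, r^2 + s*r + p ≠ 0) :
    ∃ e k : ℤ, e ∣ 3 ∧ a0 + a1 + a2 = e*k^2 := by
  have hn := im_ne hi h.pos h.hs h.hp 1 1 one_ne_zero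
  have hn : a0 + a1 + a2 ≠ 0 := fun hh => hn (by linear_combination hh)
  obtain ⟨x, y, z, hb⟩ := h.bez
  obtain ⟨d, k, hdk, hd⟩ := sqpart (a0 + a1 + a2) 3 hn (fun q hq ho => by
    by_contra h3
    refine (L12 hq (g1 := 9) (g2 := 44) (g3 := 68) (g4 := 41) (g5 := 8) (a2 := a2) (a1 := a1 + 2*a2) ?_ ?_ hn
      (l := l) (b1 := B1) (b0 := B0 + B1) (h3 := H3) (h2 := H2 + 3*H3) (h1 := H1 + 2*H2 + 3*H3) (h0 := H0 + H1 + H2 + H3)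
      h.hl ?_ ?_ ?_ ?_ ?_ ?_) ho
    · intro hh; exact h3 (hq.dvd_of_dvd_pow (n := 2) (by simpa using hh))
    · rintro ⟨t2, t1, t0⟩
      refine hq.not_isUnit (isUnit_of_dvd_one (hb ▸ ?_))
      rw [show x*a2 + y*a1 + z*a0 = (x - 2*y + z)*a2 + (y - z)*(a1 + 2*a2) + z*(a0 + a1 + a2) by ring]
      exact dvd_add (dvd_add (t2.mul_left _) (t1.mul_left _)) (t0.mul_left _)
    · linear_combination h.e0 - h.e1 - h.e2 - h.e3 - h.e4 - h.e5
    · linear_combination h.e1 + 2*h.e2 + 3*h.e3 + 4*h.e4 + 5*h.e5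
    · linear_combination h.e2 + 3*h.e3 + 6*h.e4 + 10*h.e5
    · linear_combination h.e3 + 4*h.e4 + 10*h.e5
    · linear_combination h.e4 + 5*h.e5
    · linear_combination h.e5)
  exact ⟨d, k, hd, hdk⟩

lemma IM.si (h : IM s p a2 a1 a0 l B1 B0 H3 H2 H1 H0) (hi : ∀ r : ℚ, r^2 + s*r + p ≠ 0) :
    ∃ k : ℤ, a2 = k^2 ∨ a2 = 2*k^2 := by
  have hn := im_ne hi h.pos h.hs h.hp 0 1 one_ne_zero
  simp at hn
  obtain ⟨x, y, z, hb⟩ := h.bez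
  obtain ⟨d, k, hdk, hd⟩ := sqpart a2 2 h.pos.ne' (fun q hq ho => by
    by_contra h3
    refine (L12i hq (g1 := 8) (g2 := 1) (g3 := -16) (g4 := 6) (g5 := 1) (a2 := a0) (a1 := a1) ?_ ?_ h.pos.ne' hn
      (l := l) (b3 := B0) (b2 := B1) (h4 := H0) (h3 := H1) (h2 := H2) (h1 := H3)
      h.hl ?_ ?_ ?_ ?_ ?_ ?_) ho
    · intro hh; exact h3 (hq.dvd_of_dvd_pow (n := 3) (by simpa using hh))
    · rintro ⟨t2, t1, t0⟩
      refine hq.not_isUnit (isUnit_of_dvd_one (hb ▸ ?_))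
      exact dvd_add (dvd_add (t0.mul_left _) (t1.mul_left _)) (t2.mul_left _)
    · linear_combination h.e5
    · linear_combination h.e4
    · linear_combination h.e3
    · linear_combination h.e2
    · linear_combination h.e1
    · linear_combination h.e0)
  refine ⟨k, ?_⟩
  have := h.pos
  rcases dvd_prime prime2 hd with rfl | rfl | rfl | rfl
  · left; rw [hdk]; ring
  · nlinarith [sq_nonneg k]
  · right; exact hdk
  · nlinarith [sq_nonneg k]

lemma IM.sm (h : IM s p a2 a1 a0 l B1 B0 H3 H2 H1 H0) (hi : ∀ r : ℚ, r^2 + s*r + p ≠ 0) :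
    ∃ e k : ℤ, e ∣ 426 ∧ a2 - 8*a1 + 64*a0 = e*k^2 := by
  have hn := im_ne hi h.pos h.hs h.hp (-1) 8 (by norm_num)
  have hn : a2 - 8*a1 + 64*a0 ≠ 0 := fun hh => hn (by linear_combination hh)
  obtain ⟨x, y, z, hb⟩ := h.bez
  obtain ⟨d, k, hdk, hd⟩ := sqpart (a2 - 8*a1 + 64*a0) 426 hn (fun q hq ho => by
    by_contra h3
    have q2 : ¬ q ∣ 2 := fun hh => h3 (hh.trans ⟨213, by norm_num⟩)
    have q3 : ¬ q ∣ 3 := fun hh => h3 (hh.trans ⟨142, by norm_num⟩)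
    have q71 : ¬ q ∣ 71 := fun hh => h3 (hh.trans ⟨6, by norm_num⟩)
    refine (L12 hq (g1 := -639) (g2 := 764) (g3 := -122) (g4 := -4) (g5 := 1) (a2 := a2) (a1 := 8*a1 - 2*a2) ?_ ?_ hn
      (l := 8*l) (b1 := 64*B1) (b0 := 512*B0 - 64*B1) (h3 := 8*H3) (h2 := 64*H2 - 24*H3) (h1 := 512*H1 - 128*H2 + 24*H3)
      (h0 := 4096*H0 - 512*H1 + 64*H2 - 8*H3)
      (mul_ne_zero (by norm_num) h.hl) ?_ ?_ ?_ ?_ ?_ ?_) ho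
    · intro hh
      rw [show (-639 : ℤ) = 3^2*(-71) by norm_num] at hh
      rcases hq.dvd_or_dvd hh with h4 | h4
      · exact q3 (hq.dvd_of_dvd_pow h4)
      · exact q71 (by simpa using h4)
    · rintro ⟨t2, t1, t0⟩
      have : q ∣ 2^6 := by
        rw [show (2 : ℤ)^6 = (64*x + 16*y + z)*a2 + (8*y + z)*(8*a1 - 2*a2) + z*(a2 - 8*a1 + 64*a0) by
          linear_combination -64*hb]
        exact dvd_add (dvd_add (t2.mul_left _) (t1.mul_left _)) (t0.mul_left _)
      exact q2 (hq.dvd_of_dvd_pow this)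
    · linear_combination 262144*h.e0 + 32768*h.e1 - 4096*h.e2 + 512*h.e3 - 64*h.e4 + 8*h.e5
    · linear_combination 32768*h.e1 - 2*4096*h.e2 + 3*512*h.e3 - 4*64*h.e4 + 5*8*h.e5
    · linear_combination 4096*h.e2 - 3*512*h.e3 + 6*64*h.e4 - 10*8*h.e5
    · linear_combination 512*h.e3 - 4*64*h.e4 + 10*8*h.e5
    · linear_combination 64*h.e4 - 5*8*h.e5
    · linear_combination 8*h.e5)
  exact ⟨d, k, hd, hdk⟩

lemma IM.sb (h : IM s p a2 a1 a0 l B1 B0 H3 H2 H1 H0) (hi : ∀ r : ℚ, r^2 + s*r + p ≠ 0)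
    (hne : ¬ (s = 1 ∧ p = -1)) :
    ∃ e k : ZB, e ∣ ⟨29, -52⟩ ∧ (⟨a0 + a2, a1 - a2⟩ : ZB) = e*k^2 := by
  have hn : (⟨a0 + a2, a1 - a2⟩ : ZB) ≠ 0 := by
    intro hh
    have h1 := congrArg QuadraticAlgebra.re hh
    have h2 := congrArg QuadraticAlgebra.im hh
    simp only [re_zero, im_zero] at h1 h2
    have ha : (a2 : ℚ) ≠ 0 := by exact_mod_cast h.pos.ne'
    have e1 : (a1 : ℚ) = a2 := by exact_mod_cast (by linarith : a1 = a2)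
    have e0 : (a0 : ℚ) = -a2 := by exact_mod_cast (by linarith : a0 = -a2)
    apply hne
    constructor
    · apply mul_left_cancel₀ ha; rw [h.hs, e1]; ring
    · apply mul_left_cancel₀ ha; rw [h.hp, e0]; ring
  obtain ⟨x, y, z, hb⟩ := h.bez
  obtain ⟨β, hβ⟩ : ∃ β : ZB, β = ⟨0, 1⟩ := ⟨_, rfl⟩
  have hβ2 : β^2 = 1 - β := by
    rw [hβ]; ext <;> simp [pow_two]
  have cast2 : ∀ u v : ℤ, (⟨u, v⟩ : ZB) = (u : ZB) + v*β := by
    intro u v; rw [hβ]; ext <;> simp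
  have hA : (⟨a0 + a2, a1 - a2⟩ : ZB) = (a0 : ZB) + a1*β + a2*β^2 := by
    rw [cast2]; push_cast; linear_combination - (a2 : ZB)*hβ2
  have z0 : (B0 : ZB)^2 = a0*H0 := by exact_mod_cast congrArg (Int.cast : ℤ → ZB) h.e0
  have z1 : (l : ZB)^2 = 2*B0*B1 - (a0*H1 + a1*H0) := by exact_mod_cast congrArg (Int.cast : ℤ → ZB) h.e1
  have z2 : (l : ZB)^2*6 = B1^2 - (a0*H2 + a1*H1 + a2*H0) := by exact_mod_cast congrArg (Int.cast : ℤ → ZB) h.e2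
  have z3 : (l : ZB)^2*(-16) = - (a0*H3 + a1*H2 + a2*H1) := by exact_mod_cast congrArg (Int.cast : ℤ → ZB) h.e3
  have z4 : (l : ZB)^2 = - (a1*H3 + a2*H2) := by exact_mod_cast congrArg (Int.cast : ℤ → ZB) h.e4
  have z5 : (l : ZB)^2*8 = - (a2*H3) := by exact_mod_cast congrArg (Int.cast : ℤ → ZB) h.e5
  have zb : (x : ZB)*a2 + y*a1 + z*a0 = 1 := by exact_mod_cast congrArg (Int.cast : ℤ → ZB) hb
  have zl : (l : ZB) ≠ 0 := by exact_mod_cast h.hl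
  have hP : (⟨29, -52⟩ : ZB) = 40*β^4 + 4*β^3 - 48*β^2 + 12*β + 1 := by
    rw [cast2]; push_cast; linear_combination (-40*β^2 + 36*β - 28)*hβ2
  have hG : 8*β^5 + β^4 - 16*β^3 + 6*β^2 + β = 0 := by
    linear_combination (8*β^3 - 7*β^2 - β)*hβ2
  rw [hP, hA]; rw [hA] at hn
  obtain ⟨d, k, hdk, hd⟩ := sqpart _ (40*β^4 + 4*β^3 - 48*β^2 + 12*β + 1) hn (fun q hq ho => by
    by_contra h3
    refine (L12 hq (g1 := 40*β^4 + 4*β^3 - 48*β^2 + 12*β + 1) (g2 := 80*β^3 + 6*β^2 - 48*β + 6)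
      (g3 := 80*β^2 + 4*β - 16) (g4 := 40*β + 1) (g5 := 8) (a2 := a2) (a1 := a1 + 2*a2*β) h3 ?_ hn
      (l := l) (b1 := B1) (b0 := B0 + B1*β) (h3 := H3) (h2 := H2 + 3*H3*β) (h1 := H1 + 2*H2*β + 3*H3*β^2)
      (h0 := H0 + H1*β + H2*β^2 + H3*β^3)
      zl ?_ ?_ ?_ ?_ ?_ ?_) ho
    · rintro ⟨t2, t1, t0⟩
      refine hq.not_isUnit (isUnit_of_dvd_one (zb ▸ ?_))
      rw [show (x : ZB)*a2 + y*a1 + z*a0 = (x - 2*y*β + z*β^2)*a2 + (y - z*β)*(a1 + 2*a2*β)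
        + z*(a0 + a1*β + a2*β^2) by ring]
      exact dvd_add (dvd_add (t2.mul_left _) (t1.mul_left _)) (t0.mul_left _)
    · linear_combination z0 - β*z1 - β^2*z2 - β^3*z3 - β^4*z4 - β^5*z5 + (l : ZB)^2*hG
    · linear_combination z1 + 2*β*z2 + 3*β^2*z3 + 4*β^3*z4 + 5*β^4*z5
    · linear_combination z2 + 3*β*z3 + 6*β^2*z4 + 10*β^3*z5
    · linear_combination z3 + 4*β*z4 + 10*β^2*z5
    · linear_combination z4 + 5*β*z5
    · linear_combination z5)
  exact ⟨d, k, hd, hdk⟩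
end QP

namespace QP

lemma Sp.hne {s p c d : ℚ} (h : Sp s p c d) : ¬(s = 1 ∧ p = -1) := by
  rintro ⟨rfl, rfl⟩
  have h1 := h.E1
  have h0 := h.E0
  have h2 : d^2 + c^2 = 0 := by linear_combination -h0
  have hc : c = 0 := by nlinarith [sq_nonneg c, sq_nonneg d]
  have hd : d = 0 := by nlinarith [sq_nonneg c, sq_nonneg d]
  rcases h.nz with h | h <;> contradiction

lemma Sp.root {s p c d : ℚ} (h : Sp s p c d) {w : ℝ} (hw : w^2 + s*w + p = 0) :
    0 ≤ w*(w - 1)*(w^2 + w - 1)*(8*w + 1) := by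
  have := h.fac w
  rw [hw, zero_mul] at this
  nlinarith [sq_nonneg ((c : ℝ)*w + d)]

lemma Sp.pos0 {s p c d : ℚ} (h : Sp s p c d) : 0 < p*(1 - 8*s + 64*p) := by
  have hp := h.irr 0
  have hm := h.irr (-1/8)
  have hp' : p ≠ 0 := fun e => hp (by rw [e]; ring)
  have hm' : 1 - 8*s + 64*p ≠ 0 := fun e => hm (by linear_combination e / 64)
  by_contra hcon
  have hlt : p*(1 - 8*s + 64*p) < 0 := lt_of_le_of_ne (not_lt.1 hcon) (mul_ne_zero hp' hm')
  have hltR : (p : ℝ)*(1 - 8*s + 64*p) < 0 := by exact_mod_cast hlt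
  have hcont : ContinuousOn (fun w : ℝ => (p : ℝ)*(w^2 + s*w + p)) (Set.Icc (-1/8) 0) := by fun_prop
  have := intermediate_value_Ioo (by norm_num) hcont
  have h0 : (0 : ℝ) < p^2 := by positivity
  obtain ⟨w, ⟨hw1, hw2⟩, hw⟩ := this (show (0 : ℝ) ∈ _ from ⟨by nlinarith, by nlinarith⟩)
  have hpR : (p : ℝ) ≠ 0 := by exact_mod_cast hp'
  have := h.root ((mul_eq_zero.1 hw).resolve_left hpR)
  have h1 : 0 < w*(w - 1) := by nlinarith
  have h2 : w^2 + w - 1 < 0 := by nlinarith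
  have h3 : 0 < 8*w + 1 := by linarith
  have := mul_pos (mul_pos h1 (neg_pos.2 h2)) h3
  nlinarith

lemma Sp.posb {s p c d : ℚ} (h : Sp s p c d) {b : ℝ} (hb : b^2 = 1 - b) (hb0 : b < 0) :
    0 ≤ b^2 + s*b + p := by
  by_contra hcon
  push Not at hcon
  have hcont : ContinuousOn (fun w : ℝ => w^2 + s*w + p) (Set.Icc (b - |(s : ℝ)| - |(p : ℝ)| - 2 + 2*b) b) := by fun_prop
  have hs := abs_nonneg (s : ℝ)
  have hp := abs_nonneg (p : ℝ)
  have := intermediate_value_Ioo' (by linarith) hcont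
  have hs1 := le_abs_self (s : ℝ)
  have hs2 := neg_abs_le (s : ℝ)
  have hp2 := neg_abs_le (p : ℝ)
  obtain ⟨w, ⟨hw1, hw2⟩, hw⟩ := this (show (0 : ℝ) ∈ _ from ⟨hcon, by nlinarith⟩)
  have := h.root hw
  have hb1 : b ≤ -1 := by nlinarith
  have h1 : 0 < w*(w - 1) := by nlinarith
  have h2 : 0 < w^2 + w - 1 := by nlinarith
  have h3 : 0 < -(8*w + 1) := by linarith
  have := mul_pos (mul_pos h1 h2) h3
  nlinarith

instance : Fact (Nat.Prime 2) := ⟨Nat.prime_two⟩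

lemma hq (A B C : ℤ_[2]) (hB : IsUnit B) (hC : 2 ∣ C) : ∃ u : ℤ_[2], 2 ∣ u ∧ A*u^2 + B*u + C = 0 := by
  have hB' := PadicInt.isUnit_iff.1 hB
  have hC' : ‖C‖ < 1 := (PadicInt.norm_lt_one_iff_dvd C).2 (by exact_mod_cast hC)
  have := hensels_lemma (p := 2) (R := ℤ_[2]) (F := (Polynomial.C A*Polynomial.X^2 + Polynomial.C B*Polynomial.X + Polynomial.C C)) (a := 0) (by
    simp [hB', hC'])
  obtain ⟨u, hu, hu2, -⟩ := this
  simp [hB'] at hu hu2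
  exact ⟨u, by exact_mod_cast (PadicInt.norm_lt_one_iff_dvd u).1 hu2, hu⟩

lemma sq2 (t : ℤ_[2]) : ∃ r : ℤ_[2], r^2 = 1 + 8*t := by
  obtain ⟨u, -, hu⟩ := hq 1 1 (-2*t) isUnit_one ⟨-t, by ring⟩
  exact ⟨1 + 2*u, by linear_combination 4*hu⟩

lemma odd_unit {n : ℤ} (h : n % 2 = 1) : IsUnit (n : ℤ_[2]) := by
  rw [PadicInt.isUnit_iff]
  by_contra hc
  have : ‖(n : ℤ_[2])‖ < 1 := lt_of_le_of_ne (PadicInt.norm_le_one _) hc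
  rw [PadicInt.norm_int_lt_one_iff_dvd] at this
  omega

lemma sq_odd8 {σ : ℤ} (h : σ % 2 = 1) {r : ℚ_[2]} (hr : r^2 = σ) : σ % 8 = 1 := by
  have hn : ‖r‖ ≤ 1 := by
    have h1 : ‖r‖ ^ 2 ≤ 1 := by
      rw [← norm_pow, hr]; exact Padic.norm_int_le_one σ
    have := norm_nonneg r
    nlinarith
  obtain ⟨z, rfl⟩ : ∃ z : ℤ_[2], (z : ℚ_[2]) = r := ⟨⟨r, hn⟩, rfl⟩
  have hz : z^2 = (σ : ℤ_[2]) := by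
    apply Subtype.ext; push_cast; exact hr
  have := congrArg (PadicInt.toZModPow (p := 2) 3) hz
  rw [map_pow, map_intCast] at this
  generalize (PadicInt.toZModPow (p := 2) 3) _ = q at this
  have h8 : σ = ((σ % 8 : ℤ)) + 8*(σ / 8) := by omega
  have h80 : (8 : ZMod (2^3)) = 0 := by decide
  rw [h8] at this
  push_cast at this
  rw [h80, zero_mul, add_zero] at this
  have h9 : σ % 8 = 1 ∨ σ % 8 = 3 ∨ σ % 8 = 5 ∨ σ % 8 = 7 := by omega
  revert this
  rcases h9 with h9 | h9 | h9 | h9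
  · intro _; exact h9
  all_goals rw [h9]; revert q; decide

lemma Sp.two {s p c d : ℚ} (h : Sp s p c d) {a2 a1 a0 : ℤ} (h2 : 0 < a2) (h1 : (a2 : ℚ)*s = a1)
    (h0 : (a2 : ℚ)*p = a0) (he : a2 % 2 = 0) (ho : a1 % 2 = 1) :
    ∃ r : ℚ_[2], r^2 = ((1 - 8*s + 64*p : ℚ) : ℚ_[2]) := by
  obtain ⟨i, hi2, hi⟩ := hq (a0 : ℤ_[2]) a1 a2 (odd_unit ho) (by
    obtain ⟨k, hk⟩ : ∃ k, a2 = 2*k := ⟨a2 / 2, by omega⟩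
    exact ⟨k, by rw [hk]; push_cast; ring⟩)
  have hu : IsUnit ((a1 : ℤ_[2]) + a0*i) := by
    rw [PadicInt.isUnit_iff]
    by_contra hc
    have h3 : ‖((a1 : ℤ_[2]) + a0*i)‖ < 1 := lt_of_le_of_ne (PadicInt.norm_le_one _) hc
    rw [PadicInt.norm_lt_one_iff_dvd] at h3
    have h4 : ((2 : ℕ) : ℤ_[2]) ∣ (a1 : ℤ_[2]) := by
      have : (a1 : ℤ_[2]) = (a1 + a0*i) - a0*i := by ring
      rw [this]
      exact dvd_sub h3 (Dvd.dvd.mul_left (by exact_mod_cast hi2) _)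
    have h5 : ‖(a1 : ℤ_[2])‖ < 1 := by rw [PadicInt.norm_lt_one_iff_dvd]; exact h4
    rw [PadicInt.norm_int_lt_one_iff_dvd] at h5
    omega
  obtain ⟨v, hv⟩ := hu.exists_right_inv
  obtain ⟨j, hj⟩ := hi2
  obtain ⟨r1, hr1⟩ := sq2 (-a0*v)
  obtain ⟨r2, hr2⟩ := sq2 (-j^2 + j^3)
  have hi0 : (i : ℚ_[2]) ≠ 0 := by
    intro h0
    have : i = 0 := Subtype.ext h0
    rw [this] at hi
    have : (a2 : ℤ_[2]) = 0 := by linear_combination hi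
    exact h2.ne' (by exact_mod_cast this)
  have ha : (a2 : ℚ_[2]) ≠ 0 := by exact_mod_cast h2.ne'
  have h1' : (a2 : ℚ_[2])*s = a1 := by exact_mod_cast congrArg (fun x : ℚ => (x : ℚ_[2])) h1
  have h0' : (a2 : ℚ_[2])*p = a0 := by exact_mod_cast congrArg (fun x : ℚ => (x : ℚ_[2])) h0
  have hi' : (a0 : ℚ_[2])*i^2 + a1*i + a2 = 0 := by exact_mod_cast congrArg (fun x : ℤ_[2] => (x : ℚ_[2])) hi
  have hv' : ((a1 : ℚ_[2]) + a0*i)*v = 1 := by exact_mod_cast congrArg (fun x : ℤ_[2] => (x : ℚ_[2])) hv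
  have hr1' : (r1 : ℚ_[2])^2 = 1 + 8*(-a0*v) := by exact_mod_cast congrArg (fun x : ℤ_[2] => (x : ℚ_[2])) hr1
  have hr2' : (r2 : ℚ_[2])^2 = 1 - 2*i^2 + i^3 := by
    have : r2^2 = 1 - 2*i^2 + i^3 := by rw [hr2, hj]; ring
    exact_mod_cast congrArg (fun x : ℤ_[2] => (x : ℚ_[2])) this
  have hroot : ((i : ℚ_[2])⁻¹)^2 + s*(i : ℚ_[2])⁻¹ + p = 0 := by
    field_simp
    apply mul_left_cancel₀ ha
    linear_combination hi' + (i : ℚ_[2])*h1' + (i : ℚ_[2])^2*h0'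
  have hf := h.fac (i : ℚ_[2])⁻¹
  rw [hroot, zero_mul] at hf
  have hr20 : (r2 : ℚ_[2]) ≠ 0 := by
    intro h0
    have : r2 = 0 := Subtype.ext h0
    rw [this] at hr2
    have h8 : (2 : ℤ_[2]) ∣ 1 := ⟨-4*(-j^2 + j^3), by linear_combination -hr2⟩
    have := (PadicInt.norm_lt_one_iff_dvd (1 : ℤ_[2])).2 (by exact_mod_cast h8)
    simp at this
  -- (8w+1) = ((c w + d) i^2 / r2)^2
  have h8 : 8*(i : ℚ_[2])⁻¹ + 1 = ((c*(i : ℚ_[2])⁻¹ + d)*i^2 / r2)^2 := by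
    field_simp
    field_simp at hf
    rw [hr2']
    linear_combination hf
  refine ⟨r1*((c*(i : ℚ_[2])⁻¹ + d)*i^2 / r2), ?_⟩
  rw [mul_pow, ← h8, hr1']
  push_cast
  apply mul_left_cancel₀ ha
  have h9 : (a2 : ℚ_[2])*(i : ℚ_[2])⁻¹ = - (a1 + a0*i) := by
    field_simp; linear_combination hi'
  have h10 : (a0 : ℚ_[2])*v*a2 = - a0*i := by
    linear_combination (a0 : ℚ_[2])*v*hi' - (a0 : ℚ_[2])*i*hv'
  have h11 : (a0 : ℚ_[2])*v*a2*(i : ℚ_[2])⁻¹ = -a0 := by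
    rw [h10]; field_simp
  linear_combination 8*h9 - 8*h10 - 64*h11 + 8*h1' - 64*h0'

end QP

namespace QP
open QuadraticAlgebra

def nb (s p : ℚ) : ℚ := (1 + p)^2 - (1 + p)*(s - 1) - (s - 1)^2

lemma Sp.nrm {s p c d : ℚ} (h : Sp s p c d) :
    p*(1 + s + p)*(1 - 8*s + 64*p)*nb s p = (d^2 - s*c*d + p*c^2)^2 := by
  obtain ⟨g1, hg1⟩ : ∃ g, g = 8*(s^4 - 3*s^2*p + p^2) + (-s^3 + 2*s*p) - 16*(s^2 - p) - 6*s + 1 := ⟨_, rfl⟩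
  obtain ⟨g0, hg0⟩ : ∃ g, g = 8*(s^3*p - 2*s*p^2) + (-s^2*p + p^2) - 16*s*p - 6*p := ⟨_, rfl⟩
  have h1 := h.E1
  have h0 := h.E0
  rw [← hg1] at h1
  rw [← hg0] at h0
  have : p*(1 + s + p)*(1 - 8*s + 64*p)*nb s p = g0^2 - s*g0*g1 + p*g1^2 := by
    rw [hg0, hg1, nb]; ring
  rw [this, h1, h0]; ring

lemma s8 {n : ℤ} (h : n % 8 = 1) : ∃ r : ℚ_[2], r^2 = n := by
  obtain ⟨r, hr⟩ := sq2 ((n / 8 : ℤ) : ℤ_[2])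
  refine ⟨r, ?_⟩
  have h8 : n = 1 + 8*(n / 8) := by omega
  have : r^2 = ((1 + 8*(n / 8) : ℤ) : ℤ_[2]) := by rw [hr]; push_cast; ring
  rw [← h8] at this
  exact_mod_cast congrArg (fun x : ℤ_[2] => (x : ℚ_[2])) this

lemma W8 {a0 y a2 : ℤ} (h0 : a0 % 8 = 1 ∨ a0 % 8 = 7) (h2 : a2 % 4 = 0) (hy : y % 2 = 0) :
    (a0*(a0 + (y + a2) + a2)*((a0 + a2)^2 - (a0 + a2)*y - y^2)) % 8 = 1 := by
  have e2 : a2 % 8 = 0 ∨ a2 % 8 = 4 := by omega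
  have ey : y % 8 = 0 ∨ y % 8 = 2 ∨ y % 8 = 4 ∨ y % 8 = 6 := by omega
  rcases h0 with h0 | h0 <;> rcases e2 with e2 | e2 <;> rcases ey with ey | ey | ey | ey <;>
    simp [Int.mul_emod, Int.add_emod, Int.sub_emod, pow_two, h0, e2, ey]

variable {s p : ℚ} {a2 a1 a0 l B1 B0 H3 H2 H1 H0 : ℤ}

lemma Sp.two' {c d : ℚ} (h : Sp s p c d) (hI : IM s p a2 a1 a0 l B1 B0 H3 H2 H1 H0) :
    ∃ r : ℚ_[2], r^2 = ((1 - 8*s + 64*p : ℚ) : ℚ_[2]) := by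
  have ha : (a2 : ℚ_[2]) ≠ 0 := by exact_mod_cast hI.pos.ne'
  have h1' : (a2 : ℚ_[2])*s = a1 := by exact_mod_cast congrArg (fun x : ℚ => (x : ℚ_[2])) hI.hs
  have h0' : (a2 : ℚ_[2])*p = a0 := by exact_mod_cast congrArg (fun x : ℚ => (x : ℚ_[2])) hI.hp
  push_cast
  by_cases ho2 : a2 % 2 = 1
  · obtain ⟨r, hr⟩ := s8 (n := a2*(a2 - 8*a1 + 64*a0)) (by
      have := odd_sq8 ho2
      have e : a2*(a2 - 8*a1 + 64*a0) = a2^2 + 8*(a2*(-a1 + 8*a0)) := by ring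
      omega)
    refine ⟨r / a2, ?_⟩
    rw [div_pow, hr]; field_simp; push_cast
    linear_combination -8*h1'*(a2 : ℚ_[2])*(-1) + 64*h0'*(-a2 : ℚ_[2])
  by_cases ho1 : a1 % 2 = 1
  · have := h.two hI.pos hI.hs hI.hp (by omega) ho1
    push_cast at this; exact this
  obtain ⟨α, rfl⟩ : ∃ k, a2 = 2*k := ⟨a2 / 2, by omega⟩
  by_cases hα : α % 2 = 1
  · obtain ⟨r, hr⟩ := s8 (n := α*(α - 8*a1 / 2 + 32*a0)) (by
      have := odd_sq8 hα
      have e : 8*a1 / 2 = 8*(a1 / 2) := by omega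
      have e : α*(α - 8*a1 / 2 + 32*a0) = α^2 + 8*(α*(-(a1 / 2) + 4*a0)) := by rw [e]; ring
      omega)
    have e : 8*a1 / 2 = 4*a1 := by omega
    rw [e] at hr
    push_cast at ha h1' h0' hr
    have ha' : (α : ℚ_[2]) ≠ 0 := fun h => ha (by rw [h]; ring)
    refine ⟨r / α, ?_⟩
    rw [div_pow, hr]; field_simp
    linear_combination 4*h1' - 32*h0'
  obtain ⟨x, y, z, hb⟩ := hI.bez
  have ha0 : a0 % 2 = 1 := by
    by_contra hh
    have e1 : x*(2*α) + y*a1 + z*a0 = 2*(x*α + y*(a1 / 2) + z*(a0 / 2)) := by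
      have : a1 = 2*(a1 / 2) := by omega
      have : a0 = 2*(a0 / 2) := by omega
      linear_combination y * ‹a1 = _› + z * ‹a0 = _›
    omega
  obtain ⟨k, hk⟩ := hI.s0 h.irr
  have hk2 : k % 2 = 1 := by
    by_contra hh
    have : k^2 = 2*(k^2 / 2) := by
      obtain ⟨j, rfl⟩ : ∃ j, k = 2*j := ⟨k / 2, by omega⟩
      have : (2*j)^2 = 2*(2*j^2) := by ring
      omega
    omega
  have hk8 := odd_sq8 hk2
  obtain ⟨r, hr⟩ := s8 (W8 (a0 := a0) (y := a1 - 2*α) (a2 := 2*α) (by omega) (by omega) (by omega))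
  have hr0 : r ≠ 0 := by
    rintro rfl
    have hW := W8 (a0 := a0) (y := a1 - 2*α) (a2 := 2*α) (by omega) (by omega) (by omega)
    have : a0*(a0 + (a1 - 2*α + 2*α) + 2*α)*((a0 + 2*α)^2 - (a0 + 2*α)*(a1 - 2*α) - (a1 - 2*α)^2) = 0 := by
      have h3 := hr.symm
      rw [zero_pow two_ne_zero] at h3
      exact_mod_cast h3
    rw [this] at hW; norm_num at hW
  have hN := congrArg (fun x : ℚ => (x : ℚ_[2])) h.nrm
  simp only [nb] at hN
  push_cast at hN hr ha h1' h0'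
  refine ⟨(d^2 - s*c*d + p*c^2)*(2*α)^2 / r, ?_⟩
  rw [div_pow, mul_pow, ← hN, hr, ← h1', ← h0']
  rw [← h1', ← h0'] at hr
  have hr' : r^2 = (2*(α : ℚ_[2]))^4*(p*(1 + s + p)*((1 + p)^2 - (1 + p)*(s - 1) - (s - 1)^2)) := by
    rw [hr]; ring
  have : (2*(α : ℚ_[2]))^4*(p*(1 + s + p)*((1 + p)^2 - (1 + p)*(s - 1) - (s - 1)^2)) ≠ 0 := by
    rw [← hr']; positivity
  rw [← hr, hr', div_eq_iff this]
  ring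

lemma divs {n : ℕ} {e : ℤ} (h : e ∣ n) (hn : n ≠ 0) : ∃ m ∈ n.divisors, e = m ∨ e = -m :=
  ⟨e.natAbs, Nat.mem_divisors.2 ⟨by exact_mod_cast Int.natAbs_dvd_natAbs.2 h, hn⟩, by omega⟩

lemma sq_of {E : ℤ} {k y : ℚ} (hk : k ≠ 0) (h : E*k^2 = y^2) : ∃ z : ℤ, E = z^2 :=
  int_sq (r := y / k) (by rw [div_pow, ← h]; field_simp)

end QP

namespace QP
open QuadraticAlgebra

lemma sqm4 (y : ℤ) : y^2 % 4 = 0 ∨ y^2 % 4 = 1 := by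
  rcases Int.even_or_odd' y with ⟨k, rfl | rfl⟩
  · left; have : (2*k)^2 = 4*k^2 := by ring
    omega
  · right; have : (2*k + 1)^2 = 4*(k^2 + k) + 1 := by ring
    omega

lemma no2 {O e y : ℤ} (hO : O % 2 = 1) (he : e % 4 = 2) (h : O*e = y^2) : False := by
  obtain ⟨j, rfl⟩ : ∃ j, O = 2*j + 1 := ⟨O / 2, by omega⟩
  obtain ⟨i, rfl⟩ : ∃ j, e = 4*j + 2 := ⟨e / 4, by omega⟩
  have : (2*j + 1)*(4*i + 2) = 4*(2*j*i + j + i) + 2 := by ring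
  have := sqm4 y
  omega

lemma no3 {O e y : ℤ} (hO : ¬ (3 ∣ O)) (he : e = 3 ∨ e = -3) (h : O*e = y^2) : False := by
  have h3 : Prime (3 : ℤ) := prime3
  have hy : (3 : ℤ) ∣ y := h3.dvd_of_dvd_pow (n := 2) (by rw [← h]; exact Dvd.dvd.mul_left (by omega) _)
  obtain ⟨j, rfl⟩ := hy
  apply hO
  rcases he with rfl | rfl
  · exact ⟨j^2, by linarith [h]⟩
  · exact ⟨-j^2, by linarith [h]⟩

lemma nd3 {ε n σ : ℤ} (hε : ε = 1 ∨ ε = -1)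
    (hn : n = 1 ∨ n = -1 ∨ n = 5 ∨ n = -5 ∨ n = 71 ∨ n = -71 ∨ n = 355 ∨ n = -355) (hσ : σ = 1 ∨ σ = -71) :
    ¬ (3 ∣ ε*n*σ) := by
  intro h3
  rcases prime3.dvd_or_dvd h3 with h3 | h3
  · rcases prime3.dvd_or_dvd h3 with h3 | h3
    · clear * - hε h3; omega
    · clear * - hn h3; omega
  · clear * - hσ h3; omega

/-- class information of a point -/
structure Cls (s p τ : ℚ) : Prop where
  ht : τ = 1 ∨ τ = 2
  c0 : ∃ k : ℚ, p = τ*k^2 ∨ p = -τ*k^2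
  c1 : ∃ k : ℚ, 1 + s + p = τ*k^2 ∨ 1 + s + p = -τ*k^2
  cm : ∃ k : ℚ, 1 - 8*s + 64*p = k^2 ∨ 1 - 8*s + 64*p = -71*k^2
  cb : ∃ (x y : ℤ) (q : ℚ) (n e k : ZB), q ≠ 0 ∧ e*n = ⟨29, -52⟩ ∧ (⟨x, y⟩ : ZB) = e*k^2 ∧
    τ*q^2*(1 + p) = x ∧ τ*q^2*(s - 1) = y

lemma odd_mul {a b : ℤ} (ha : a % 2 = 1) (hb : b % 2 = 1) : (a*b) % 2 = 1 := by
  rw [Int.mul_emod, ha, hb]; rfl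

lemma div355 {n m : ℤ} (h : n*m = -355) : n = 1 ∨ n = -1 ∨ n = 5 ∨ n = -5 ∨ n = 71 ∨ n = -71 ∨ n = 355 ∨ n = -355 := by
  obtain ⟨q, hq, h⟩ := divs (n := 355) (e := n) ⟨-m, by push_cast; linarith⟩ (by norm_num)
  have : q ∈ ({1, 5, 71, 355} : Finset ℕ) := by
    have e : Nat.divisors 355 = {1, 5, 71, 355} := by decide +kernel
    rwa [e] at hq
  simp at this
  omega

set_option maxHeartbeats 1000000 in
lemma Sp.cls {s p c d : ℚ} (h : Sp s p c d) : ∃ τ, Cls s p τ := by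
  obtain ⟨a2, a1, a0, l, B1, B0, H3, H2, H1, H0, hI⟩ := h.im
  obtain ⟨k0, hk0⟩ := hI.s0 h.irr
  obtain ⟨e1, k1, he1, hk1⟩ := hI.s1 h.irr
  obtain ⟨k, hk⟩ := hI.si h.irr
  obtain ⟨em, km, hem, hkm⟩ := hI.sm h.irr
  obtain ⟨eb, kb, ⟨nb', heb⟩, hkb⟩ := hI.sb h.irr h.hne
  obtain ⟨T, hT, hk⟩ : ∃ T : ℤ, (T = 1 ∨ T = 2) ∧ a2 = T*k^2 := by
    rcases hk with hk | hk
    · exact ⟨1, by simp, by linarith⟩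
    · exact ⟨2, by simp, by linarith⟩
  obtain ⟨ε, hε, hk0⟩ : ∃ T : ℤ, (T = 1 ∨ T = -1) ∧ a0 = T*k0^2 := by
    rcases hk0 with hk | hk
    · exact ⟨1, by simp, by linarith⟩
    · exact ⟨-1, by simp, by linarith⟩
  have ha : (a2 : ℚ) ≠ 0 := by exact_mod_cast hI.pos.ne'
  have hkz : (k : ℚ) ≠ 0 := by
    intro h0; apply ha; rw [hk]; push_cast; rw [h0]; ring
  have hTz : (T : ℚ) ≠ 0 := by intro h0; apply ha; rw [hk]; push_cast; rw [h0]; ring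
  have q2 : (a2 : ℚ) = T*k^2 := by rw [hk]; push_cast; ring
  have hp0 : p ≠ 0 := fun e => h.irr 0 (by rw [e]; ring)
  have h10 : 1 + s + p ≠ 0 := fun e => h.irr 1 (by linear_combination e)
  have hm0 : 1 - 8*s + 64*p ≠ 0 := fun e => h.irr (-1/8) (by linear_combination e / 64)
  have hp : p = ε*T*(k0 / (T*k))^2 := by
    have := hI.hp
    rw [hk0, q2] at this
    push_cast at this
    field_simp; linear_combination this
  have hA1 : 1 + s + p = e1*T*(k1 / (T*k))^2 := by
    have e : (a2 : ℚ)*(1 + s + p) = e1*k1^2 := by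
      have : ((a0 + a1 + a2 : ℤ) : ℚ) = e1*k1^2 := by rw [hk1]; push_cast; ring
      rw [← this]; push_cast; rw [← hI.hs, ← hI.hp]; ring
    rw [q2] at e
    field_simp; linear_combination e
  have hAm : 1 - 8*s + 64*p = em*T*(km / (T*k))^2 := by
    have e : (a2 : ℚ)*(1 - 8*s + 64*p) = em*km^2 := by
      have : ((a2 - 8*a1 + 64*a0 : ℤ) : ℚ) = em*km^2 := by rw [hkm]; push_cast; ring
      rw [← this]; push_cast; rw [← hI.hs, ← hI.hp]; ring
    rw [q2] at e
    field_simp; linear_combination e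
  have hnb : nb s p = nm eb*(nm kb / a2)^2 := by
    have e := congrArg nm hkb
    rw [nm_mul, pow_two, nm_mul] at e
    have e' : (a2 : ℚ)^2*nb s p = nm eb*(nm kb*nm kb) := by
      have : ((nm (⟨a0 + a2, a1 - a2⟩ : ZB) : ℤ) : ℚ) = nm eb*(nm kb*nm kb) := by rw [e]; push_cast; ring
      rw [← this]; simp only [nm, nb]; push_cast; rw [← hI.hs, ← hI.hp]; ring
    field_simp; linear_combination e'
  have hn355 : nm eb*nm nb' = -355 := by
    rw [← nm_mul, ← heb]; rfl
  have hn := div355 hn355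
  have hnbz : nb s p ≠ 0 := by
    intro h0
    rw [h0] at hnb
    have hx : (⟨a0 + a2, a1 - a2⟩ : ZB) ≠ 0 := by
      intro hx
      have e1 := congrArg QuadraticAlgebra.re hx
      have e2 := congrArg QuadraticAlgebra.im hx
      simp at e1 e2
      apply h.hne
      have e1' : (a0 : ℚ) + a2 = 0 := by exact_mod_cast e1
      have e2' : (a1 : ℚ) - a2 = 0 := by exact_mod_cast e2
      constructor
      · apply mul_left_cancel₀ ha; linear_combination hI.hs + e2'
      · apply mul_left_cancel₀ ha; linear_combination hI.hp + e1'
    have hkk : (nm kb : ℚ) ≠ 0 := by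
      have : kb ≠ 0 := by rintro rfl; apply hx; rw [hkb]; simp
      exact_mod_cast nm_ne this
    have hen : (nm eb : ℚ) ≠ 0 := by
      have : nm eb ≠ 0 := by omega
      exact_mod_cast this
    have : (nm eb : ℚ)*(nm kb / a2)^2 ≠ 0 := by positivity
    exact this hnb.symm
  have hN := h.nrm
  obtain ⟨y, hy⟩ : ∃ y : ℤ, (ε*e1*nm eb)*(em*T) = y^2 := by
    refine sq_of (k := (k0 / (T*k))*T*(k1 / (T*k))*(km / (T*k))*(nm kb / a2)) (y := d^2 - s*c*d + p*c^2) ?_ ?_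
    · intro h0
      have : p*(1 + s + p)*(1 - 8*s + 64*p)*nb s p ≠ 0 := by positivity
      apply this
      rw [hA1, hAm, hnb, hp]
      linear_combination (ε*e1*nm eb : ℚ)*(em*T)*((k0 / (T*k))*T*(k1 / (T*k))*(km / (T*k))*(nm kb / a2))*h0
    · rw [← hN, hA1, hAm, hnb]
      push_cast
      linear_combination -(e1*nm eb : ℚ)*(em*T)*T*((k1 / (T*k))*(km / (T*k))*(nm kb / a2))^2*hp
  have he1' : e1 = 1 ∨ e1 = -1 ∨ e1 = 3 ∨ e1 = -3 := dvd_prime prime3 he1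
  have hO : (ε*e1*nm eb) % 2 = 1 := odd_mul (odd_mul (by omega) (by omega)) (by omega)
  have hem' : em = 1 ∨ em = -1 ∨ em = 2 ∨ em = -2 ∨ em = 3 ∨ em = -3 ∨ em = 6 ∨ em = -6 ∨ em = 71 ∨ em = -71 ∨ em = 142 ∨ em = -142 ∨
      em = 213 ∨ em = -213 ∨ em = 426 ∨ em = -426 := by
    obtain ⟨q, hq, h⟩ := divs (n := 426) (e := em) (by exact_mod_cast hem) (by norm_num)
    have : q ∈ ({1, 2, 3, 6, 71, 142, 213, 426} : Finset ℕ) := by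
      have e : Nat.divisors 426 = {1, 2, 3, 6, 71, 142, 213, 426} := by decide +kernel
      rwa [e] at hq
    simp at this
    omega
  -- the odd class σ
  obtain ⟨σ, j, hj, hσ1, hσ2, hσ⟩ : ∃ σ j : ℤ, j ≠ 0 ∧ em*T = σ*j^2 ∧ σ % 2 = 1 ∧
      (σ = 1 ∨ σ = -1 ∨ σ = 3 ∨ σ = -3 ∨ σ = 71 ∨ σ = -71 ∨ σ = 213 ∨ σ = -213) := by
    rcases hT with rfl | rfl
    · have : ¬ (em % 4 = 2) := fun h4 => no2 hO (e := em*1) (by omega) hy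
      exact ⟨em, 1, one_ne_zero, by ring, by omega, by omega⟩
    · have : ¬ (em % 2 = 1) := fun h4 => no2 hO (e := em*2) (by omega) hy
      exact ⟨em / 2, 2, two_ne_zero, by omega, by omega, by omega⟩
  have hAm' : 1 - 8*s + 64*p = σ*(j*km / (T*k))^2 := by
    rw [hAm]
    have : (em : ℚ)*T = σ*j^2 := by exact_mod_cast hσ1
    rw [this]; ring
  have h8 : σ % 8 = 1 := by
    obtain ⟨r, hr⟩ := h.two' hI
    rw [hAm'] at hr
    push_cast at hr
    have hz : (j*km / (T*k) : ℚ_[2]) ≠ 0 := by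
      have : (j*km / (T*k) : ℚ) ≠ 0 := by
        intro h0; rw [h0] at hAm'; exact hm0 (by rw [hAm']; ring)
      exact_mod_cast this
    exact sq_odd8 hσ2 (r := r / (j*km / (T*k))) (by rw [div_pow, hr, mul_div_assoc, div_self (pow_ne_zero 2 hz), mul_one])
  have hσ' : σ = 1 ∨ σ = -71 := by omega
  have he1'' : e1 = 1 ∨ e1 = -1 := by
    by_contra hcon
    rw [hσ1] at hy
    have hy2 : (ε*nm eb*σ*j^2)*e1 = y^2 := by rw [← hy]; ring
    have hy3 : ∃ z : ℤ, (ε*nm eb*σ)*e1 = z^2 :=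
      sq_of (k := j) (y := y) (by exact_mod_cast hj) (by exact_mod_cast (by rw [← hy]; ring : (ε*nm eb*σ)*e1*j^2 = y^2))
    obtain ⟨z, hz⟩ := hy3
    exact no3 (nd3 hε hn hσ') (by clear * - he1' hcon; omega) hz
  refine ⟨T, ⟨?_, ⟨k0 / (T*k), ?_⟩, ⟨k1 / (T*k), ?_⟩, ⟨j*km / (T*k), ?_⟩, ?_⟩⟩
  · rcases hT with rfl | rfl <;> simp
  · rcases hε with rfl | rfl
    · left; rw [hp]; push_cast; ring
    · right; rw [hp]; push_cast; ring
  · rcases he1'' with rfl | rfl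
    · left; rw [hA1]; push_cast; ring
    · right; rw [hA1]; push_cast; ring
  · rcases hσ' with rfl | rfl
    · left; rw [hAm']; push_cast; ring
    · right; rw [hAm']; push_cast; ring
  · refine ⟨a0 + a2, a1 - a2, k, nb', eb, kb, hkz, heb.symm, hkb, ?_, ?_⟩
    · rw [← q2]; push_cast; rw [← hI.hp]; ring
    · rw [← q2]; push_cast; rw [← hI.hs]; ring

/-- all the rational classes trivial -/
structure SS (s p : ℚ) : Prop where
  c0 : ∃ k : ℚ, p = k^2
  c1 : ∃ k : ℚ, 1 + s + p = k^2
  cm : ∃ k : ℚ, 1 - 8*s + 64*p = k^2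

lemma nsq2 (x y : ℚ) (hx : x ≠ 0) (h : x^2 = 2*y^2) : False := by
  have hy : y ≠ 0 := by rintro rfl; apply hx; nlinarith
  obtain ⟨z, hz⟩ := sq_of (E := 2) (k := y) (y := x) hy (by push_cast; linarith)
  have := sqm4 z
  omega

lemma SS.cb {s p c d : ℚ} (h : Sp s p c d) (hS : SS s p) :
    ∃ g0 g1 : ℚ, 1 + p = g0^2 + g1^2 ∧ s - 1 = 2*g0*g1 - g1^2 := by
  obtain ⟨τ, hC⟩ := h.cls
  obtain ⟨k0, h0⟩ := hS.c0
  obtain ⟨k1, h1⟩ := hS.c1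
  obtain ⟨km, hm⟩ := hS.cm
  have hp0 : p ≠ 0 := fun e => h.irr 0 (by rw [e]; ring)
  have h10 : 1 + s + p ≠ 0 := fun e => h.irr 1 (by linear_combination e)
  have hm0 : 1 - 8*s + 64*p ≠ 0 := fun e => h.irr (-1/8) (by linear_combination e / 64)
  have hk0 : k0 ≠ 0 := by rintro rfl; apply hp0; rw [h0]; ring
  have hk1 : k1 ≠ 0 := by rintro rfl; apply h10; rw [h1]; ring
  have hkm : km ≠ 0 := by rintro rfl; apply hm0; rw [hm]; ring
  have hτ : τ = 1 := by
    rcases hC.ht with ht | ht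
    · exact ht
    · exfalso
      obtain ⟨k, hk⟩ := hC.c0
      rw [ht, h0] at hk
      rcases hk with hk | hk
      · exact nsq2 k0 k hk0 hk
      · have : 0 < k0^2 := by positivity
        nlinarith [sq_nonneg k]
  obtain ⟨x, y, q, n, e, k, hq, hen, hxy, hx, hy⟩ := hC.cb
  rw [hτ, one_mul] at hx hy
  have e1 := congrArg QuadraticAlgebra.re hxy
  have e2 := congrArg QuadraticAlgebra.im hxy
  have hn := congrArg nm hen
  rw [nm_mul] at hn
  have hn355 := div355 (hn.trans rfl)
  have hnm := congrArg nm hxy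
  rw [nm_mul, pow_two, nm_mul] at hnm
  have hnq : q^4*nb s p = nm e*nm k^2 := by
    have : ((nm (⟨x, y⟩ : ZB) : ℤ) : ℚ) = nm e*(nm k*nm k) := by rw [hnm]; push_cast; ring
    rw [pow_two (nm k : ℚ), ← this]; simp only [nm, nb]; push_cast; rw [← hx, ← hy]; ring
  have hN := h.nrm
  rw [hm, h1] at hN
  nth_rw 1 [h0] at hN
  have hk : k ≠ 0 := by
    rintro rfl
    simp at hxy
    have e1 := congrArg QuadraticAlgebra.re hxy
    have e2 := congrArg QuadraticAlgebra.im hxy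
    simp at e1 e2
    rw [e1] at hx; rw [e2] at hy
    apply h.hne
    have hq2 : q^2 ≠ 0 := by positivity
    constructor
    · apply mul_left_cancel₀ hq2; push_cast at hy; linear_combination hy
    · apply mul_left_cancel₀ hq2; push_cast at hx; linear_combination hx
  have hkn : (nm k : ℚ) ≠ 0 := by exact_mod_cast nm_ne hk
  obtain ⟨z, hz⟩ := sq_of (E := nm e) (k := nm k*k0*k1*km) (y := q^2*(d^2 - s*c*d + p*c^2)) (by positivity) (by
    linear_combination q^4*hN - (k0*k1*km)^2*hnq)
  have hn1 : nm e = 1 := by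
    have hz8 := sqm4 z
    rw [← hz] at hz8
    rcases hn355 with h | h | h | h | h | h | h | h
    · exact h
    · omega
    · rw [h] at hz
      have h1 : z < 3 := by nlinarith
      have h2 : -3 < z := by nlinarith
      interval_cases z <;> omega
    · nlinarith [sq_nonneg z]
    · omega
    · nlinarith [sq_nonneg z]
    · omega
    · nlinarith [sq_nonneg z]
  obtain ⟨v, hv⟩ := unit_sq hn1
  rcases hv with hv | hv
  · refine ⟨(v*k).re / q, (v*k).im / q, ?_, ?_⟩
    · have : x = (v*k).re^2 + (v*k).im^2 := by
        have : (⟨x, y⟩ : ZB) = (v*k)^2 := by rw [hxy, hv]; ring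
        have := congrArg QuadraticAlgebra.re this
        rw [pow_two, re_mul] at this
        linear_combination this
      have : (x : ℚ) = (v*k).re^2 + (v*k).im^2 := by exact_mod_cast this
      field_simp; linear_combination hx + this
    · have : y = 2*(v*k).re*(v*k).im - (v*k).im^2 := by
        have : (⟨x, y⟩ : ZB) = (v*k)^2 := by rw [hxy, hv]; ring
        have := congrArg QuadraticAlgebra.im this
        rw [pow_two, im_mul] at this
        linear_combination this
      have : (y : ℚ) = 2*(v*k).re*(v*k).im - (v*k).im^2 := by exact_mod_cast this
      field_simp; linear_combination hy + this
  · exfalso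
    have hx1 : x = -((v*k).re^2 + (v*k).im^2) := by
      have : (⟨x, y⟩ : ZB) = -(v*k)^2 := by rw [hxy, hv]; ring
      have := congrArg QuadraticAlgebra.re this
      rw [pow_two, re_neg, re_mul] at this
      linear_combination this
    have hy1 : y = -(2*(v*k).re*(v*k).im - (v*k).im^2) := by
      have : (⟨x, y⟩ : ZB) = -(v*k)^2 := by rw [hxy, hv]; ring
      have := congrArg QuadraticAlgebra.im this
      rw [pow_two, im_neg, im_mul] at this
      linear_combination this
    generalize (v*k).re = u at hx1 hy1
    generalize (v*k).im = t at hx1 hy1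
    have h5 : Real.sqrt 5^2 = 5 := Real.sq_sqrt (by norm_num)
    have h5p := Real.sqrt_nonneg 5
    obtain ⟨b, hb⟩ : ∃ b : ℝ, b = (-1 - Real.sqrt 5) / 2 := ⟨_, rfl⟩
    have hb2 : b^2 = 1 - b := by rw [hb]; linear_combination h5 / 4
    have hb0 : b < 0 := by rw [hb]; linarith
    have hpos := h.posb hb2 hb0
    have hxR : (q : ℝ)^2*(1 + p) = -(u^2 + t^2) := by
      have : q^2*(1 + p) = -((u : ℚ)^2 + t^2) := by rw [hx, hx1]; push_cast; ring
      exact_mod_cast congrArg (fun x : ℚ => (x : ℝ)) this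
    have hyR : (q : ℝ)^2*(s - 1) = -(2*u*t - t^2) := by
      have : q^2*(s - 1) = -(2*(u : ℚ)*t - t^2) := by rw [hy, hy1]; push_cast; ring
      exact_mod_cast congrArg (fun x : ℚ => (x : ℝ)) this
    have hq2 : (0 : ℝ) < (q : ℝ)^2 := by positivity
    have hkey : (q : ℝ)^2*(b^2 + s*b + p) = -(u + t*b)^2 := by
      linear_combination hxR + b*hyR + ((q : ℝ)^2 + t^2)*hb2
    have hz0 : (u + t*b)^2 = 0 := by
      nlinarith [mul_nonneg hq2.le hpos, sq_nonneg ((u : ℝ) + t*b)]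
    have hz1 : (u : ℝ) + t*b = 0 := by exact pow_eq_zero_iff two_ne_zero |>.1 hz0
    -- then u^2 - u t - t^2 = 0 in ℤ
    have h3 : ((u : ℝ)^2 - u*t - t^2) = 0 := by
      have : (u : ℝ) = -t*b := by linear_combination hz1
      rw [this]; linear_combination (t : ℝ)^2*hb2
    have h4 : nm ⟨u, t⟩ = 0 := by simp only [nm]; exact_mod_cast h3
    have h6 : (⟨u, t⟩ : ZB) = 0 := by
      by_contra hcon; exact nm_ne hcon h4
    have u0 := congrArg QuadraticAlgebra.re h6
    have t0 := congrArg QuadraticAlgebra.im h6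
    simp at u0 t0
    rw [u0, t0] at hx1 hy1
    apply h.hne
    have hq2 : q^2 ≠ 0 := by positivity
    rw [hx1] at hx; rw [hy1] at hy
    push_cast at hx hy
    constructor
    · apply mul_left_cancel₀ hq2; linear_combination hy
    · apply mul_left_cancel₀ hq2; linear_combination hx
end QP

namespace QP

def Z1 {R : Type*} [CommRing R] (k s p x : R) : R :=
  -64*s^3*p + 384*s^2*p^2 + 32*k*s^2*p - s^2*x^2 - 8*k*s^2*x + 1024*s*p^3 - 16*s*p^2*x - 64*k*s*p^2 + 8*s*p*x^2 + 128*k*s*p*x - 132*k^2*s*p - 2*k^2*s*x - 16*k^3*s + 128*p^3*x - 256*k*p^3 + 132*k*p^2*x - 264*k^2*p^2 + 4*k*p*x^2 + 8*k^2*p*x - 32*k^3*p + k*x^3 + 6*k^2*x^2 - 16*k^3*x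

def Z2 {R : Type*} [CommRing R] (k s p x : R) : R :=
  -8*s^3*x + 64*s^2*p^2 + 96*s^2*p*x + 128*k*s^2*p - 16*s^2*x^2 + 2*k*s^2*x + 8*k^2*s^2 + 128*s*p^2*x - 1568*k*s*p^2 - 2*s*p*x^2 + 456*k*s*p*x - 224*k^2*s*p - s*x^3 - 12*k*s*x^2 + 16*k^2*s*x - 1792*k*p^3 + 8*p^2*x^2 + 224*k*p^2*x - 2044*k^2*p^2 + 16*k*p*x^2 + 196*k^2*p*x - 224*k^3*p + k^2*x^2

def Z3 {R : Type*} [CommRing R] (k s p x : R) : R :=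
  -8*k*s^3 - 8*s^2*p*x + 192*k*s^2*p - 6*s^2*x^2 + k^2*s^2 - 128*s*p^3 - 96*s*p^2*x - 1280*k*s*p^2 + 194*k*s*p*x - 8*k^2*s*p + k*s*x^2 - 12*k^2*s*x + 16*k^3*s - 128*p^3*x - 1536*k*p^3 + p^2*x^2 + 8*k*p^2*x - 1584*k^2*p^2 + p*x^3 + 24*k*p*x^2 + 160*k^2*p*x - 192*k^3*p + 2*k^3*x

def Z4 {R : Type*} [CommRing R] (k s p x : R) : R :=
  64*s^4 + 2048*s^2*p^2 + 6912*k*s^2*p - 216*s^2*x^2 + 256*k^2*s^2 + 512*s*p^3 - 2688*s*p^2*x - 41472*k*s*p^2 + 7424*k*s*p*x - 864*k^2*s*p - 336*k^2*s*x + 384*k^3*s - 3072*p^3*x - 51200*k*p^3 + 256*p^2*x^2 + 864*k*p^2*x - 52800*k^2*p^2 + 864*k*p*x^2 + 5184*k^2*p*x - 6400*k^3*p + x^4 + 32*k^2*x^2 - 8*k^3*x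

def ZK {R : Type*} [CommRing R] (k s p x : R) : R :=
  32*k*s^2*p - s^2*x^2 - 16*s*p^2*x - 192*k*s*p^2 + 32*k*s*p*x - 4*k^2*s*p - 2*k^2*s*x - 64*p^4 - 256*k*p^3 + 4*k*p^2*x - 248*k^2*p^2 + 4*k*p*x^2 + 24*k^2*p*x - 32*k^3*p - k^4

def kap (s p c : ℚ) : ℚ := c^2 - 6 - 16*s - s^2 + 8*s^3 - 8*s*p

def hev (s p c e : ℚ) : ℚ := 8*e^3 + (1 - 8*s)*e^2 + (-16 - 8*p - s + 8*s^2)*e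
        + (6 - c^2 - s*(-16 - 8*p - s + 8*s^2) - p*(1 - 8*s))

lemma three {l u v x y z : ℚ} (h1 : x ≠ z) (h2 : y ≠ z) (h3 : x ≠ y) (hx : -l*x^2 + u*x + v = 0)
    (hy : -l*y^2 + u*y + v = 0) (hz : -l*z^2 + u*z + v = 0) : l = 0 ∧ u = 0 ∧ v = 0 := by
  have e1 : -l*(x + z) + u = 0 := mul_left_cancel₀ (sub_ne_zero.2 h1) (by linear_combination hx - hz)
  have e2 : -l*(y + z) + u = 0 := mul_left_cancel₀ (sub_ne_zero.2 h2) (by linear_combination hy - hz)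
  have e3 : l = 0 := mul_left_cancel₀ (sub_ne_zero.2 h3) (by linear_combination e2 - e1)
  rw [e3] at e1 hx
  have e4 : u = 0 := by linear_combination e1
  rw [e4] at hx
  exact ⟨e3, e4, by linear_combination hx⟩

lemma Sp.tr {s p c d e : ℚ} (h : Sp s p c d) (he : e = 0 ∨ e = 1 ∨ e = -1/8) :
    ∃ s' p' c' d' l u v : ℚ, Sp s' p' c' d' ∧
      8*(e^2 + s*e + p)*(e^2 + s'*e + p') = 40*e^4 + 4*e^3 - 48*e^2 + 12*e + 1 ∧
      (∀ r : ℚ, 8*r^5 + r^4 - 16*r^3 + 6*r^2 + r - (-l*r^2 + u*r + v)^2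
        = 8*(r^2 + s*r + p)*(r^2 + s'*r + p')*(r - e)) ∧
      8*((e^2 + s*e + p)*s') = (1 - 8*s + 8*e)*(e^2 + s*e + p) + hev s p c e ∧
      8*((e^2 + s*e + p)*p') = (-16 - 8*p - s + 8*s^2)*(e^2 + s*e + p) + 2*c*(c*e + d) + s*hev s p c e
        + 8*e*((e^2 + s*e + p)*s') ∧
      (e^2 + s*e + p)*hev s' p' c' e = hev s p c e*(e^2 + s'*e + p') := by
  have hG : 8*e^5 + e^4 - 16*e^3 + 6*e^2 + e = 0 := by rcases he with rfl | rfl | rfl <;> norm_num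
  have hGd : 40*e^4 + 4*e^3 - 48*e^2 + 12*e + 1 ≠ 0 := by rcases he with rfl | rfl | rfl <;> norm_num
  have hA : e^2 + s*e + p ≠ 0 := h.irr e
  obtain ⟨l, hl⟩ : ∃ l, l*(e^2 + s*e + p) = c*e + d := ⟨(c*e + d) / (e^2 + s*e + p), div_mul_cancel₀ _ hA⟩
  have hhe : hev s p c e = - l^2*(e^2 + s*e + p) := by
    apply mul_left_cancel₀ hA
    have := h.fac e
    simp only [Rat.cast_id, hG] at this
    rw [hev]
    linear_combination -this + (l*(e^2 + s*e + p) + (c*e + d))*hl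
  have hh : hev s p c e + 2*l*(c*e + d) - l^2*(e^2 + s*e + p) = 0 := by
    rw [← hl, hhe]; ring
  obtain ⟨s', hs⟩ : ∃ s', s' = (1 - 8*s - l^2) / 8 + e := ⟨_, rfl⟩
  obtain ⟨p', hp⟩ : ∃ p', p' = ((-16 - 8*p - s + 8*s^2) + 2*l*c - l^2*s) / 8 + e*s' := ⟨_, rfl⟩
  have hpoly : ∀ r : ℚ, 8*r^5 + r^4 - 16*r^3 + 6*r^2 + r - (-l*r^2 + (c - l*s)*r + (d - l*p))^2
        = 8*(r^2 + s*r + p)*(r^2 + s'*r + p')*(r - e) := by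
    intro r
    have := h.fac r
    simp only [Rat.cast_id] at this
    rw [hev] at hh
    rw [hp, hs]
    linear_combination this + (r^2 + s*r + p)*hh
  have hbe : -l*e^2 + (c - l*s)*e + (d - l*p) = 0 := by linear_combination -hl
  have hpd : ∀ r : ℚ, 40*r^4 + 4*r^3 - 48*r^2 + 12*r + 1
      - 2*(-l*r^2 + (c - l*s)*r + (d - l*p))*(-2*l*r + (c - l*s))
        = 8*(2*r + s)*(r^2 + s'*r + p')*(r - e) + 8*(r^2 + s*r + p)*(2*r + s')*(r - e)
          + 8*(r^2 + s*r + p)*(r^2 + s'*r + p') := by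
    intro r
    have := h.E1
    rw [hev] at hh
    rw [hp, hs]
    linear_combination this + (2*r + s)*hh
  have hder : 8*(e^2 + s*e + p)*(e^2 + s'*e + p') = 40*e^4 + 4*e^3 - 48*e^2 + 12*e + 1 := by
    have := hpd e
    rw [hbe] at this
    linear_combination -this
  have hA' : e^2 + s'*e + p' ≠ 0 := by
    intro h0; rw [h0] at hder; exact hGd (by rw [← hder]; ring)
  have hSp : Sp s' p' (c - l*s + l*s') (d - l*p + l*p') := by
    refine ⟨?_, ?_, ?_, ?_⟩
    · have key : ∀ r : ℚ, r^2 + s'*r + p' = 0 → (r = 0 ∨ r = 1 ∨ r = -1/8) ∧ r ≠ e ∧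
          -l*r^2 + (c - l*s)*r + (d - l*p) = 0 ∧ 2*r + s' ≠ 0 := by
        intro r hr
        have h1 := hpoly r
        rw [hr] at h1
        have h2 : r = 0 ∨ r = 1 ∨ r = -1/8 := lemR (z := -l*r^2 + (c - l*s)*r + (d - l*p)) (by linear_combination -h1)
        have h3 : -l*r^2 + (c - l*s)*r + (d - l*p) = 0 := by
          have h4 : (-l*r^2 + (c - l*s)*r + (d - l*p))^2 = 0 := by
            have : 8*r^5 + r^4 - 16*r^3 + 6*r^2 + r = 0 := by rcases h2 with rfl | rfl | rfl <;> norm_num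
            linear_combination -h1 + this
          exact pow_eq_zero_iff two_ne_zero |>.1 h4
        refine ⟨h2, ?_, h3, ?_⟩
        · rintro rfl; exact hA' hr
        · intro h5
          have := hpd r
          rw [hr, h5, h3] at this
          rcases h2 with rfl | rfl | rfl <;> norm_num at this
      intro r hr
      obtain ⟨k1, k2, k3, k4⟩ := key r hr
      obtain ⟨m1, m2, m3, m4⟩ := key (-s' - r) (by linear_combination hr)
      have hne : r ≠ -s' - r := fun h => k4 (by linear_combination h)
      obtain ⟨z1, z2, z3⟩ := three k2 m2 hne k3 m3 hbe
      rw [z1] at z2 z3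
      rcases h.nz with h | h
      · exact h (by linear_combination z2)
      · exact h (by linear_combination z3)
    · have := h.E1
      rw [hev] at hh
      clear hder hA' hpoly hpd hbe
      subst hp; subst hs
      linear_combination this + (s - ((1 - 8*s - l^2) / 8 + e))*hh
    · have := h.E0
      rw [hev] at hh
      clear hder hA' hpoly hpd hbe
      subst hp; subst hs
      linear_combination this + (p - (((-16 - 8*p - s + 8*s^2) + 2*l*c - l^2*s) / 8 + e*((1 - 8*s - l^2) / 8 + e)))*hh
    · by_contra hcon
      push Not at hcon
      obtain ⟨h1, h2⟩ := hcon
      have : l*(e^2 + s'*e + p') = 0 := by linear_combination e*h1 + h2 + hl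
      have hl0 : l = 0 := (mul_eq_zero.1 this).resolve_right hA'
      rw [hl0] at h1 h2
      rcases h.nz with h | h
      · exact h (by linear_combination h1)
      · exact h (by linear_combination h2)
  refine ⟨s', p', _, _, l, c - l*s, d - l*p, hSp, hder, hpoly, ?_, ?_, ?_⟩
  · rw [hhe, hs]; ring
  · rw [hhe, hp, ← hl]; ring
  · rw [hhe]
    apply mul_left_cancel₀ hA'
    have := hSp.fac e
    simp only [Rat.cast_id, hG] at this
    rw [hev]
    have hq : (c - l*s + l*s')*e + (d - l*p + l*p') = l*(e^2 + s'*e + p') := by linear_combination hbe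
    rw [hq] at this
    linear_combination -(e^2 + s*e + p)*this

end QP

namespace QP

def SD (s p x s' p' x' : ℚ) : Prop := ∃ t : ℚ, t ≠ 0 ∧ Z1 1 s' p' x' = t*Z1 1 s p x ∧ Z2 1 s' p' x' = t*Z2 1 s p x ∧
  Z3 1 s' p' x' = t*Z3 1 s p x ∧ Z4 1 s' p' x' = t*Z4 1 s p x

lemma SD.refl (s p x : ℚ) : SD s p x s p x := ⟨1, one_ne_zero, by simp⟩

lemma SD.trans {s p x s' p' x' s2 p2 x2 : ℚ} (h : SD s p x s' p' x') (h' : SD s' p' x' s2 p2 x2) : SD s p x s2 p2 x2 := by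
  obtain ⟨t, ht, h1, h2, h3, h4⟩ := h
  obtain ⟨u, hu, g1, g2, g3, g4⟩ := h'
  exact ⟨u*t, mul_ne_zero hu ht, by rw [g1, h1]; ring, by rw [g2, h2]; ring, by rw [g3, h3]; ring, by rw [g4, h4]; ring⟩

lemma sd_of {A S P Q s p x s' p' x' L : ℚ} (hA : A ≠ 0) (hL : L ≠ 0) (hS : A*s' = S) (hP : A*p' = P) (hQ : A*x' = Q)
    (h1 : Z1 A S P Q = L*Z1 1 s p x) (h2 : Z2 A S P Q = L*Z2 1 s p x) (h3 : Z3 A S P Q = L*Z3 1 s p x)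
    (h4 : Z4 A S P Q = L*Z4 1 s p x) : SD s p x s' p' x' := by
  subst hS; subst hP; subst hQ
  have hA4 : A^4 ≠ 0 := by positivity
  refine ⟨L / A^4, by positivity, ?_, ?_, ?_, ?_⟩
  · rw [div_mul_eq_mul_div, ← h1, eq_div_iff hA4]; simp only [Z1]; ring
  · rw [div_mul_eq_mul_div, ← h2, eq_div_iff hA4]; simp only [Z2]; ring
  · rw [div_mul_eq_mul_div, ← h3, eq_div_iff hA4]; simp only [Z3]; ring
  · rw [div_mul_eq_mul_div, ← h4, eq_div_iff hA4]; simp only [Z4]; ring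

lemma cls_of {a a' b f m : ℚ} (ha : a ≠ 0) (hf : f ≠ 0) (hm : m ≠ 0) (h : b^2 = f*a*a') : ∃ k, a' = f*a*k^2 :=
  ⟨b / (f*a), by field_simp; linear_combination -h⟩

lemma kgen {e A S P H G A' s' p' c' : ℚ} (h5 : A*hev s' p' c' e = H*A') (h1 : 8*A*A' = G)
    (hs : A*s' = S) (hp : A*p' = P) : A*(A*kap s' p' c') = A^2*(8*e^3 + e^2 - 16*e)
      - 8*e^2*S*A - 8*e*P*A - e*S*A + 8*e*S^2 - P*A + 8*S*P - H*G / 8 := by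
  rw [hev] at h5
  rw [kap]
  linear_combination -A*h5 - H / 8*h1 + (8*e*(A*s' + S) - 8*e^2*A - e*A + 8*A*p')*hs
    + (8*S - 8*e*A - A)*hp

lemma Sp.t0 {s p c d : ℚ} (h : Sp s p c d) : ∃ s' p' c' d', Sp s' p' c' d' ∧ SD s p (kap s p c) s' p' (kap s' p' c') ∧
    (∃ k, p' = 2*p*k^2) ∧ (∃ k, 1 + s' + p' = -2*(1 + s + p)*k^2) ∧
    (∃ k, 1 - 8*s' + 64*p' = (1 - 8*s + 64*p)*k^2) := by
  obtain ⟨s', p', c', d', l, u, v, hS, h1, h2, h3, h4, h5⟩ := h.tr (e := 0) (by simp)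
  have hp0 : p ≠ 0 := fun e => h.irr 0 (by rw [e]; ring)
  have h10 : 1 + s + p ≠ 0 := fun e => h.irr 1 (by linear_combination e)
  have hm0 : 1 - 8*s + 64*p ≠ 0 := fun e => h.irr (-1/8) (by linear_combination e / 64)
  have E1 := h.E1
  refine ⟨s', p', c', d', hS, ?_, ?_, ?_, ?_⟩
  · have hs : p*s' = -kap s p c / 8 := by rw [hev] at h3; rw [kap]; linear_combination h3 / 8
    have hp : p*p' = 1 / 8 := by linear_combination h1 / 8
    have hk : p*kap s' p' c' = - s := by
      apply mul_left_cancel₀ hp0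
      have := kgen h5 h1 (Eq.trans (by ring) hs) (Eq.trans (by ring) hp)
      simp only [hev, kap] at this
      simp only [kap]
      linear_combination this
    refine sd_of (L := 1 / 64) hp0 (by norm_num) hs hp hk ?_ ?_ ?_ ?_ <;> simp only [Z1, Z2, Z3, Z4] <;> ring
  · exact ⟨1 / (4*p), by field_simp; linear_combination 2*h1⟩
  · have := h2 1
    refine cls_of (b := (-l*1^2 + u*1 + v) / 2) h10 (by norm_num) one_ne_zero (by linear_combination -this / 4)
  · have := h2 (-1/8)
    obtain ⟨k, hk⟩ := cls_of (b := 64*(-l*(-1/8)^2 + u*(-1/8) + v)) (f := 1) (a' := 1 - 8*s' + 64*p') hm0 (by norm_num) one_ne_zero (by linear_combination -4096*this)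
    exact ⟨k, by rw [hk]; ring⟩

lemma Sp.t1 {s p c d : ℚ} (h : Sp s p c d) : ∃ s' p' c' d', Sp s' p' c' d' ∧ SD s p (kap s p c) s' p' (kap s' p' c') ∧
    (∃ k, p' = 2*p*k^2) ∧ (∃ k, 1 + s' + p' = 2*(1 + s + p)*k^2) ∧
    (∃ k, 1 - 8*s' + 64*p' = (1 - 8*s + 64*p)*k^2) := by
  obtain ⟨s', p', c', d', l, u, v, hS, h1, h2, h3, h4, h5⟩ := h.tr (e := 1) (by simp)
  have hp0 : p ≠ 0 := fun e => h.irr 0 (by rw [e]; ring)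
  have h10 : 1 + s + p ≠ 0 := fun e => h.irr 1 (by linear_combination e)
  have hm0 : 1 - 8*s + 64*p ≠ 0 := fun e => h.irr (-1/8) (by linear_combination e / 64)
  have E1 := h.E1
  refine ⟨s', p', c', d', hS, ?_, ?_, ?_, ?_⟩
  · have hs : (1 + s + p)*s' = -s -kap s p c / 8 + 1 / 4 := by rw [hev] at h3; rw [kap]; linear_combination h3 / 8
    have hp : (1 + s + p)*p' = -p + kap s p c / 8 - 1 / 8 := by
      rw [hev] at h3 h4; rw [kap]; linear_combination h4 / 8 + h3 / 8 - E1 / 8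
    have hk : (1 + s + p)*kap s' p' c' = s + 2*p + kap s p c := by
      apply mul_left_cancel₀ h10
      have := kgen h5 h1 (Eq.trans (by ring) hs) (Eq.trans (by ring) hp)
      simp only [hev, kap] at this
      simp only [kap]
      linear_combination this
    refine sd_of (L := 81 / 64) h10 (by norm_num) hs hp hk ?_ ?_ ?_ ?_ <;> simp only [Z1, Z2, Z3, Z4] <;> ring
  · have := h2 0
    refine cls_of (b := (-l*0^2 + u*0 + v) / 2) hp0 (by norm_num) one_ne_zero (by linear_combination -this / 4)
  · exact ⟨3 / (4*(1 + s + p)), by field_simp; linear_combination 2*h1⟩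
  · have := h2 (-1/8)
    obtain ⟨k, hk⟩ := cls_of (b := 64*(-l*(-1/8)^2 + u*(-1/8) + v) / 3) (f := 1) (a' := 1 - 8*s' + 64*p') hm0 (by norm_num) one_ne_zero (by linear_combination -4096/9*this)
    exact ⟨k, by rw [hk]; ring⟩

lemma Sp.tm {s p c d : ℚ} (h : Sp s p c d) : ∃ s' p' c' d', Sp s' p' c' d' ∧ SD s p (kap s p c) s' p' (kap s' p' c') ∧
    (∃ k, 1 - 8*s' + 64*p' = -71*(1 - 8*s + 64*p)*k^2) := by
  obtain ⟨s', p', c', d', l, u, v, hS, h1, h2, h3, h4, h5⟩ := h.tr (e := -1/8) (by simp)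
  have hm0 : 1 - 8*s + 64*p ≠ 0 := fun e => h.irr (-1/8) (by linear_combination e / 64)
  have hm1 : 1 / 64 - s / 8 + p ≠ 0 := fun e => h.irr (-1/8) (by linear_combination e)
  have E1 := h.E1
  refine ⟨s', p', c', d', hS, ?_, ?_⟩
  · have hs : (1 / 64 - s / 8 + p)*s' = -s / 64 -kap s p c / 8 + 1 / 4 := by rw [hev] at h3; rw [kap]; linear_combination h3 / 8
    have hp : (1 / 64 - s / 8 + p)*p' = -p / 64 - kap s p c / 64 - 1 / 8 := by
      rw [hev] at h3 h4; rw [kap]; linear_combination h4 / 8 - h3 / 64 - E1 / 8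
    have hk : (1 / 64 - s / 8 + p)*kap s' p' c' = s + 2*p + kap s p c / 64 := by
      apply mul_left_cancel₀ hm1
      have := kgen h5 h1 (Eq.trans (by ring) hs) (Eq.trans (by ring) hp)
      simp only [hev, kap] at this
      simp only [kap]
      linear_combination this
    refine sd_of (L := 408321/16777216) hm1 (by norm_num) hs hp hk ?_ ?_ ?_ ?_ <;> simp only [Z1, Z2, Z3, Z4] <;> ring
  · exact ⟨3 / (1 - 8*s + 64*p), by field_simp; linear_combination 512*h1⟩
lemma Sp.p0 {s p c d : ℚ} (h : Sp s p c d) : p ≠ 0 := fun e => h.irr 0 (by rw [e]; ring)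
lemma Sp.mn0 {s p c d : ℚ} (h : Sp s p c d) : 1 - 8*s + 64*p ≠ 0 := fun e => h.irr (-1/8) (by linear_combination e / 64)
lemma Sp.ap0 {s p c d : ℚ} (h : Sp s p c d) : 1 + s + p ≠ 0 := fun e => h.irr 1 (by linear_combination e)

def Good (s p x : ℚ) : Prop := ∃ s' p' c' d', Sp s' p' c' d' ∧ SS s' p' ∧ SD s p x s' p' (kap s' p' c')

lemma Sp.ss3 {s p c d : ℚ} (h : Sp s p c d) (hm : ∃ k, 1 - 8*s + 64*p = k^2) (hp : ∃ k, p = k^2) :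
    Good s p (kap s p c) := by
  obtain ⟨τ, hc⟩ := h.cls
  obtain ⟨k, hk⟩ := hp
  have hk0 : k ≠ 0 := by rintro rfl; exact h.p0 (by rw [hk]; ring)
  obtain ⟨k', hk'⟩ := hc.c0
  have hτ : τ = 1 := by
    rcases hc.ht with h1 | h1
    · exact h1
    · exfalso
      rw [h1] at hk'
      rcases hk' with hk' | hk'
      · exact nsq2 k k' hk0 (by rw [← hk, hk'])
      · have : 0 < k^2 := by positivity
        nlinarith [sq_nonneg k']
  obtain ⟨j, hj⟩ := hc.c1
  rw [hτ] at hj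
  rcases hj with hj | hj
  · exact ⟨s, p, c, d, h, ⟨⟨k, hk⟩, ⟨j, by rw [hj]; ring⟩, hm⟩, SD.refl _ _ _⟩
  · obtain ⟨s1, p1, c1, d1, H1, S1, ⟨k0, hk0⟩, ⟨k1, hk1⟩, ⟨k2, hk2⟩⟩ := h.t0
    obtain ⟨s2, p2, c2, d2, H2, S2, ⟨l0, hl0⟩, ⟨l1, hl1⟩, ⟨l2, hl2⟩⟩ := H1.t1
    obtain ⟨m, hm⟩ := hm
    refine ⟨s2, p2, c2, d2, H2, ⟨⟨2*k*k0*l0, ?_⟩, ⟨2*j*k1*l1, ?_⟩, ⟨m*k2*l2, ?_⟩⟩, S1.trans S2⟩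
    · rw [hl0, hk0, hk]; ring
    · rw [hl1, hk1, hj]; ring
    · rw [hl2, hk2, hm]; ring

lemma Sp.ss2 {s p c d : ℚ} (h : Sp s p c d) (hm : ∃ k, 1 - 8*s + 64*p = k^2) : Good s p (kap s p c) := by
  obtain ⟨τ, hc⟩ := h.cls
  obtain ⟨m, hm'⟩ := hm
  have hp : 0 < p := by
    have := h.pos0
    rw [hm'] at this
    exact pos_of_mul_pos_left this (sq_nonneg m)
  obtain ⟨k, hk⟩ := hc.c0
  rcases hc.ht with h1 | h1 <;> rw [h1] at hk
  · refine h.ss3 ⟨m, hm'⟩ ?_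
    rcases hk with hk | hk
    · exact ⟨k, by rw [hk]; ring⟩
    · nlinarith [sq_nonneg k]
  · rcases hk with hk | hk
    · obtain ⟨s1, p1, c1, d1, H1, S1, ⟨k0, hk0⟩, ⟨k1, hk1⟩, ⟨k2, hk2⟩⟩ := h.t1
      obtain ⟨s2, p2, c2, d2, H2, hS, S2⟩ := H1.ss3 ⟨m*k2, by rw [hk2, hm']; ring⟩ ⟨2*k*k0, by rw [hk0, hk]; ring⟩
      exact ⟨s2, p2, c2, d2, H2, hS, S1.trans S2⟩
    · nlinarith [sq_nonneg k]

lemma Sp.toSS {s p c d : ℚ} (h : Sp s p c d) : Good s p (kap s p c) := by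
  obtain ⟨τ, hc⟩ := h.cls
  obtain ⟨m, hm | hm⟩ := hc.cm
  · exact h.ss2 ⟨m, hm⟩
  · obtain ⟨s1, p1, c1, d1, H1, S1, ⟨k0, hk0⟩⟩ := h.tm
    obtain ⟨s2, p2, c2, d2, H2, hS, S2⟩ := H1.ss2 ⟨71*m*k0, by rw [hk0, hm]; ring⟩
    exact ⟨s2, p2, c2, d2, H2, hS, S1.trans S2⟩
end QP

namespace QP

lemma lin0 {s p : ℚ} (irr : ∀ r : ℚ, r^2 + s*r + p ≠ 0) {w : ℂ} (hw : w^2 + s*w + p = 0) {x y : ℚ}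
    (h : (x : ℂ) + y*w = 0) : x = 0 ∧ y = 0 := by
  have hy : y = 0 := by
    by_contra hy
    apply irr (-x / y)
    have hy' : (y : ℂ) ≠ 0 := by exact_mod_cast hy
    have hw' : w = ((-x / y : ℚ) : ℂ) := by
      push_cast; rw [eq_div_iff hy']; linear_combination h
    rw [hw'] at hw
    exact_mod_cast hw
  subst hy
  refine ⟨?_, rfl⟩
  simpa using h

structure KV where
  (P0 P1 P2 P3 Q0 Q1 Q2 : ℚ)

def KV.P (v : KV) (w : ℂ) : ℂ := v.P0 + v.P1*w + v.P2*w^2 + v.P3*w^3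
def KV.Q (v : KV) (w : ℂ) : ℂ := v.Q0 + v.Q1*w + v.Q2*w^2

structure Ker (s0 s1 sm g0 g1 : ℚ) (v : KV) : Prop where
  h0 : v.P0 = s0*v.Q0
  h1 : v.P0 + v.P1 + v.P2 + v.P3 = s1*(v.Q0 + v.Q1 + v.Q2)
  hm : v.P0 - v.P1 / 8 + v.P2 / 64 - v.P3 / 512 = sm*(v.Q0 - v.Q1 / 8 + v.Q2 / 64)
  b0 : v.P0 + v.P2 - v.P3 = g0*(v.Q0 + v.Q2) + g1*(v.Q1 - v.Q2)
  b1 : v.P1 - v.P2 + 2*v.P3 = g0*(v.Q1 - v.Q2) + g1*(v.Q0 + v.Q2) - g1*(v.Q1 - v.Q2)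

lemma exKer (s0 s1 sm g0 g1 σ : ℚ) : ∃ v : KV, Ker s0 s1 sm g0 g1 v ∧ v.P3 = σ*v.Q2 ∧
    ¬ (v.P0 = 0 ∧ v.P1 = 0 ∧ v.P2 = 0 ∧ v.P3 = 0 ∧ v.Q0 = 0 ∧ v.Q1 = 0 ∧ v.Q2 = 0) := by
  let M : Matrix (Fin 6) (Fin 7) ℚ := !![1, 0, 0, 0, -s0, 0, 0;
    1, 1, 1, 1, -s1, -s1, -s1;
    1, -1/8, 1/64, -1/512, -sm, sm/8, -sm/64;
    1, 0, 1, -1, -g0, -g1, -g0 + g1;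
    0, 1, -1, 2, -g1, -g0 + g1, g0 - g1 - g1;
    0, 0, 0, 1, 0, 0, -σ]
  have hk : LinearMap.ker (Matrix.toLin' M) ≠ ⊥ := LinearMap.ker_ne_bot_of_finrank_lt (by simp)
  obtain ⟨v, hv, hv0⟩ := (Submodule.ne_bot_iff _).1 hk
  rw [LinearMap.mem_ker, Matrix.toLin'_apply] at hv
  have e0 := congrFun hv 0
  have e1 := congrFun hv 1
  have e2 := congrFun hv 2
  have e3 := congrFun hv 3
  have e4 := congrFun hv 4
  have e5 := congrFun hv 5
  simp [M, Matrix.mulVec, dotProduct, Fin.sum_univ_succ] at e0 e1 e2 e3 e4 e5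
  refine ⟨⟨v 0, v 1, v 2, v 3, v 4, v 5, v 6⟩, ⟨?_, ?_, ?_, ?_, ?_⟩, ?_, ?_⟩
  · dsimp only; linear_combination e0
  · dsimp only; linear_combination e1
  · dsimp only; linear_combination e2
  · dsimp only; linear_combination e3
  · dsimp only; linear_combination e4
  · dsimp only; linear_combination e5
  · dsimp only
    rintro ⟨z0, z1, z2, z3, z4, z5, z6⟩
    apply hv0
    funext i
    fin_cases i <;> assumption

lemma van {r0 r1 r2 r3 r4 r5 r6 : ℚ} (h0 : r0 = 0) (h1 : r0 + r1 + r2 + r3 + r4 + r5 + r6 = 0)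
    (hm : r0 - r1 / 8 + r2 / 64 - r3 / 512 + r4 / 4096 - r5 / 32768 + r6 / 262144 = 0)
    (hb0 : r0 + r2 - r3 + 2*r4 - 3*r5 + 5*r6 = 0) (hb1 : r1 - r2 + 2*r3 - 3*r4 + 5*r5 - 8*r6 = 0) (w : ℂ) :
    r0 + r1*w + r2*w^2 + r3*w^3 + r4*w^4 + r5*w^5 + r6*w^6 =
      (8*w^5 + w^4 - 16*w^3 + 6*w^2 + w)*((r6 / 8 : ℚ)*w + r1) := by
  have e2 : r2 = 6*r1 + r6 / 8 := by linarith
  have e3 : r3 = -16*r1 + 6*(r6 / 8) := by linarith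
  have e4 : r4 = r1 - 16*(r6 / 8) := by linarith
  have e5 : r5 = 8*r1 + r6 / 8 := by linarith
  rw [h0, e2, e3, e4, e5]
  push_cast
  ring

lemma Ker.pol {s0 s1 sm g0 g1 s p : ℚ} {v v' : KV} (h : Ker s0 s1 sm g0 g1 v) (h' : Ker s0 s1 sm g0 g1 v')
    (k0 : p = s0^2) (k1 : 1 + s + p = s1^2) (km : 1 / 64 - s / 8 + p = sm^2)
    (kb : 1 + p = g0^2 + g1^2) (kb' : s - 1 = 2*g0*g1 - g1^2) :
    ∃ L0 : ℚ, ∀ w : ℂ, v.P w*v'.P w - (w^2 + s*w + p)*v.Q w*v'.Q w =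
      (8*w^5 + w^4 - 16*w^3 + 6*w^2 + w)*(((v.P3*v'.P3 - v.Q2*v'.Q2) / 8 : ℚ)*w + L0) := by
  refine ⟨_, fun w => Eq.trans ?_ (van (r0 := v.P0*v'.P0 - p*(v.Q0*v'.Q0))
    (r1 := v.P0*v'.P1 + v.P1*v'.P0 - (s*(v.Q0*v'.Q0) + p*(v.Q0*v'.Q1 + v.Q1*v'.Q0)))
    (r2 := v.P0*v'.P2 + v.P1*v'.P1 + v.P2*v'.P0 - (v.Q0*v'.Q0 + s*(v.Q0*v'.Q1 + v.Q1*v'.Q0)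
      + p*(v.Q0*v'.Q2 + v.Q1*v'.Q1 + v.Q2*v'.Q0)))
    (r3 := v.P0*v'.P3 + v.P1*v'.P2 + v.P2*v'.P1 + v.P3*v'.P0 - (v.Q0*v'.Q1 + v.Q1*v'.Q0 + s*(v.Q0*v'.Q2 + v.Q1*v'.Q1 + v.Q2*v'.Q0)
      + p*(v.Q1*v'.Q2 + v.Q2*v'.Q1)))
    (r4 := v.P1*v'.P3 + v.P2*v'.P2 + v.P3*v'.P1 - (v.Q0*v'.Q2 + v.Q1*v'.Q1 + v.Q2*v'.Q0
      + s*(v.Q1*v'.Q2 + v.Q2*v'.Q1) + p*(v.Q2*v'.Q2)))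
    (r5 := v.P2*v'.P3 + v.P3*v'.P2 - (v.Q1*v'.Q2 + v.Q2*v'.Q1 + s*(v.Q2*v'.Q2)))
    (r6 := v.P3*v'.P3 - v.Q2*v'.Q2) ?_ ?_ ?_ ?_ ?_ w)⟩
  · simp only [KV.P, KV.Q]; push_cast; ring
  · rw [h.h0, h'.h0, k0]; ring
  · have := congrArg₂ (· * ·) h.h1 h'.h1
    linear_combination this - (v.Q0 + v.Q1 + v.Q2)*(v'.Q0 + v'.Q1 + v'.Q2)*k1
  · have := congrArg₂ (· * ·) h.hm h'.hm
    linear_combination this - (v.Q0 - v.Q1 / 8 + v.Q2 / 64)*(v'.Q0 - v'.Q1 / 8 + v'.Q2 / 64)*km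
  · have e1 : (v.P0 + v.P2 - v.P3)*(v'.P0 + v'.P2 - v'.P3) = _ := congrArg₂ (· * ·) h.b0 h'.b0
    have e2 : (v.P1 - v.P2 + 2*v.P3)*(v'.P1 - v'.P2 + 2*v'.P3) = _ := congrArg₂ (· * ·) h.b1 h'.b1
    linear_combination e1 + e2 - ((v.Q0 + v.Q2)*(v'.Q0 + v'.Q2) + (v.Q1 - v.Q2)*(v'.Q1 - v'.Q2))*kb
      - ((v.Q0 + v.Q2)*(v'.Q1 - v'.Q2) + (v.Q1 - v.Q2)*(v'.Q0 + v'.Q2) - (v.Q1 - v.Q2)*(v'.Q1 - v'.Q2))*kb'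
  · have e1 : (v.P0 + v.P2 - v.P3)*(v'.P1 - v'.P2 + 2*v'.P3) = _ := congrArg₂ (· * ·) h.b0 h'.b1
    have e3 : (v.P1 - v.P2 + 2*v.P3)*(v'.P0 + v'.P2 - v'.P3) = _ := congrArg₂ (· * ·) h.b1 h'.b0
    have e2 : (v.P1 - v.P2 + 2*v.P3)*(v'.P1 - v'.P2 + 2*v'.P3) = _ := congrArg₂ (· * ·) h.b1 h'.b1
    linear_combination e1 + e3 - e2 - ((v.Q0 + v.Q2)*(v'.Q1 - v'.Q2) + (v.Q1 - v.Q2)*(v'.Q0 + v'.Q2) - (v.Q1 - v.Q2)*(v'.Q1 - v'.Q2))*kb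
      - ((v.Q0 + v.Q2)*(v'.Q0 + v'.Q2) + (v.Q1 - v.Q2)*(v'.Q1 - v'.Q2) - ((v.Q0 + v.Q2)*(v'.Q1 - v'.Q2) + (v.Q1 - v.Q2)*(v'.Q0 + v'.Q2) - (v.Q1 - v.Q2)*(v'.Q1 - v'.Q2)))*kb'

lemma P_red {s p : ℚ} (v : KV) {w : ℂ} (hw : w^2 + s*w + p = 0) : ∃ u0 u1 : ℚ, v.P w = u0 + u1*w ∧
    ∀ w : ℂ, v.P w = (v.P3*w + (v.P2 - s*v.P3 : ℚ))*(w^2 + s*w + p) + (u0 + u1*w) := by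
  refine ⟨v.P0 - p*(v.P2 - s*v.P3), v.P1 - p*v.P3 - s*(v.P2 - s*v.P3), ?_, ?_⟩
  · rw [KV.P]; push_cast; linear_combination (v.P3*w + (v.P2 - s*v.P3))*hw
  · intro w; rw [KV.P]; push_cast; ring

lemma quart0 {c0 c1 c2 c3 c4 : ℚ} (h : ∀ r : ℚ, c0 + c1*r + c2*r^2 + c3*r^3 + c4*r^4 = 0) :
    c0 = 0 ∧ c1 = 0 ∧ c2 = 0 ∧ c3 = 0 ∧ c4 = 0 := by
  have h0 := h 0
  have h1 := h 1
  have h2 := h (-1)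
  have h3 := h 2
  have h4 := h (-2)
  refine ⟨?_, ?_, ?_, ?_, ?_⟩ <;> linarith

lemma exroot (s p : ℚ) : ∃ w : ℂ, w^2 + s*w + p = 0 := by
  obtain ⟨z, hz⟩ := IsAlgClosed.exists_pow_nat_eq ((s : ℂ)^2 / 4 - p) (n := 2) (by norm_num)
  exact ⟨z - s / 2, by linear_combination hz⟩

/-- `P² = a Q²` forces zero. -/
lemma Psq {s p : ℚ} (irr : ∀ r : ℚ, r^2 + s*r + p ≠ 0) {v : KV}
    (h : ∀ w : ℂ, v.P w*v.P w - (w^2 + s*w + p)*v.Q w*v.Q w = 0) :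
    v.P0 = 0 ∧ v.P1 = 0 ∧ v.P2 = 0 ∧ v.P3 = 0 ∧ v.Q0 = 0 ∧ v.Q1 = 0 ∧ v.Q2 = 0 := by
  have ev : ∀ r : ℚ, (v.P0 + v.P1*r + v.P2*r^2 + v.P3*r^3)^2
      = (r^2 + s*r + p)*(v.Q0 + v.Q1*r + v.Q2*r^2)^2 := by
    intro r
    have := h r
    simp only [KV.P, KV.Q] at this
    have h2 : ((v.P0 + v.P1*r + v.P2*r^2 + v.P3*r^3)*(v.P0 + v.P1*r + v.P2*r^2 + v.P3*r^3)
      - (r^2 + s*r + p)*(v.Q0 + v.Q1*r + v.Q2*r^2)*(v.Q0 + v.Q1*r + v.Q2*r^2) : ℚ) = 0 := by exact_mod_cast this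
    linear_combination h2
  obtain ⟨w, hw⟩ := exroot s p
  have hPw : v.P w = 0 := by
    have := h w
    rw [hw, zero_mul, zero_mul, sub_zero] at this
    exact mul_self_eq_zero.1 this
  obtain ⟨n1, hn1⟩ : ∃ n1, n1 = v.P3 := ⟨_, rfl⟩
  obtain ⟨n0, hn0⟩ : ∃ n0, n0 = v.P2 - s*v.P3 := ⟨_, rfl⟩
  obtain ⟨u0, u1⟩ := lin0 irr hw (x := v.P0 - p*n0) (y := v.P1 - p*v.P3 - s*n0) (by
    rw [KV.P] at hPw; rw [hn0]; push_cast; linear_combination hPw - (v.P3*w + (v.P2 - s*v.P3))*hw)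
  have ev2 : ∀ r : ℚ, (r^2 + s*r + p)*(n1*r + n0)^2 = (v.Q0 + v.Q1*r + v.Q2*r^2)^2 := by
    intro r
    apply mul_left_cancel₀ (irr r)
    rw [← ev r]
    have : v.P0 + v.P1*r + v.P2*r^2 + v.P3*r^3 = (n1*r + n0)*(r^2 + s*r + p) := by
      rw [hn1]
      linear_combination u0 + r*u1 + (-r^2)*hn0
    rw [this]; ring
  have hQw : v.Q w = 0 := by
    obtain ⟨c0, c1, c2, c3, c4⟩ := quart0 (c0 := p*n0^2 - v.Q0^2) (c1 := 2*p*n1*n0 + s*n0^2 - 2*v.Q1*v.Q0)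
      (c2 := p*n1^2 + 2*s*n1*n0 + n0^2 - v.Q1^2 - 2*v.Q2*v.Q0)
      (c3 := s*n1^2 + 2*n1*n0 - 2*v.Q2*v.Q1) (c4 := n1^2 - v.Q2^2) (fun r => by linear_combination ev2 r)
    have d0 : ((p*n0^2 - v.Q0^2 : ℚ) : ℂ) = 0 := by exact_mod_cast c0
    have d1 : ((2*p*n1*n0 + s*n0^2 - 2*v.Q1*v.Q0 : ℚ) : ℂ) = 0 := by exact_mod_cast c1
    have d2 : ((p*n1^2 + 2*s*n1*n0 + n0^2 - v.Q1^2 - 2*v.Q2*v.Q0 : ℚ) : ℂ) = 0 := by exact_mod_cast c2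
    have d3 : ((s*n1^2 + 2*n1*n0 - 2*v.Q2*v.Q1 : ℚ) : ℂ) = 0 := by exact_mod_cast c3
    have d4 : ((n1^2 - v.Q2^2 : ℚ) : ℂ) = 0 := by exact_mod_cast c4
    push_cast at d0 d1 d2 d3 d4
    have : (v.Q w)^2 = 0 := by
      rw [KV.Q]
      linear_combination (n1*w + n0)^2*hw - d0 - w*d1 - w^2*d2 - w^3*d3 - w^4*d4
    exact pow_eq_zero_iff two_ne_zero |>.1 this
  obtain ⟨q0, q1⟩ := lin0 irr hw (x := v.Q0 - p*v.Q2) (y := v.Q1 - s*v.Q2) (by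
    rw [KV.Q] at hQw; push_cast; linear_combination hQw - v.Q2*hw)
  have ev3 : ∀ r : ℚ, (n1*r + n0)^2 = (r^2 + s*r + p)*v.Q2^2 := by
    intro r
    apply mul_left_cancel₀ (irr r)
    rw [ev2 r]
    have : v.Q0 + v.Q1*r + v.Q2*r^2 = (r^2 + s*r + p)*v.Q2 := by linear_combination q0 + r*q1
    rw [this]; ring
  have hnq : n1^2 = v.Q2^2 := by
    linear_combination (ev3 1) / 2 + ev3 (-1) / 2 - ev3 0
  have hn : n1 = 0 := by
    by_contra hne
    have := ev3 (-n0 / n1)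
    rw [mul_div_cancel₀ _ hne] at this
    rw [← hnq] at this
    rcases mul_eq_zero.1 (this.symm.trans (by ring : (-n0 + n0)^2 = 0)) with h | h
    · exact irr _ h
    · exact hne (pow_eq_zero_iff two_ne_zero |>.1 h)
  rw [hn] at hnq
  have hQ2 : v.Q2 = 0 := pow_eq_zero_iff two_ne_zero |>.1 (hnq.symm.trans (by ring))
  have hn00 : n0 = 0 := by
    have := ev3 0
    rw [hQ2] at this
    exact pow_eq_zero_iff two_ne_zero |>.1 (by linear_combination this : n0^2 = 0)
  have hP3 : v.P3 = 0 := by rw [← hn1, hn]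
  rw [hn00, hP3] at hn0 u1
  rw [hn00] at u0
  rw [hQ2] at q0 q1
  refine ⟨by linear_combination u0, by linear_combination u1, by linear_combination -hn0, hP3, by linear_combination q0, by linear_combination q1, hQ2⟩

lemma Sp.N0 {s p c d : ℚ} (h : Sp s p c d) : d^2 - s*c*d + p*c^2 ≠ 0 := by
  intro h0
  by_cases hc : c = 0
  · rcases h.nz with h1 | h1
    · exact h1 hc
    · rw [hc] at h0; exact h1 (pow_eq_zero_iff two_ne_zero |>.1 (by linear_combination h0))
  · apply h.irr (-d / c)
    field_simp
    linear_combination h0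

lemma Sp.rat {s p c d l : ℚ} (h : Sp s p c d) (v : KV) {w : ℂ} (hw : w^2 + s*w + p = 0) (hb : (c : ℂ)*w + d ≠ 0)
    (hl : v.P w*v.P w = l*(c*w + d)^2) : ∃ x y : ℚ, v.P w = (x + y*w)*(c*w + d) ∧ (y = 0 ∨ x = s / 2*y) ∧
      x^2 - p*y^2 = l := by
  obtain ⟨u0, u1, hu, -⟩ := P_red v hw
  have hN := h.N0
  obtain ⟨N, hN'⟩ : ∃ N, N = d^2 - s*c*d + p*c^2 := ⟨_, rfl⟩
  rw [← hN'] at hN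
  obtain ⟨x, hx⟩ : ∃ x, x*N = u0*(d - c*s) + p*c*u1 := ⟨_, div_mul_cancel₀ _ hN⟩
  obtain ⟨y, hy⟩ : ∃ y, y*N = u1*d - u0*c := ⟨_, div_mul_cancel₀ _ hN⟩
  have e0 : u0 = x*d - p*y*c := by
    apply mul_right_cancel₀ hN; linear_combination -d*hx + p*c*hy + u0*hN'
  have e1 : u1 = x*c + y*d - s*y*c := by
    apply mul_right_cancel₀ hN; linear_combination -c*hx + (s*c - d)*hy + u1*hN'
  have hP : v.P w = (x + y*w)*(c*w + d) := by
    rw [hu, e0, e1]; push_cast; linear_combination -y*c*hw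
  have h2 : ((x : ℂ) + y*w)^2 = l := by
    apply mul_right_cancel₀ (pow_ne_zero 2 hb)
    rw [← hl, hP]; ring
  obtain ⟨k0, k1⟩ := lin0 h.irr hw (x := x^2 - p*y^2 - l) (y := 2*x*y - s*y^2) (by
    push_cast; linear_combination h2 - y^2*hw)
  refine ⟨x, y, hP, ?_, by linear_combination k0⟩
  have : y*(x - s / 2*y) = 0 := by linear_combination k1 / 2
  rcases mul_eq_zero.1 this with h | h
  · exact Or.inl h
  · exact Or.inr (by linear_combination h)

end QP

namespace QP

lemma Sp.bne {s p c d : ℚ} (h : Sp s p c d) {w : ℂ} (hw : w^2 + s*w + p = 0) : (c : ℂ)*w + d ≠ 0 := by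
  intro h0
  obtain ⟨h1, h2⟩ := lin0 h.irr hw (x := d) (y := c) (by linear_combination h0)
  rcases h.nz with h | h
  · exact h h2
  · exact h h1

/-- a square root of the divisor, from a kernel vector with rational multiplier -/
lemma Sp.scale {s p c d l x : ℚ} (h : Sp s p c d) {v : KV} {w : ℂ} (hw : w^2 + s*w + p = 0)
    (hσ : v.P3 = v.Q2 ∨ v.P3 = -v.Q2) (hQ : v.Q2 ≠ 0) (hl : l ≠ 0) (hx : x^2 = l)
    (hP : v.P w = x*(c*w + d))
    (hpol : ∀ w : ℂ, v.P w*v.P w - (w^2 + s*w + p)*v.Q w*v.Q w = (8*w^5 + w^4 - 16*w^3 + 6*w^2 + w)*l) :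
    ∃ v : KV, v.P3 = v.Q2 ∧ v.Q2 ≠ 0 ∧ v.P w = c*w + d ∧
      ∀ w : ℂ, v.P w*v.P w - (w^2 + s*w + p)*v.Q w*v.Q w = (8*w^5 + w^4 - 16*w^3 + 6*w^2 + w) := by
  have hx0 : x ≠ 0 := by rintro rfl; exact hl (by rw [← hx]; ring)
  have hx0' : (x : ℂ) ≠ 0 := by exact_mod_cast hx0
  have hxl : (x : ℂ)^2 = l := by exact_mod_cast hx
  have hPw : ∀ w : ℂ, KV.P ⟨v.P0 / x, v.P1 / x, v.P2 / x, v.P3 / x, 0, 0, 0⟩ w = v.P w / x := by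
    intro w; simp only [KV.P]; push_cast; ring
  obtain ⟨e, he, hee⟩ : ∃ e : ℚ, e^2 = 1 ∧ v.P3 = e*v.Q2 := by
    rcases hσ with h | h
    · exact ⟨1, by norm_num, by rw [h]; ring⟩
    · exact ⟨-1, by norm_num, by rw [h]; ring⟩
  have he0 : e ≠ 0 := by rintro rfl; norm_num at he
  have he' : (e : ℂ)^2 = 1 := by exact_mod_cast he
  refine ⟨⟨v.P0 / x, v.P1 / x, v.P2 / x, v.P3 / x, e*v.Q0 / x, e*v.Q1 / x, e*v.Q2 / x⟩, ?_, ?_, ?_, ?_⟩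
  · dsimp only; rw [hee]
  · dsimp only; positivity
  · simp only [KV.P] at hP ⊢; push_cast; field_simp; linear_combination hP
  · intro w
    have := hpol w
    simp only [KV.P, KV.Q] at this ⊢
    push_cast
    field_simp
    rw [hxl]
    linear_combination this - (w^2 + s*w + p)*(v.Q0 + v.Q1*w + v.Q2*w^2)^2*he'

lemma Sp.half0 {s p c d : ℚ} (h : Sp s p c d) (hS : SS s p) {w : ℂ} (hw : w^2 + s*w + p = 0) : ∃ v : KV, v.P3 = v.Q2 ∧ v.Q2 ≠ 0 ∧
    v.P w = c*w + d ∧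
      ∀ w : ℂ, v.P w*v.P w - (w^2 + s*w + p)*v.Q w*v.Q w = (8*w^5 + w^4 - 16*w^3 + 6*w^2 + w) := by
  have hb := h.bne hw
  have hG : (8*w^5 + w^4 - 16*w^3 + 6*w^2 + w) = (c*w + d)^2 := by
    have := h.fac w
    rw [hw] at this
    linear_combination this
  obtain ⟨g0, g1, kb, kb'⟩ := hS.cb h
  obtain ⟨s0, k0⟩ := hS.c0
  obtain ⟨s1, k1⟩ := hS.c1
  obtain ⟨sm, km⟩ := hS.cm
  have km : 1 / 64 - s / 8 + p = (sm / 8)^2 := by linear_combination km / 64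
  have key : ∀ σ : ℚ, (σ = 1 ∨ σ = -1) → ∃ v : KV, Ker s0 s1 (sm / 8) g0 g1 v ∧ (v.P3 = σ*v.Q2) ∧ v.Q2 ≠ 0 ∧
      ∃ l : ℚ, l ≠ 0 ∧ ∀ w : ℂ, v.P w*v.P w - (w^2 + s*w + p)*v.Q w*v.Q w = (8*w^5 + w^4 - 16*w^3 + 6*w^2 + w)*l := by
    intro σ hσ
    obtain ⟨v, hv, h3, hnz⟩ := exKer s0 s1 (sm / 8) g0 g1 σ
    obtain ⟨l, hl⟩ := hv.pol hv k0 k1 km kb kb'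
    have h30 : (v.P3*v.P3 - v.Q2*v.Q2) / 8 = 0 := by
      rw [h3]; rcases hσ with rfl | rfl <;> ring
    rw [h30] at hl
    have hl' : ∀ w : ℂ, v.P w*v.P w - (w^2 + s*w + p)*v.Q w*v.Q w = (8*w^5 + w^4 - 16*w^3 + 6*w^2 + w)*l := by
      intro w; rw [hl w]; push_cast; ring
    have hl0 : l ≠ 0 := by
      rintro rfl
      exact hnz (Psq h.irr (fun w => by rw [hl' w]; push_cast; ring))
    refine ⟨v, hv, h3, ?_, l, hl0, hl'⟩
    intro hq
    rw [hq, mul_zero] at h3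
    apply hl0
    have f0 := hl' 0
    have f1 := hl' 1
    have f2 := hl' 2
    have f3 := hl' 3
    have f4 := hl' 4
    have f5 := hl' 5
    simp only [KV.P, KV.Q, hq, h3] at f0 f1 f2 f3 f4 f5
    push_cast at f0 f1 f2 f3 f4 f5
    have : (l : ℂ) = 0 := by
      linear_combination (-1/960)*f5 + (5/960)*f4 + (-10/960)*f3 + (10/960)*f2 + (-5/960)*f1 + (1/960)*f0
    exact_mod_cast this
  obtain ⟨v, hv, h3, hq, l, hl, hlv⟩ := key 1 (Or.inl rfl)
  obtain ⟨v', hv', h3', hq', l', hl', hlv'⟩ := key (-1) (Or.inr rfl)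
  obtain ⟨x, y, hx, hy, hxl⟩ := h.rat v (l := l) hw hb (by
    have := hlv w; rw [hw, hG] at this; linear_combination this)
  obtain ⟨x', y', hx', hy', hxl'⟩ := h.rat v' (l := l') hw hb (by
    have := hlv' w; rw [hw, hG] at this; linear_combination this)
  rcases hy with hy | hy
  · subst hy
    exact h.scale (x := x) hw (Or.inl (by rw [h3]; ring)) hq hl (by linear_combination hxl) (by rw [hx]; push_cast; ring) hlv
  rcases hy' with hy' | hy'
  · subst hy'
    exact h.scale (x := x') hw (Or.inr (by rw [h3']; ring)) hq' hl' (by linear_combination hxl') (by rw [hx']; push_cast; ring) hlv'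
  exfalso
  obtain ⟨L, hL⟩ := hv.pol hv' k0 k1 km kb kb'
  have e := hL w
  rw [hw, hG, hx, hx', h3, h3'] at e
  have e2 : ((x : ℂ) + y*w)*(x' + y'*w) = (((1*v.Q2)*(-1*v'.Q2) - v.Q2*v'.Q2) / 8 : ℚ)*w + L := by
    apply mul_left_cancel₀ (pow_ne_zero 2 hb)
    linear_combination e
  rw [hy, hy'] at e2
  push_cast at e2
  obtain ⟨-, k⟩ := lin0 h.irr hw (x := y*y'*(s^2 / 4 - p) - L) (y := v.Q2*v'.Q2 / 4) (by
    push_cast; linear_combination e2 - y*y'*hw)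
  have : v.Q2*v'.Q2 = 0 := by linear_combination 4*k
  exact mul_ne_zero hq hq' this

lemma der6 {s p s1 p1 c1 d1 m1 m0 : ℚ} (h : ∀ r : ℚ, ((m1*r + m0)*(r^2 + s1*r + p1) + (c1*r + d1))^2 - m1^2*(r^2 + s*r + p)*(r^2 + s1*r + p1)^2
      = 8*r^5 + r^4 - 16*r^3 + 6*r^2 + r) (r : ℚ) :
    2*((m1*r + m0)*(r^2 + s1*r + p1) + (c1*r + d1))*(m1*(r^2 + s1*r + p1) + (m1*r + m0)*(2*r + s1) + c1)
      - m1^2*(2*r + s)*(r^2 + s1*r + p1)^2 - 2*m1^2*(r^2 + s*r + p)*(r^2 + s1*r + p1)*(2*r + s1)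
      = 40*r^4 + 4*r^3 - 48*r^2 + 12*r + 1 := by
  linear_combination 45 / 60*(h (r + 1) - h (r - 1)) - 9 / 60*(h (r + 2) - h (r - 2)) + 1 / 60*(h (r + 3) - h (r - 3))

lemma Sp.half {s p c d : ℚ} (h : Sp s p c d) (hS : SS s p) : ∃ s1 p1 c1 d1 m1 m0 : ℚ, m1 ≠ 0 ∧ Sp s1 p1 c1 d1 ∧
    (∀ r : ℚ, ((m1*r + m0)*(r^2 + s1*r + p1) + (c1*r + d1))^2 - m1^2*(r^2 + s*r + p)*(r^2 + s1*r + p1)^2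
      = 8*r^5 + r^4 - 16*r^3 + 6*r^2 + r) ∧
    c = m0*s1 + m1*p1 + c1 - m1*p - (m0 + m1*s1 - m1*s)*s ∧
    d = m0*p1 + d1 - (m0 + m1*s1 - m1*s)*p := by
  obtain ⟨w, hw⟩ := exroot s p
  obtain ⟨v, h3, hq, hP, hpol⟩ := h.half0 hS hw
  obtain ⟨m1, hm1⟩ : ∃ m1, m1 = v.Q2 := ⟨_, rfl⟩
  rw [← hm1] at h3 hq
  obtain ⟨s1, hs1⟩ : ∃ s1, m1*s1 = v.Q1 := ⟨v.Q1 / m1, by field_simp⟩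
  obtain ⟨p1, hp1⟩ : ∃ p1, m1*p1 = v.Q0 := ⟨v.Q0 / m1, by field_simp⟩
  obtain ⟨m0, hm0⟩ : ∃ m0, m0 = v.P2 - m1*s1 := ⟨_, rfl⟩
  obtain ⟨c1, hc1⟩ : ∃ c1, c1 = v.P1 - m0*s1 - m1*p1 := ⟨_, rfl⟩
  obtain ⟨d1, hd1⟩ : ∃ d1, d1 = v.P0 - m0*p1 := ⟨_, rfl⟩
  have hr : ∀ r : ℂ, ((m1*r + m0)*(r^2 + s1*r + p1) + (c1*r + d1))^2 - m1^2*(r^2 + s*r + p)*(r^2 + s1*r + p1)^2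
      = 8*r^5 + r^4 - 16*r^3 + 6*r^2 + r := by
    intro r
    rw [← hpol r]
    simp only [KV.P, KV.Q]
    rw [h3, ← hs1, ← hp1, ← hm1, hd1, hc1, hm0]
    push_cast
    ring
  have hrQ : ∀ r : ℚ, ((m1*r + m0)*(r^2 + s1*r + p1) + (c1*r + d1))^2 - m1^2*(r^2 + s*r + p)*(r^2 + s1*r + p1)^2
      = 8*r^5 + r^4 - 16*r^3 + 6*r^2 + r := by
    intro r
    have := hr r
    exact_mod_cast this
  obtain ⟨f0, f1⟩ := lin0 h.irr hw (x := v.P0 - p*(v.P2 - s*v.P3) - d) (y := v.P1 - p*v.P3 - s*(v.P2 - s*v.P3) - c) (by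
    rw [KV.P] at hP; push_cast; linear_combination hP - (v.P3*w + (v.P2 - s*v.P3))*hw)
  refine ⟨s1, p1, c1, d1, m1, m0, hq, ?_, hrQ, ?_, ?_⟩
  · have irr1 : ∀ r : ℚ, r^2 + s1*r + p1 ≠ 0 := by
      intro r h0
      have e1 := hrQ r
      rw [h0] at e1
      have h2 := lemR (w := r) (z := (c1*r + d1)) (by linear_combination e1)
      have h4 : 8*r^5 + r^4 - 16*r^3 + 6*r^2 + r = 0 := by rcases h2 with rfl | rfl | rfl <;> norm_num
      have h5 : c1*r + d1 = 0 := pow_eq_zero_iff two_ne_zero |>.1 (by linear_combination e1 + h4 : (c1*r + d1)^2 = 0)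
      have h6 := der6 hrQ r
      rw [h0, h5] at h6
      rcases h2 with rfl | rfl | rfl <;> norm_num at h6
    obtain ⟨z, hz⟩ := exroot s1 p1
    have hrz := hr z
    rw [hz] at hrz
    obtain ⟨E0, E1⟩ := lin0 irr1 hz (x := 8*(s1^3*p1 - 2*s1*p1^2) + (-s1^2*p1 + p1^2) - 16*s1*p1 - 6*p1 - (d1^2 - p1*c1^2))
      (y := 8*(s1^4 - 3*s1^2*p1 + p1^2) + (-s1^3 + 2*s1*p1) - 16*(s1^2 - p1) - 6*s1 + 1 - (-s1*c1^2 + 2*c1*d1)) (by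
        push_cast
        linear_combination -hrz - (8*z^3 + (1 - 8*s1)*z^2 + (-16 - 8*p1 - s1 + 8*s1^2)*z
        + (6 - c1^2 - s1*(-16 - 8*p1 - s1 + 8*s1^2) - p1*(1 - 8*s1)))*hz)
    refine ⟨irr1, by linear_combination E1, by linear_combination E0, ?_⟩
    by_contra hcon
    push Not at hcon
    obtain ⟨hc0, hd0⟩ := hcon
    rw [hc0, hd0] at hrQ
    have t0 : m0^2 - m1^2*p = 0 := by
      apply mul_left_cancel₀ (pow_ne_zero 2 (irr1 0)); linear_combination hrQ 0
    have t1 : (m1 + m0)^2 - m1^2*(1 + s + p) = 0 := by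
      apply mul_left_cancel₀ (pow_ne_zero 2 (irr1 1)); linear_combination hrQ 1
    have t2 : (- m1 + m0)^2 - m1^2*(1 - s + p) = 0 := by linear_combination 2*t0 - t1
    have := hrQ (-1)
    have h7 : (-1 - s1 + p1 - s1*0 + 2)^2*((- m1 + m0)^2 - m1^2*(1 - s + p)) = 14 := by linear_combination this
    rw [t2] at h7
    norm_num at h7
  · rw [hc1]; rw [h3] at f1; linear_combination -f1 + s*hm0
  · rw [hd1]; rw [h3] at f0; linear_combination -f0 + p*hm0

end QP

namespace QP

def dR (s p x : ℚ) : ℚ := -1/2*s^2*x - 4*s*p^2 + 8*s*p - 1/2*s + p^2 + 2*p*x + 6*p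
def dE (s p x : ℚ) : ℚ := 4*s^3*x + 32*s^2*p^2 - 64*s^2*p + 12*s^2 - 8*s*p^2 - 24*s*p*x - 144*s*p + 8*s*x - s - 64*p^3 - 192*p^2 + 2*p*x - 124*p + x^2 + 6*x - 8
def dF (s p x : ℚ) : ℚ := 4*s^2*p*x + 32*s*p^3 - 64*s*p^2 - 12*s*p + 1/2*s*x^2 - 8*p^3 - 12*p^2*x - 8*p*x + p + 1/2*x

set_option maxHeartbeats 2000000 in
lemma dblid {s p x : ℚ} (h : ZK 1 s p x = 0) :
    Z1 1 s p x^2*p^2 + (Z1 1 s p x*s^2 - 2*(16*dR s p x^2 - Z2 1 s p x / 2)*s + Z3 1 s p x - 4*dR s p x*dE s p x)*Z3 1 s p x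
      - 2*(Z1 1 s p x*s - (16*dR s p x^2 - Z2 1 s p x / 2) + 32*dR s p x^2)*((16*dR s p x^2 - Z2 1 s p x / 2)*p + 2*dR s p x*dF s p x)
      = dR s p x^2*Z4 1 s p x := by
  rw [ZK] at h
  simp only [Z1, Z2, Z3, Z4, dR, dE, dF]
  linear_combination (16*s^6 + 96*s^5*p*x - 384*s^5*p - 4*s^5*x^3 - 8*s^5 + 768*s^4*p^3 - 64 *
      s^4*p^2*x^2 - 384*s^4*p^2*x + 1280*s^4*p^2 + 192*s^4*p*x^2 - 48*s^4
      * p*x + 128*s^4*p + s^4*x^3 - 56*s^4*x^2 + 65*s^4 - 256*s^3*p^4*x - 3072 *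
      s^3*p^4 + 1536*s^3*p^3*x + 11840*s^3*p^3 + 32*s^3*p^2*x^2 - 4256*s^3 *
      p^2*x + 896*s^3*p^2 + 28*s^3*p*x^3 - 144*s^3*p*x^2 + 2182*s^3*p*x -
      1544*s^3*p + 8*s^3*x^3 + 2*s^3*x^2 - 72*s^3*x + 112*s^3 + 192*s^2*p^4
      * x - 8960*s^2*p^4 + 224*s^2*p^3*x^2 - 1152*s^2*p^3*x + 21584*s^2*p^3 -
      1092*s^2*p^2*x^2 + 2680*s^2*p^2*x - 10416*s^2*p^2 - 3*s^2*p*x^3 + 172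
      * s^2*p*x^2 + 800*s^2*p*x - 896*s^2*p - 1/4*s^2*x^4 + 12*s^2*x^3 + 16 *
      s^2*x^2 - 2*s^2*x - 6192*s*p^4*x - 20032*s*p^4 - 64*s*p^3*x^2 + 15904*s
      * p^3*x + 33276*s*p^3 - 68*s*p^2*x^3 + 192*s*p^2*x^2 + 3314*s*p^2*x -
      8736*s*p^2 - 8*s*p*x^3 - 587*s*p*x^2 + 320*s*p*x - 5/2*s*x^3 + 24*s*x ^
      2 - 32*s*x - 256*p^4*x^2 + 1540*p^4*x + 5616*p^4 + 1538*p^3*x^2 + 14632*p^3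
      * x + 15232*p^3 - 3*p^2*x^3 - 748*p^2*x^2 + 1760*p^2*x - 5/2*p*x^4 - 42*p *
      x^3 - 352*p*x^2 + 384*p*x - 4*x^2)*h

lemma Sp.cd {s p c d : ℚ} (h : Sp s p c d) : c^2 = kap s p c + 6 + 16*s + s^2 - 8*s^3 + 8*s*p ∧
    c*d = -8*s^2*p + s*p + s*kap s p c / 2 + 4*p^2 + 8*p + 1 / 2 ∧
    d^2 = -8*s*p^2 + p^2 + p*kap s p c := by
  have h1 := h.E1
  have h0 := h.E0
  rw [kap]
  exact ⟨by ring, by linear_combination -h1 / 2, by linear_combination -h0⟩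

lemma Sp.ZK0 {s p c d : ℚ} (h : Sp s p c d) : ZK 1 s p (kap s p c) = 0 := by
  obtain ⟨h1, h2, h3⟩ := h.cd
  generalize kap s p c = x at *
  have : 4*(c^2*d^2) = 4*(c*d)^2 := by ring
  rw [h1, h2, h3] at this
  rw [ZK]
  linear_combination this

def Dbl (s1 p1 x1 s p x : ℚ) : Prop := Z1 1 s1 p1 x1 ≠ 0 ∧ s*Z1 1 s1 p1 x1 = -Z2 1 s1 p1 x1 ∧ p*Z1 1 s1 p1 x1 = Z3 1 s1 p1 x1 ∧
  4*x*Z1 1 s1 p1 x1 = Z4 1 s1 p1 x1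

lemma Dbl.sd {s1 p1 x1 s p x s2 p2 x2 : ℚ} (h : Dbl s1 p1 x1 s p x) (h2 : SD s1 p1 x1 s2 p2 x2) : Dbl s2 p2 x2 s p x := by
  obtain ⟨k1, k2, k3, k4⟩ := h
  obtain ⟨t, ht, l1, l2, l3, l4⟩ := h2
  refine ⟨?_, ?_, ?_, ?_⟩
  · rw [l1]; exact mul_ne_zero ht k1
  · rw [l1, l2]; linear_combination t*k2
  · rw [l1, l3]; linear_combination t*k3
  · rw [l1, l4]; linear_combination t*k4

/-- computing with the doubling data -/
lemma dbl_core {s p c d x m1 m0 S P X : ℚ} (hm : m1 ≠ 0) (hR : d^2 - s*c*d + p*c^2 ≠ 0)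
    (hK : ZK 1 s p x = 0)
    (hcc : c^2 = x + 6 + 16*s + s^2 - 8*s^3 + 8*s*p)
    (hcd : c*d = -8*s^2*p + s*p + s*x / 2 + 4*p^2 + 8*p + 1 / 2)
    (hdd : d^2 = -8*s*p^2 + p^2 + p*x)
    (e1 : 2*m1*(d - s*c) + 2*m0*c = 24*s^2 - 2*s - 16*p - 16)
    (e0 : 2*m0*d - 2*p*m1*c = - x + 24*s*p - 2*p)
    (hS : m1^2*S = 2*m1*m0 - 8)
    (hP : m1^2*P = m0^2 + 2*m1*c - 1 + 16*s)
    (hX : m1^2*X = m1^4*p^2 + ((m1*s - m0)^2 + 16*s - 1)*(m0^2 + 2*m1*c - 1 + 16*s)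
      - 2*m1*(m1^2*s - m0*m1 + 8)*(m0*p + d)) : Dbl s p x S P X := by
  have hRR : d^2 - s*c*d + p*c^2 = dR s p x := by
    rw [dR]; linear_combination hdd - s*hcd + p*hcc
  rw [hRR] at hR
  have hN1 : 2*dR s p x*m1 = (24*s^2 - 2*s - 16*p - 16)*d - (- x + 24*s*p - 2*p)*c := by
    rw [← hRR, ← e1, ← e0]; ring
  have hN0 : 2*dR s p x*m0 = (d - s*c)*(- x + 24*s*p - 2*p) + p*c*(24*s^2 - 2*s - 16*p - 16) := by
    rw [← hRR, ← e1, ← e0]; ring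
  have hE : 2*dR s p x*m1*c = dE s p x := by
    rw [hN1, dE]
    linear_combination (24*s^2 - 2*s - 16*p - 16)*hcd - (- x + 24*s*p - 2*p)*hcc
  have hF : 2*dR s p x*m1*d = dF s p x := by
    rw [hN1, dF]
    linear_combination (24*s^2 - 2*s - 16*p - 16)*hdd - (- x + 24*s*p - 2*p)*hcd
  obtain ⟨f0, hf0⟩ : ∃ f0, f0 = - x + 24*s*p - 2*p := ⟨_, rfl⟩
  obtain ⟨f1, hf1⟩ : ∃ f1, f1 = 24*s^2 - 2*s - 16*p - 16 := ⟨_, rfl⟩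
  have hA : (2*dR s p x*m1)^2 = Z1 1 s p x := by
    rw [hN1, ← hf0, ← hf1]
    have : (f1*d - f0*c)^2 = f1^2*d^2 - 2*f1*f0*(c*d) + f0^2*c^2 := by ring
    rw [this, hdd, hcd, hcc, hf0, hf1, Z1]
    rw [ZK] at hK
    linear_combination (-16*s)*hK
  have hB : 2*((2*dR s p x*m1)*(2*dR s p x*m0)) = 32*dR s p x^2 - Z2 1 s p x := by
    rw [hN1, hN0, ← hf0, ← hf1]
    have : (f1*d - f0*c)*((d - s*c)*f0 + p*c*f1) = f1*f0*(d^2 - s*(c*d)) + f1^2*p*(c*d)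
      - f0^2*(c*d - s*c^2) - f0*f1*p*c^2 := by ring
    rw [this, hdd, hcd, hcc, hf0, hf1, Z2, dR]
    rw [ZK] at hK
    linear_combination (-32*p)*hK
  have hC : (2*dR s p x*m0)^2 + 4*dR s p x*dE s p x - 4*dR s p x^2*(1 - 16*s) = Z3 1 s p x := by
    rw [hN0, ← hf0, ← hf1]
    have : ((d - s*c)*f0 + p*c*f1)^2 = f0^2*(d^2 - 2*s*(c*d) + s^2*c^2) + 2*p*f0*f1*(c*d - s*c^2)
      + p^2*f1^2*c^2 := by ring
    rw [this, hdd, hcd, hcc, hf0, hf1, Z3, dR, dE]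
    rw [ZK] at hK
    linear_combination (2*x)*hK
  have hid := dblid hK
  rw [Dbl]
  generalize dR s p x = R at *
  generalize dE s p x = E at *
  generalize dF s p x = F at *
  generalize Z1 1 s p x = z1 at *
  generalize Z2 1 s p x = z2 at *
  generalize Z3 1 s p x = z3 at *
  generalize Z4 1 s p x = z4 at *
  clear hcc hcd hdd e1 e0 hN1 hN0 hRR hf0 hf1 hK
  refine ⟨?_, ?_, ?_, ?_⟩
  · rw [← hA]; positivity
  · linear_combination -S*hA + 4*R^2*hS + hB
  · linear_combination -P*hA + 4*R^2*hP + hC + 4*R*hE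
  · have hz2 : z2 = 32*R^2 - 2*((2*R*m1)*(2*R*m0)) := by linear_combination hB
    subst hE; subst hF; subst hA; subst hC; subst hz2
    apply mul_left_cancel₀ (pow_ne_zero 2 hR)
    linear_combination hid + 16*R^4*hX

lemma Sp.dbl {s p c d s1 p1 c1 d1 m1 m0 : ℚ} (h : Sp s p c d) (hm : m1 ≠ 0) (h1 : Sp s1 p1 c1 d1)
    (hr : ∀ r : ℚ, ((m1*r + m0)*(r^2 + s1*r + p1) + (c1*r + d1))^2 - m1^2*(r^2 + s*r + p)*(r^2 + s1*r + p1)^2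
      = 8*r^5 + r^4 - 16*r^3 + 6*r^2 + r)
    (hc : c = m0*s1 + m1*p1 + c1 - m1*p - (m0 + m1*s1 - m1*s)*s)
    (hd : d = m0*p1 + d1 - (m0 + m1*s1 - m1*s)*p) : Dbl s1 p1 (kap s1 p1 c1) s p (kap s p c) := by
  obtain ⟨hcc, hcd, hdd⟩ := h1.cd
  obtain ⟨k0, k1, k2, k3, -⟩ := quart0 (c0 := m0^2*p1 + 2*m0*d1 - m1^2*p*p1 - (-kap s1 p1 c1 - p1 + 8*s1*p1))
    (c1 := m0^2*s1 + 2*m1*m0*p1 + 2*(m1*d1 + m0*c1) - m1^2*(s*p1 + p*s1) - (-16 - 8*p1 - s1 + 8*s1^2))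
    (c2 := m0^2 + 2*m1*m0*s1 + m1^2*p1 + 2*m1*c1 - m1^2*(p + s*s1 + p1) - (1 - 8*s1))
    (c3 := 2*m1*m0 + m1^2*s1 - m1^2*(s1 + s) - 8) (c4 := 0) (by
      intro r
      apply mul_left_cancel₀ (h1.irr r)
      have := h1.fac r
      simp only [Rat.cast_id] at this
      rw [kap]
      linear_combination hr r + this)
  have hS : m1^2*s = 2*m1*m0 - 8 := by linear_combination -k3
  have hP : m1^2*p = m0^2 + 2*m1*c1 - 1 + 16*s1 := by linear_combination -k2 + s1*k3
  refine dbl_core (m1 := m1) (m0 := m0) hm h1.N0 h1.ZK0 hcc hcd hdd ?_ ?_ hS hP ?_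
  · linear_combination k1 + p1*hS + s1*hP
  · linear_combination k0 + p1*hP
  · obtain ⟨_, _, hdd2⟩ := h.cd
    obtain ⟨n0, hn0⟩ : ∃ n0, n0 = m0 + m1*s1 - m1*s := ⟨_, rfl⟩
    rw [← hn0] at hd
    have hr0 := hr 0
    have hp0 := h.p0
    generalize kap s p c = X at *
    have hX : X = m1^2*p1^2 + n0^2*p - 2*n0*(m0*p1 + d1) - p + 8*s*p := by
      apply mul_left_cancel₀ hp0
      linear_combination -hdd2 + hr0 + (d + m0*p1 + d1 - n0*p)*hd
    have hn : m1*n0 = m1^2*s1 - m0*m1 + 8 := by rw [hn0]; linear_combination -hS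
    apply mul_left_cancel₀ (pow_ne_zero 2 hm)
    have e1 : m1^2*(m1^2*X) = m1^6*p1^2 + (m1*n0)^2*(m1^2*p) - 2*m1^3*(m1*n0)*(m0*p1 + d1)
      - m1^2*(m1^2*p) + 8*(m1^2*s)*(m1^2*p) := by rw [hX]; ring
    rw [e1, hn, hS, hP]
    ring

lemma Sp.halve {s p c d : ℚ} (h : Sp s p c d) (hS : SS s p) : ∃ s1 p1 c1 d1, Sp s1 p1 c1 d1 ∧ SS s1 p1 ∧
    Dbl s1 p1 (kap s1 p1 c1) s p (kap s p c) := by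
  obtain ⟨s1, p1, c1, d1, m1, m0, hm, h1, hr, hc, hd⟩ := h.half hS
  have hD := h.dbl hm h1 hr hc hd
  obtain ⟨s2, p2, c2, d2, h2, hS2, hSD⟩ := h1.toSS
  exact ⟨s2, p2, c2, d2, h2, hS2, hD.sd hSD⟩
end QP

namespace QP

lemma oddval : ∀ (v : ℕ) (O y : ℤ), O % 2 = 1 → 2^v*O = y^2 → v % 2 = 0 ∧ ∃ z, O = z^2 := by
  intro v
  induction v using Nat.strong_induction_on with
  | _ v ih =>
    intro O y hO h
    match v, ih, h with
    | 0, _, h => exact ⟨rfl, y, by linear_combination h⟩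
    | 1, _, h =>
      exfalso
      rcases sqm4 y with h2 | h2 <;> omega
    | v + 2, ih, h =>
      have h4 : 2 ∣ y^2 := ⟨2^(v + 1)*O, by rw [← h]; ring⟩
      obtain ⟨z, rfl⟩ := Int.prime_two.dvd_of_dvd_pow h4
      obtain ⟨h1, h2⟩ := ih v (by omega) O z hO (by
        apply mul_left_cancel₀ (show (4 : ℤ) ≠ 0 by norm_num)
        linear_combination h)
      exact ⟨by omega, h2⟩

lemma val2 {T : ℤ} (hT : T ≠ 0) : ∃ (v : ℕ) (O : ℤ), T = 2^v*O ∧ O % 2 = 1 := by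
  have : FiniteMultiplicity 2 T := Int.finiteMultiplicity_iff.2 ⟨by decide, hT⟩
  obtain ⟨O, h1, h2⟩ := this.exists_eq_pow_mul_and_not_dvd
  exact ⟨_, O, h1, by omega⟩

lemma gdvd {R : ℤ → ℤ → ℤ → ℤ → ℤ} (hR : R = Z1 ∨ R = Z2 ∨ R = Z3) (q a b c x : ℤ) : q ∣ R (q*a) (q*b) (q*c) x := by
  have ha : q*a ≡ 0 [ZMOD q] := (Int.modEq_zero_iff_dvd).2 ⟨a, rfl⟩
  have hb : q*b ≡ 0 [ZMOD q] := (Int.modEq_zero_iff_dvd).2 ⟨b, rfl⟩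
  have hc : q*c ≡ 0 [ZMOD q] := (Int.modEq_zero_iff_dvd).2 ⟨c, rfl⟩
  apply (Int.modEq_zero_iff_dvd).1
  generalize q*a = a' at *
  generalize q*b = b' at *
  generalize q*c = c' at *
  have : R a' b' c' x ≡ R 0 0 0 x [ZMOD q] := by
    rcases hR with rfl | rfl | rfl
    · unfold Z1; gcongr
    · unfold Z2; gcongr
    · unfold Z3; gcongr
  refine this.trans ?_
  rcases hR with rfl | rfl | rfl <;> simp [Z1, Z2, Z3] <;> rfl

end QP

namespace QP

def Dp (n : ℕ) (s p κ : ℚ) : Prop := ∃ a b c k : ℤ, k % 2 = 1 ∧ a ≠ 0 ∧ κ*(2^n*a) = k ∧ s*a = b ∧ p*a = c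

lemma Dp.dbl {n : ℕ} {s1 p1 x1 s p x : ℚ} (h : Dp n s1 p1 x1) (hd : Dbl s1 p1 x1 s p x) : Dp (n + 2) s p x := by
  obtain ⟨a, b, c, k, hk, ha, h1, h2, h3⟩ := h
  obtain ⟨e1, e2, e3, e4⟩ := hd
  obtain ⟨z1, hz1⟩ := gdvd (Or.inl rfl) (2^n) a b c k
  obtain ⟨z2, hz2⟩ := gdvd (Or.inr (Or.inl rfl)) (2^n) a b c k
  obtain ⟨z3, hz3⟩ := gdvd (Or.inr (Or.inr rfl)) (2^n) a b c k
  have hq : (2^n : ℚ) ≠ 0 := by positivity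
  have haq : (a : ℚ) ≠ 0 := by exact_mod_cast ha
  have f1 : (2^n : ℚ)*z1 = (2^n*a)^4*Z1 1 s1 p1 x1 := by
    have := congrArg (Int.cast : ℤ → ℚ) hz1
    simp only [Z1] at this
    push_cast at this
    rw [← this, ← h1, ← h2, ← h3, Z1]; ring
  have f2 : (2^n : ℚ)*z2 = (2^n*a)^4*Z2 1 s1 p1 x1 := by
    have := congrArg (Int.cast : ℤ → ℚ) hz2
    simp only [Z2] at this
    push_cast at this
    rw [← this, ← h1, ← h2, ← h3, Z2]; ring
  have f3 : (2^n : ℚ)*z3 = (2^n*a)^4*Z3 1 s1 p1 x1 := by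
    have := congrArg (Int.cast : ℤ → ℚ) hz3
    simp only [Z3] at this
    push_cast at this
    rw [← this, ← h1, ← h2, ← h3, Z3]; ring
  have f4 : ((Z4 (2^n*a) (2^n*b) (2^n*c) k : ℤ) : ℚ) = (2^n*a)^4*Z4 1 s1 p1 x1 := by
    simp only [Z4]
    push_cast
    rw [← h1, ← h2, ← h3]; ring
  refine ⟨z1, -z2, z3, Z4 (2^n*a) (2^n*b) (2^n*c) k, ?_, ?_, ?_, ?_, ?_⟩
  · generalize (2:ℤ)^n*a = a'
    generalize (2:ℤ)^n*b = b'
    generalize (2:ℤ)^n*c = c'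
    have h : Z4 a' b' c' k % 2 = k^4 % 2 := by
      apply Int.ModEq.symm
      apply (Int.modEq_iff_dvd).2
      rw [Z4]
      refine ⟨32*b'^4 + 1024*b'^2*c'^2 + 3456*a'*b'^2*c' - 108*b'^2*k^2 + 128*a'^2*b'^2 + 256*b'*c'^3 - 1344*b'*c'^2*k - 20736*a'*b'*c'^2 + 3712*a'*b'*c'*k - 432*a'^2*b'*c' - 168*a'^2*b'*k + 192*a'^3*b' - 1536*c'^3*k - 25600*a'*c'^3 + 128*c'^2*k^2 + 432*a'*c'^2*k - 26400*a'^2*c'^2 + 432*a'*c'*k^2 + 2592*a'^2*c'*k - 3200*a'^3*c' + 16*a'^2*k^2 - 4*a'^3*k, ?_⟩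
      ring
    rw [h]
    exact Int.odd_iff.1 ((Int.odd_iff.2 hk).pow)
  · rintro rfl
    have : (2^n*(a:ℚ))^4*Z1 1 s1 p1 x1 ≠ 0 := by positivity
    apply this
    rw [← f1]; simp
  · rw [f4, ← e4, pow_add]
    linear_combination 4*x*f1
  · push_cast
    apply mul_left_cancel₀ hq
    linear_combination s*f1 + (2^n*(a:ℚ))^4*e2 + f2
  · apply mul_left_cancel₀ hq
    linear_combination p*f1 + (2^n*(a:ℚ))^4*e3 - f3

lemma Dp.unb {κ : ℚ} (h : ∀ n, ∃ s p, Dp (2*n) s p κ) : False := by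
  obtain ⟨s, p, a, b, c, k, hk, ha, h1, -, -⟩ := h κ.den
  have hd := κ.den_ne_zero
  have hq : κ = κ.num / κ.den := (Rat.num_div_den κ).symm
  have h2 : κ.num*(2^(2*κ.den)*a) = k*κ.den := by
    have : (κ.num : ℚ)*(2^(2*κ.den)*a) = k*κ.den := by
      rw [← h1]
      have : (κ.num : ℚ) = κ*κ.den := (Rat.mul_den_eq_num κ).symm
      rw [this]; ring
    exact_mod_cast this
  have h3 : (2:ℤ)^(2*κ.den) ∣ k*κ.den := ⟨κ.num*a, by rw [← h2]; ring⟩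
  have hc : IsCoprime ((2:ℤ)^(2*κ.den)) k := by
    apply IsCoprime.pow_left
    exact ⟨-(k / 2), 1, by omega⟩
  have h4 := hc.dvd_of_dvd_mul_left h3
  have h5 := Int.le_of_dvd (by positivity) h4
  have h6 : (κ.den : ℤ) < 2^κ.den := by exact_mod_cast Nat.lt_two_pow_self
  have h7 : (2:ℤ)^κ.den ≤ 2^(2*κ.den) := by gcongr <;> omega
  omega

lemma prim4 (s p x : ℚ) : ∃ T S P X : ℤ, T ≠ 0 ∧ (T:ℚ)*s = S ∧ (T:ℚ)*p = P ∧ (T:ℚ)*x = X ∧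
    ¬ (T % 2 = 0 ∧ S % 2 = 0 ∧ P % 2 = 0 ∧ X % 2 = 0) := by
  have key : ∀ n : ℕ, ∀ T S P X : ℤ, T.natAbs = n → T ≠ 0 → (T:ℚ)*s = S → (T:ℚ)*p = P → (T:ℚ)*x = X →
      ∃ T S P X : ℤ, T ≠ 0 ∧ (T:ℚ)*s = S ∧ (T:ℚ)*p = P ∧ (T:ℚ)*x = X ∧
    ¬ (T % 2 = 0 ∧ S % 2 = 0 ∧ P % 2 = 0 ∧ X % 2 = 0) := by
    intro n
    induction n using Nat.strong_induction_on with
    | _ n ih =>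
      intro T S P X hn h0 h1 h2 h3
      by_cases hh : T % 2 = 0 ∧ S % 2 = 0 ∧ P % 2 = 0 ∧ X % 2 = 0
      · obtain ⟨g1, g2, g3, g4⟩ := hh
        obtain ⟨T, rfl⟩ := Int.dvd_of_emod_eq_zero g1
        obtain ⟨S, rfl⟩ := Int.dvd_of_emod_eq_zero g2
        obtain ⟨P, rfl⟩ := Int.dvd_of_emod_eq_zero g3
        obtain ⟨X, rfl⟩ := Int.dvd_of_emod_eq_zero g4
        push_cast at h1 h2 h3
        exact ih T.natAbs (by omega) T S P X rfl (by omega) (by linarith) (by linarith) (by linarith)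
      · exact ⟨T, S, P, X, h0, h1, h2, h3, hh⟩
  obtain ⟨m, hm, hl⟩ := clr [s, p, x]
  obtain ⟨S, hS⟩ := hl s (by simp)
  obtain ⟨P, hP⟩ := hl p (by simp)
  obtain ⟨X, hX⟩ := hl x (by simp)
  exact key _ m S P X rfl hm hS hP hX

end QP

namespace QP

lemma om {a b : ℤ} (ha : a % 2 = 1) (hb : b % 2 = 1) : (a*b) % 2 = 1 := by
  rw [Int.mul_emod, ha, hb]; rfl

lemma osq {a z : ℤ} (ha : a % 2 = 1) (h : a = z^2) : a % 8 = 1 := by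
  have hz : z % 2 = 1 := by
    rcases Int.emod_two_eq_zero_or_one z with h0 | h0
    · exfalso
      obtain ⟨w, rfl⟩ := Int.dvd_of_emod_eq_zero h0
      have : a = 2*(2*w^2) := by rw [h]; ring
      omega
    · exact h0
  rw [h]; exact odd_sq8 hz

lemma base_S {T S P : ℤ} (hT : T ≠ 0) (hP : P ≠ 0) (h0 : ∃ y, T*P = y^2) (h1 : ∃ y, T*(T + S + P) = y^2)
    (h2 : ∃ y, T*(T - 8*S + 64*P) = y^2) (hS : S % 2 = 1) (hTe : T % 2 = 0) : False := by
  obtain ⟨v, O, rfl, hO⟩ := val2 hT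
  obtain ⟨u, O', rfl, hO'⟩ := val2 hP
  obtain ⟨y0, h0⟩ := h0
  obtain ⟨y1, h1⟩ := h1
  obtain ⟨y2, h2⟩ := h2
  have h3 := (oddval (v + u) (O*O') y0 (om hO hO') (by rw [← h0]; ring)).1
  rcases Nat.even_or_odd' v with ⟨w, rfl | rfl⟩
  · match w with
    | 0 => simp at hTe; omega
    | 1 =>
      have ho : (O*(O - 2*S + 16*(2^u*O'))) % 2 = 1 := om hO (by omega)
      obtain ⟨-, z, hz⟩ := oddval 4 (O*(O - 2*S + 16*(2^u*O'))) y2 ho (by rw [← h2]; ring)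
      have h8 := osq ho hz
      have hO2 : O*O % 2 = 1 := om hO hO
      have hO3 : (O*O) % 8 = 1 := osq hO2 (sq O).symm
      have hOS : (O*S) % 2 = 1 := om hO hS
      have e : O*(O - 2*S + 16*(2^u*O')) = O*O - 2*(O*S) + 16*(O*(2^u*O')) := by ring
      rw [e] at h8
      omega
    | w + 2 =>
      have ho : (O*(2*(2^(2*w)*O) - S + 8*(2^u*O'))) % 2 = 1 := om hO (by omega)
      have := (oddval (2*(w + 2) + 3) _ y2 ho (by rw [← h2]; ring)).1
      omega
  · have hu : ∃ u', u = u' + 1 := ⟨u - 1, by omega⟩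
    obtain ⟨u, rfl⟩ := hu
    have ho : (O*(2*(2^(2*w)*O) + S + 2*(2^u*O'))) % 2 = 1 := om hO (by omega)
    have := (oddval (2*w + 1) _ y1 ho (by rw [← h1]; ring)).1
    omega

lemma base_P4 {u S P X : ℤ} (hu : u % 2 = 1) (hP : P % 2 = 1) (hS : S % 2 = 1) (hK : ZK (4*u) (4*S) P (2*X) = 0)
    (h : ∃ y, (4*u)*(-8*(4*S)*P^2 + (4*u)*P^2 + (4*u)*P*(2*X)) = y^2) : False := by
  have hXe : X % 2 = 0 := by
    rcases Int.emod_two_eq_zero_or_one X with h0 | h0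
    · exact h0
    exfalso
    have e : ∃ w, u*(P*P)*X + 2*w = 0 := by
      refine ⟨32*u*S^2*P - S^2*X^2 - 2*S*P^2*X - 48*u*S*P^2 + 16*u*S*P*X - 4*u^2*S*P - 4*u^2*S*X - P^4 - 16*u*P^3
        - 62*u^2*P^2 + u*P*X^2 + 12*u^2*P*X - 32*u^3*P - 4*u^4, ?_⟩
      apply mul_left_cancel₀ (show (32:ℤ) ≠ 0 by norm_num)
      rw [ZK] at hK
      linear_combination hK
    obtain ⟨w, hw⟩ := e
    have := om (om hu (om hP hP)) h0
    omega
  obtain ⟨x, rfl⟩ := Int.dvd_of_emod_eq_zero hXe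
  have hPP : P*P % 8 = 1 := osq (om hP hP) (sq P).symm
  have huu : u*u % 8 = 1 := osq (om hu hu) (sq u).symm
  have hxo : x % 2 = 1 := by
    rcases Int.emod_two_eq_zero_or_one x with h0 | h0
    · exfalso
      have e : ∃ w, (P*P)*(P*P) + 2*w = u*(P*P)*x := by
        refine ⟨31*u^2*P^2 - (16*u*S^2*P - 2*S^2*x^2 - 2*S*P^2*x - 24*u*S*P^2 + 16*u*S*P*x - 2*u^2*S*P - 4*u^2*S*x - 8*u*P^3
          + 2*u*P*x^2 + 12*u^2*P*x - 16*u^3*P - 2*u^4), ?_⟩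
        apply mul_left_cancel₀ (show (64:ℤ) ≠ 0 by norm_num)
        rw [ZK] at hK
        linear_combination -hK
      obtain ⟨w, hw⟩ := e
      have := om (om hP hP) (om hP hP)
      obtain ⟨x, rfl⟩ := Int.dvd_of_emod_eq_zero h0
      have e2 : u*(P*P)*(2*x) = 2*(u*(P*P)*x) := by ring
      omega
    · exact h0
  obtain ⟨y, hy⟩ := h
  have e : 2^4*((u*u)*(P*P) + 4*(u*u*P*x) - 8*(S*u*P^2)) = y^2 := by
    rw [← hy]; ring
  have h5 := om (om (om hu hu) hP) hxo
  have h6 : (u*u)*(P*P) % 8 = 1 := by rw [Int.mul_emod, huu, hPP]; rfl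
  have ho : ((u*u)*(P*P) + 4*(u*u*P*x) - 8*(S*u*P^2)) % 2 = 1 := by omega
  obtain ⟨-, z, hz⟩ := oddval 4 _ y ho e
  have := osq ho hz
  omega

lemma base_P {T S P X : ℤ} (hT : T ≠ 0) (hK : ZK T S P (2*X) = 0) (h0 : ∃ y, T*P = y^2) (h1 : ∃ y, T*(T + S + P) = y^2)
    (h3 : ∃ y, T*(-8*S*P^2 + T*P^2 + T*P*(2*X)) = y^2) (hP : P % 2 = 1) (hS : S % 2 = 0) (hTe : T % 2 = 0) : False := by
  obtain ⟨v, O, rfl, hO⟩ := val2 hT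
  obtain ⟨y0, h0⟩ := h0
  obtain ⟨y1, h1⟩ := h1
  have k1 := om hO hP
  obtain ⟨g1, z, hz⟩ := oddval v (O*P) y0 k1 (by rw [← h0]; ring)
  have k2 := osq k1 hz
  have k3 : (O*(2^v*O + S + P)) % 2 = 1 := om hO (by omega)
  obtain ⟨-, z', hz'⟩ := oddval v _ y1 k3 (by rw [← h1]; ring)
  have k4 := osq k3 hz'
  have k5 : (8:ℤ) ∣ O*(2^v*O + S) := by
    have : O*(2^v*O + S + P) = O*(2^v*O + S) + O*P := by ring
    omega
  have k6 : (8:ℤ) ∣ 2^v*O + S := by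
    have hc : IsCoprime ((2:ℤ)^3) O := by
      apply IsCoprime.pow_left
      exact ⟨-(O / 2), 1, by omega⟩
    norm_num at hc
    exact hc.dvd_of_dvd_mul_left k5
  rcases Nat.even_or_odd' v with ⟨w, rfl | rfl⟩
  · match w with
    | 0 => simp at hTe; omega
    | 1 =>
      norm_num at k6
      have : (4:ℤ) ∣ S := by omega
      obtain ⟨S, rfl⟩ := this
      norm_num at hK h3
      exact base_P4 hO hP (by omega) hK (by simpa using h3)
    | w + 2 =>
      have e : (2:ℤ)^(2*(w + 2))*O = 16*(2^(2*w)*O) := by ring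
      rw [e] at k6 hK
      generalize (2:ℤ)^(2*w)*O = t at *
      have : (8:ℤ) ∣ S := by omega
      obtain ⟨S, rfl⟩ := this
      have e : ∃ w, P*P*(P*P) = 2*w := by
        refine ⟨256*t*S^2*P - 2*S^2*X^2 - 2*S*P^2*X - 192*t*S*P^2 + 64*t*S*P*X - 64*t^2*S*P - 64*t^2*S*X - 32*t*P^3
          + t*P^2*X - 496*t^2*P^2 + 2*t*P*X^2 + 96*t^2*P*X - 1024*t^3*P - 512*t^4, ?_⟩
        apply mul_left_cancel₀ (show (64:ℤ) ≠ 0 by norm_num)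
        rw [ZK] at hK
        linear_combination -hK
      obtain ⟨w, hw⟩ := e
      have := om (om hP hP) (om hP hP)
      omega
  · omega

lemma base_int {T S P X : ℤ} (hT : T ≠ 0) (hP : P ≠ 0) (hK : ZK T S P X = 0) (h0 : ∃ y, T*P = y^2) (h1 : ∃ y, T*(T + S + P) = y^2)
    (h2 : ∃ y, T*(T - 8*S + 64*P) = y^2) (h3 : ∃ y, T*(-8*S*P^2 + T*P^2 + T*P*X) = y^2)
    (hn : ¬ (T % 2 = 0 ∧ S % 2 = 0 ∧ P % 2 = 0 ∧ X % 2 = 0)) : X % 2 = 1 := by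
  rcases Int.emod_two_eq_zero_or_one X with h | h
  · exfalso
    obtain ⟨X, rfl⟩ := Int.dvd_of_emod_eq_zero h
    have hTe : T % 2 = 0 := by
      rcases Int.emod_two_eq_zero_or_one T with h | h
      · exact h
      exfalso
      have e : ∃ w, T*T*(T*T) = 2*w := by
        refine ⟨16*T*S^2*P - 2*S^2*X^2 - 16*S*P^2*X - 96*T*S*P^2 + 32*T*S*P*X - 2*T^2*S*P - 2*T^2*S*X - 32*P^4 - 128*T*P^3
          + 4*T*P^2*X - 124*T^2*P^2 + 8*T*P*X^2 + 24*T^2*P*X - 16*T^3*P, ?_⟩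
        rw [ZK] at hK
        linear_combination -hK
      obtain ⟨w, hw⟩ := e
      have := om (om h h) (om h h)
      omega
    rcases Int.emod_two_eq_zero_or_one S with hS | hS
    · exact base_P hT hK h0 h1 h3 (by omega) hS hTe
    · exact base_S hT hP h0 h1 h2 hS hTe
  · exact h

lemma base_Dp {s p c d : ℚ} (h : Sp s p c d) (hS : SS s p) : Dp 0 s p (kap s p c) := by
  obtain ⟨T, S, P, X, hT, e1, e2, e3, hn⟩ := prim4 s p (kap s p c)
  have hTq : (T:ℚ) ≠ 0 := by exact_mod_cast hT
  have hz := h.ZK0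
  obtain ⟨-, -, hd⟩ := h.cd
  obtain ⟨⟨k0, h0⟩, ⟨k1, h1⟩, ⟨k2, h2⟩⟩ := hS
  refine ⟨T, S, P, X, base_int hT ?_ ?_ ?_ ?_ ?_ ?_ hn, hT, by linarith, by linarith, by linarith⟩
  · rintro rfl
    have : (T:ℚ)*p = 0 := by rw [e2]; simp
    rcases mul_eq_zero.1 this with h' | h'
    · exact hTq h'
    · exact h.p0 h'
  · have : ((ZK T S P X : ℤ) : ℚ) = 0 := by
      have : ((ZK T S P X : ℤ) : ℚ) = T^4*ZK 1 s p (kap s p c) := by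
        simp only [ZK]
        push_cast
        rw [← e1, ← e2, ← e3]; ring
      rw [this, hz, mul_zero]
    exact_mod_cast this
  · refine sq_of (k := 1) (y := T*k0) one_ne_zero ?_
    push_cast
    rw [← e2, h0]; ring
  · refine sq_of (k := 1) (y := T*k1) one_ne_zero ?_
    push_cast
    rw [← e2, ← e1]; linear_combination (T:ℚ)^2*h1
  · refine sq_of (k := 1) (y := T*k2) one_ne_zero ?_
    push_cast
    rw [← e2, ← e1]; linear_combination (T:ℚ)^2*h2
  · refine sq_of (k := 1) (y := T^2*d) one_ne_zero ?_
    push_cast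
    rw [← e2, ← e1, ← e3]; linear_combination -(T:ℚ)^4*hd

lemma all_Dp (n : ℕ) : ∀ {s p c d : ℚ}, Sp s p c d → SS s p → Dp (2*n) s p (kap s p c) := by
  induction n with
  | zero => intro s p c d h hS; exact base_Dp h hS
  | succ n ih =>
    intro s p c d h hS
    obtain ⟨s1, p1, c1, d1, h1, hS1, hd⟩ := h.halve hS
    exact (ih h1 hS1).dbl hd

lemma no_sp {s p c d : ℚ} (h : Sp s p c d) (hS : SS s p) : False :=
  Dp.unb (fun n => ⟨s, p, all_Dp n h hS⟩)

end QP

namespace QP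

lemma no_sp' {s p c d : ℚ} (h : Sp s p c d) : False := by
  obtain ⟨s', p', c', d', h1, h2, -⟩ := h.toSS
  exact no_sp h1 h2

section red
variable {k : Type} [Field k] [Algebra ℚ k]

lemma ind2 {w : k} (hw : w ∉ Set.range (algebraMap ℚ k)) {a b : ℚ} (h : algebraMap ℚ k a*w + algebraMap ℚ k b = 0) : a = 0 ∧ b = 0 := by
  have ha : a = 0 := by
    by_contra ha
    apply hw
    have ha' : algebraMap ℚ k a ≠ 0 := (map_ne_zero (algebraMap ℚ k)).2 ha
    refine ⟨-b / a, ?_⟩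
    rw [map_div₀, map_neg]
    field_simp
    linear_combination -h
  subst ha
  rw [map_zero, zero_mul, zero_add] at h
  exact ⟨rfl, (map_eq_zero (algebraMap ℚ k)).1 h⟩

lemma span2 (hk : Module.finrank ℚ k = 2) {w : k} (hw : w ∉ Set.range (algebraMap ℚ k)) (z : k) :
    ∃ c d : ℚ, z = algebraMap ℚ k c*w + algebraMap ℚ k d := by
  have hli : LinearIndependent ℚ ![w, 1] := by
    rw [LinearIndependent.pair_iff]
    intro a b h
    apply ind2 hw
    simpa [Algebra.smul_def] using h
  have hs := hli.span_eq_top_of_card_eq_finrank (by simp [hk])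
  have hz : z ∈ Submodule.span ℚ (Set.range ![w, 1]) := by rw [hs]; trivial
  simp only [Matrix.range_cons, Matrix.range_empty, Set.union_empty, Set.singleton_union] at hz
  obtain ⟨c, d, h⟩ := Submodule.mem_span_pair.1 hz
  exact ⟨c, d, by rw [← h]; simp [Algebra.smul_def]⟩

lemma red_irr (hk : Module.finrank ℚ k = 2) {w z : k} (hw : w ∉ Set.range (algebraMap ℚ k)) (hz : z ≠ 0)
    (h : z^2 = 8*w^5 + w^4 - 16*w^3 + 6*w^2 + w) : False := by
  obtain ⟨a, b, hab⟩ := span2 hk hw (w^2)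
  obtain ⟨c, d, rfl⟩ := span2 hk hw z
  obtain ⟨s, rfl⟩ : ∃ s, a = -s := ⟨-a, by ring⟩
  obtain ⟨p, rfl⟩ : ∃ p, b = -p := ⟨-b, by ring⟩
  have key : algebraMap ℚ k (8*(s^4-3*s^2*p+p^2)+(-s^3+2*s*p)-16*(s^2-p)-6*s+1 - (-s*c^2+2*c*d))*w +
      algebraMap ℚ k (8*(s^3*p-2*s*p^2)+(-s^2*p+p^2)-16*s*p-6*p - (d^2-p*c^2)) = 0 := by
    simp only [map_add, map_sub, map_mul, map_neg, map_pow, map_one, map_ofNat] at hab ⊢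
    generalize algebraMap ℚ k s = s at *
    generalize algebraMap ℚ k p = p at *
    generalize algebraMap ℚ k c = c at *
    generalize algebraMap ℚ k d = d at *
    linear_combination -h - (8*(w^3 - s*w^2 + (s^2-p)*w + (2*s*p - s^3)) + (w^2 - s*w + s^2 - p) - 16*(w - s) + 6 - c^2)*hab
  obtain ⟨e1, e0⟩ := ind2 hw key
  refine no_sp' (s := s) (p := p) (c := c) (d := d) ⟨?_, ?_, ?_, ?_⟩
  · intro r hr
    have hr' := congrArg (algebraMap ℚ k) hr
    simp only [map_add, map_mul, map_pow, map_neg, map_zero] at hr' hab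
    have : (w - algebraMap ℚ k r)*(w + algebraMap ℚ k r + algebraMap ℚ k s) = 0 := by
      linear_combination hab - hr'
    rcases mul_eq_zero.1 this with h' | h'
    · exact hw ⟨r, by linear_combination -h'⟩
    · exact hw ⟨-r - s, by rw [map_sub, map_neg]; linear_combination -h'⟩
  · linear_combination e1
  · linear_combination e0
  · by_contra hc
    push Not at hc
    obtain ⟨rfl, rfl⟩ := hc
    simp at hz

lemma red_rat (hk : Module.finrank ℚ k = 2) {t Y : k} {w : ℚ} (ht : t ∉ Set.range (algebraMap ℚ k)) (hY : Y ≠ 0)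
    (h : Y^2 = algebraMap ℚ k (w^4 - 2*w^2 + w)) (h2 : t^2 = algebraMap ℚ k (8*w + 1)) : w = 1 / 2 := by
  have hg : w^4 - 2*w^2 + w ≠ 0 := by
    intro h0
    rw [h0, map_zero] at h
    exact hY (by simpa using h)
  have hw0 : w ≠ 0 := by rintro rfl; norm_num at hg
  have hw1 : w ≠ 1 := by rintro rfl; norm_num at hg
  obtain ⟨c, d, rfl⟩ := span2 hk ht Y
  have key : algebraMap ℚ k (2*c*d)*t + algebraMap ℚ k (c^2*(8*w + 1) + d^2 - (w^4 - 2*w^2 + w)) = 0 := by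
    rw [map_sub, map_add, map_mul _ (c^2), ← h, ← h2]
    simp only [map_mul, map_pow, map_ofNat]
    ring
  obtain ⟨e1, e0⟩ := ind2 ht key
  have hcd : c*d = 0 := by linarith
  rcases mul_eq_zero.1 hcd with rfl | rfl
  · rcases EQ (w := w) (Y := d) (by linear_combination e0) with h' | h' | h'
    · exact absurd h' hw0
    · exact absurd h' hw1
    · exact h'
  · exfalso
    rcases lemR (w := w) (z := c*(8*w + 1)) (by linear_combination (8*w + 1)*e0) with h' | h' | h'
    · exact absurd h' hw0
    · exact absurd h' hw1
    · rw [h'] at h2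
      norm_num at h2
      exact ht ⟨0, by simp [h2]⟩

lemma final (hk : Module.finrank ℚ k = 2) (x y : k)
    (hxy : y^2 = 8*x^7 - 16*x^5 - 7*x^4 + 4*x^3 + 6*x^2 + 4*x + 1)
    (hx : x ∉ Set.range (algebraMap ℚ k)) (hy : y ≠ 0) : (2*x - 1)^2 = 5 := by
  have : CharZero k := algebraRat.charZero k
  have hx0 : x ≠ 0 := by rintro rfl; exact hx ⟨0, by simp⟩
  have ht : (1 + 2 / x) ∉ Set.range (algebraMap ℚ k) := by
    rintro ⟨q, hq⟩
    apply hx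
    have h1 : (algebraMap ℚ k q - 1)*x = 2 := by rw [hq]; field_simp; ring
    refine ⟨2 / (q - 1), ?_⟩
    have h2 : algebraMap ℚ k q - 1 ≠ 0 := by
      intro h0; rw [h0, zero_mul] at h1; norm_num at h1
    rw [map_div₀, map_sub, map_one, map_ofNat, ← h1]
    field_simp
  have hY : y / (4*x^4) ≠ 0 := div_ne_zero hy (mul_ne_zero (by norm_num) (pow_ne_zero 4 hx0))
  have hYY : (y / (4*x^4))^2 = ((x + 1) / (2*x^2))^4 - 2*((x + 1) / (2*x^2))^2 + (x + 1) / (2*x^2) := by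
    rw [div_pow, hxy]
    field_simp
    ring
  have htt : (1 + 2 / x)^2 = 8*((x + 1) / (2*x^2)) + 1 := by
    field_simp
    ring
  have hwx : (x + 1) / (2*x^2)*(2*x^2) = x + 1 := by field_simp
  generalize (x + 1) / (2*x^2) = w at *
  generalize y / (4*x^4) = Y at *
  generalize (1 + 2 / x) = t at *
  by_cases hw : w ∈ Set.range (algebraMap ℚ k)
  · obtain ⟨q, rfl⟩ := hw
    have := red_rat hk (w := q) ht hY (by rw [hYY]; simp) (by rw [htt]; simp)
    subst this
    simp only [one_div, map_inv₀, map_ofNat] at hwx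
    have : x^2 = x + 1 := by rw [← hwx]; field_simp
    linear_combination 4*this
  · exfalso
    have ht0 : t ≠ 0 := by rintro rfl; exact ht ⟨0, by simp⟩
    exact red_irr hk hw (mul_ne_zero ht0 hY) (by rw [mul_pow, hYY, htt]; ring)

end red

end QP

/-- Subsection 6.1: on the curve `y² = 8x⁷ - 16x⁵ - 7x⁴ + 4x³ + 6x² + 4x + 1`,
every quadratic point with non-rational `x`-coordinate and `y ≠ 0` satisfies
`(2x - 1)² = 5`, i.e. `x = (1 ± √5)/2`. -/
theorem stmt_12 (k : Type) [Field k] [Algebra ℚ k]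
    (hk : Module.finrank ℚ k = 2) (x y : k)
    (hxy : y ^ 2 = 8 * x ^ 7 - 16 * x ^ 5 - 7 * x ^ 4 + 4 * x ^ 3
        + 6 * x ^ 2 + 4 * x + 1)
    (hx : x ∉ Set.range (algebraMap ℚ k)) (hy : y ≠ 0) :
    (2 * x - 1) ^ 2 = 5 := by
  exact QP.final hk x y hxy hx hy
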